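/- arXiv:1807.11211 — 2 statements merged into one kernel-verified Lean document; each statement's English description precedes it below -/
import Mathlib

section
/- For every integer n ≥ 6, every triple system on an n-element vertex set with more than f(n) = ⌊n/3⌋·⌊(n+1)/3⌋·⌊(n+2)/3⌋ triples contains a Berge-K4 whose six triples together span at most 9 vertices (in particular, a Berge-K4 that is not the 10-vertex expansion of K4). -/
/-! ### Berge copies of `K₄` -/

/-- `H` contains a Berge-`K₄` whose six triples span at most nine vertices. -/
def HasShortBergeK4 {V : Type*} [DecidableEq V] (H : Finset (Finset V)) : Prop :=
  ∃ v₁ v₂ v₃ v₄ : V, ∃ e₁₂ e₁₃ e₁₄ e₂₃ e₂₄ e₃₄ : Finset V,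
    v₁ ≠ v₂ ∧ v₁ ≠ v₃ ∧ v₁ ≠ v₄ ∧ v₂ ≠ v₃ ∧ v₂ ≠ v₄ ∧ v₃ ≠ v₄ ∧
    ([e₁₂, e₁₃, e₁₄, e₂₃, e₂₄, e₃₄] : List (Finset V)).Nodup ∧
    e₁₂ ∈ H ∧ e₁₃ ∈ H ∧ e₁₄ ∈ H ∧ e₂₃ ∈ H ∧ e₂₄ ∈ H ∧ e₃₄ ∈ H ∧
    {v₁, v₂} ⊆ e₁₂ ∧ {v₁, v₃} ⊆ e₁₃ ∧ {v₁, v₄} ⊆ e₁₄ ∧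
    {v₂, v₃} ⊆ e₂₃ ∧ {v₂, v₄} ⊆ e₂₄ ∧ {v₃, v₄} ⊆ e₃₄ ∧
    (e₁₂ ∪ e₁₃ ∪ e₁₄ ∪ e₂₃ ∪ e₂₄ ∪ e₃₄).card ≤ 9

lemma HasShortBergeK4.mono {V : Type*} [DecidableEq V] {H H' : Finset (Finset V)}
    (h : HasShortBergeK4 H) (hH : H ⊆ H') : HasShortBergeK4 H' := by
  obtain ⟨v₁, v₂, v₃, v₄, e₁₂, e₁₃, e₁₄, e₂₃, e₂₄, e₃₄, n₁, n₂, n₃, n₄, n₅, n₆, hnd,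
    h₁, h₂, h₃, h₄, h₅, h₆, hrest⟩ := h
  exact ⟨v₁, v₂, v₃, v₄, e₁₂, e₁₃, e₁₄, e₂₃, e₂₄, e₃₄, n₁, n₂, n₃, n₄, n₅, n₆, hnd,
    hH h₁, hH h₂, hH h₃, hH h₄, hH h₅, hH h₆, hrest⟩

/-- A system of distinct representatives for the pairs in a 4-set gives a Berge-`K₄`. -/
lemma hasShortBergeK4_of_injOn {V : Type*} [DecidableEq V] {H : Finset (Finset V)}
    {K : Finset V} (hK : K.card = 4) (m : Finset V → Finset V)
    (hinj : Set.InjOn m (K.powersetCard 2)) (hm : ∀ p ∈ K.powersetCard 2, m p ∈ H ∧ p ⊆ m p)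
    (hspan : ((K.powersetCard 2).biUnion m).card ≤ 9) : HasShortBergeK4 H := by
  obtain ⟨a, b, c, d, hab, hac, had, hbc, hbd, hcd, rfl⟩ := Finset.card_eq_four.1 hK
  have hp : ∀ u v, u ≠ v → u ∈ ({a, b, c, d} : Finset V) → v ∈ ({a, b, c, d} : Finset V) →
      {u, v} ∈ Finset.powersetCard 2 ({a, b, c, d} : Finset V) := by
    intro u v huv hu hv
    rw [Finset.mem_powersetCard]
    exact ⟨Finset.insert_subset hu (Finset.singleton_subset_iff.2 hv), Finset.card_pair huv⟩
  have h₁ := hp a b hab (by simp) (by simp)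
  have h₂ := hp a c hac (by simp) (by simp)
  have h₃ := hp a d had (by simp) (by simp)
  have h₄ := hp b c hbc (by simp) (by simp)
  have h₅ := hp b d hbd (by simp) (by simp)
  have h₆ := hp c d hcd (by simp) (by simp)
  refine ⟨a, b, c, d, m {a, b}, m {a, c}, m {a, d}, m {b, c}, m {b, d}, m {c, d}, hab, hac, had,
    hbc, hbd, hcd, ?_, (hm _ h₁).1, (hm _ h₂).1, (hm _ h₃).1, (hm _ h₄).1, (hm _ h₅).1,
    (hm _ h₆).1, (hm _ h₁).2, (hm _ h₂).2, (hm _ h₃).2, (hm _ h₄).2, (hm _ h₅).2, (hm _ h₆).2,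
    (Finset.card_le_card ?_).trans hspan⟩
  · have hne : ∀ p q, p ∈ Finset.powersetCard 2 ({a, b, c, d} : Finset V) →
        q ∈ Finset.powersetCard 2 ({a, b, c, d} : Finset V) → (∃ x, x ∈ p ∧ x ∉ q) →
        m p ≠ m q := by
      rintro p q hp hq ⟨x, hxp, hxq⟩ h
      exact hxq (hinj hp hq h ▸ hxp)
    simp only [List.nodup_cons, List.mem_cons, List.not_mem_nil, or_false, not_or,
      not_false_eq_true, List.nodup_nil, and_true]
    refine ⟨⟨?_, ?_, ?_, ?_, ?_⟩, ⟨?_, ?_, ?_, ?_⟩, ⟨?_, ?_, ?_⟩, ⟨?_, ?_⟩, ?_⟩ <;>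
      refine hne _ _ (by assumption) (by assumption) ?_ <;>
      simp [hab, hac, had, hbc, hbd, hcd, hab.symm, hac.symm, hbc.symm, hbd.symm, hcd.symm]
  · simp only [Finset.union_subset_iff]
    exact ⟨⟨⟨⟨⟨Finset.subset_biUnion_of_mem m h₁, Finset.subset_biUnion_of_mem m h₂⟩,
      Finset.subset_biUnion_of_mem m h₃⟩, Finset.subset_biUnion_of_mem m h₄⟩,
      Finset.subset_biUnion_of_mem m h₅⟩, Finset.subset_biUnion_of_mem m h₆⟩

/-! ### Exhaustive search on at most eight vertices -/

namespace SmallSearch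

/-- The triples of `{0, …, 7}` in colexicographic order. A set of triples is encoded by the natural
number whose binary digits are the indicator function of the positions in this list. -/
def triples : List (ℕ × ℕ × ℕ) :=
  (List.range 8).flatMap fun k => (List.range k).flatMap fun j => (List.range j).map fun i =>
    (i, j, k)

/-- A list of pairs of vertices inside a common 4-set, each given by the code `e` of the set of
triples meeting the 4-set in exactly that pair and by the codes `a`, `b` of the two triples
inside the 4-set that contain the pair. -/
inductive Rows
  | nil
  | cons (e a b : ℕ) (r : Rows)

/-- A list of 4-sets `{i, j, k, l}`, each with the rows of its six pairs. -/
inductive Quads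
  | nil
  | cons (i j k l : ℕ) (r : Rows) (q : Quads)

/-- Whether the pairs in `r` can be assigned distinct triples of the set coded by `g`. The
definition, like the next two, is in terms of recursors since the kernel evaluates it. -/
noncomputable def hasSDR (r : Rows) : ℕ → Bool :=
  Rows.rec (motive := fun _ => ℕ → Bool) (fun _ => true) (fun e a b _ ih g =>
    Bool.rec (motive := fun _ => Bool) (ih (Nat.xor g (Nat.land g e)))
      (Bool.rec (motive := fun _ => Bool)
        (Bool.rec (motive := fun _ => Bool)
          (Bool.rec (motive := fun _ => Bool) (ih (Nat.xor g (Nat.land g b))) false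
            (Nat.beq (Nat.land g b) 0))
          true
          (ih (Nat.xor g (Nat.land g a))))
        (Bool.rec (motive := fun _ => Bool) (ih (Nat.xor g (Nat.land g b))) false
          (Nat.beq (Nat.land g b) 0))
        (Nat.beq (Nat.land g a) 0))
      (Nat.beq (Nat.land g e) 0)) r

/-- Whether some 4-set in `q` is the core of a Berge-`K₄` in the set coded by `g`. -/
noncomputable def bad (q : Quads) (g : ℕ) : Bool :=
  Quads.rec (motive := fun _ => Bool) false (fun _ _ _ _ r _ ih =>
    Bool.rec (motive := fun _ => Bool) ih true (hasSDR r g)) q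

/-- Whether every set without a Berge-`K₄` obtained from the set coded by `g` by adding at least
`need` of the triples in `l`, where `n` is the length of `l`, has a code satisfying `q`. -/
noncomputable def search (qs : Quads) (q : ℕ → Bool) (l : List ℕ) : ℕ → ℕ → ℕ → Bool :=
  List.rec (motive := fun _ => ℕ → ℕ → ℕ → Bool)
    (fun _ need g => Bool.rec (motive := fun _ => Bool) true (q g) (Nat.beq need 0))
    (fun t _ ih n need g => Bool.rec (motive := fun _ => Bool) true
      (Nat.rec (motive := fun _ => Bool) true (fun g' _ =>
        Bool.rec (motive := fun _ => Bool) false (ih (Nat.pred n) need g)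
          (Bool.rec (motive := fun _ => Bool) (ih (Nat.pred n) (Nat.pred need) (Nat.succ g')) true
            (bad qs (Nat.succ g'))))
        (Nat.lor g (Nat.pow 2 t)))
      (Nat.ble need n)) l

/-- `ts` picks one triple from each row. -/
def Rows.Selects : Rows → List ℕ → Prop
  | .nil, ts => ts = []
  | .cons e a b r, ts => ∃ t ts', ts = t :: ts' ∧
      (e ||| a ||| b).testBit t = true ∧ r.Selects ts'

lemma exists_testBit_land {g e : ℕ} (h : Nat.beq (Nat.land g e) 0 = false) :
    ∃ t, g.testBit t = true ∧ e.testBit t = true := by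
  have h0 : g &&& e ≠ 0 := by
    intro h1
    rw [show Nat.land g e = 0 from h1] at h
    simp at h
  obtain ⟨t, ht⟩ := Nat.exists_testBit_of_ne_zero h0
  exact ⟨t, by simpa [Nat.testBit_land] using ht⟩

lemma exists_selects_of_hasSDR (r : Rows) (g : ℕ) (h : hasSDR r g = true) :
    ∃ ts, r.Selects ts ∧ ts.Nodup ∧ ∀ t ∈ ts, g.testBit t = true := by
  induction r generalizing g with
  | nil => exact ⟨[], rfl, List.nodup_nil, by simp⟩
  | cons e a b r ih =>
    have step : ∀ m : ℕ, (∀ t, m.testBit t = true → (e ||| a ||| b).testBit t = true) →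
        Nat.beq (Nat.land g m) 0 = false → hasSDR r (Nat.xor g (Nat.land g m)) = true →
        ∃ ts, (Rows.cons e a b r).Selects ts ∧ ts.Nodup ∧ ∀ t ∈ ts, g.testBit t = true := by
      intro m hm h0 h1
      obtain ⟨t, htg, htm⟩ := exists_testBit_land h0
      obtain ⟨ts, hs, hnd, hts⟩ := ih _ h1
      have key : ∀ t' ∈ ts, g.testBit t' = true ∧ m.testBit t' = false := by
        intro t' ht'
        have h2 := hts t' ht'
        rw [show Nat.xor g (Nat.land g m) = g ^^^ (g &&& m) from rfl, Nat.testBit_xor,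
          Nat.testBit_land] at h2
        revert h2
        cases g.testBit t' <;> cases m.testBit t' <;> simp
      refine ⟨t :: ts, ⟨t, ts, rfl, hm t htm, hs⟩, List.nodup_cons.2 ⟨fun hmem => ?_, hnd⟩, ?_⟩
      · have := (key t hmem).2
        rw [htm] at this
        exact absurd this (by simp)
      · intro t' ht'
        rcases List.mem_cons.1 ht' with rfl | ht'
        exacts [htg, (key t' ht').1]
    have he : ∀ t, e.testBit t = true → (e ||| a ||| b).testBit t = true := by
      intro t ht; simp [ht]
    have ha : ∀ t, a.testBit t = true → (e ||| a ||| b).testBit t = true := by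
      intro t ht; simp [ht]
    have hb : ∀ t, b.testBit t = true → (e ||| a ||| b).testBit t = true := by
      intro t ht; simp [ht]
    change Bool.rec (motive := fun _ => Bool) (hasSDR r (Nat.xor g (Nat.land g e)))
      (Bool.rec (motive := fun _ => Bool)
        (Bool.rec (motive := fun _ => Bool)
          (Bool.rec (motive := fun _ => Bool) (hasSDR r (Nat.xor g (Nat.land g b))) false
            (Nat.beq (Nat.land g b) 0))
          true
          (hasSDR r (Nat.xor g (Nat.land g a))))
        (Bool.rec (motive := fun _ => Bool) (hasSDR r (Nat.xor g (Nat.land g b))) false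
          (Nat.beq (Nat.land g b) 0))
        (Nat.beq (Nat.land g a) 0))
      (Nat.beq (Nat.land g e) 0) = true at h
    rcases hE : Nat.beq (Nat.land g e) 0 with _ | _
    · rw [hE] at h
      exact step e he hE h
    rcases hB : Nat.beq (Nat.land g b) 0 with _ | _
    · rcases hA : Nat.beq (Nat.land g a) 0 with _ | _
      · rcases hR : hasSDR r (Nat.xor g (Nat.land g a)) with _ | _
        · rw [hE, hA, hB, hR] at h
          exact step b hb hB h
        · exact step a ha hA hR
      · rw [hE, hA, hB] at h
        exact step b hb hB h
    · rcases hA : Nat.beq (Nat.land g a) 0 with _ | _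
      · rcases hR : hasSDR r (Nat.xor g (Nat.land g a)) with _ | _
        · rw [hE, hA, hB, hR] at h
          simp at h
        · exact step a ha hA hR
      · rw [hE, hA, hB] at h
        simp at h

lemma exists_of_search (qs : Quads) (q : ℕ → Bool) (χ : ℕ → Prop) [DecidablePred χ]
    (hbad : ∀ g : ℕ, (∀ t, g.testBit t = true → χ t) → bad qs g = false) (l : List ℕ)
    (n need g : ℕ) (hn : l.length = n) (hg : ∀ t, g.testBit t = true → χ t)
    (h : search qs q l n need g = true) (hneed : need ≤ (l.filter χ).length) :
    ∃ g' : ℕ, q g' = true ∧ ∀ t, g'.testBit t = true ↔ g.testBit t = true ∨ t ∈ l ∧ χ t := by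
  induction l generalizing n need g with
  | nil =>
    obtain rfl : need = 0 := by simpa using hneed
    exact ⟨g, h, by simp⟩
  | cons t l ih =>
    have hle : Nat.ble need n = true := by
      rw [Nat.ble_eq, ← hn]
      exact hneed.trans (List.length_filter_le _ _)
    have hbit : ∀ s, (g ||| 2 ^ t).testBit s = true ↔ g.testBit s = true ∨ s = t := by
      intro s
      rw [Nat.testBit_or, Nat.testBit_two_pow, Bool.or_eq_true, decide_eq_true_eq,
        @eq_comm _ t s]
    obtain ⟨g', hg'⟩ : ∃ g', g ||| 2 ^ t = g' + 1 := by
      refine Nat.exists_eq_succ_of_ne_zero fun h0 => ?_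
      have := (hbit t).2 (Or.inr rfl)
      rw [h0] at this
      simp at this
    change Bool.rec (motive := fun _ => Bool) true
      (Nat.rec (motive := fun _ => Bool) true (fun g' _ =>
        Bool.rec (motive := fun _ => Bool) false (search qs q l (Nat.pred n) need g)
          (Bool.rec (motive := fun _ => Bool)
            (search qs q l (Nat.pred n) (Nat.pred need) (Nat.succ g')) true
            (bad qs (Nat.succ g'))))
        (g ||| 2 ^ t)) (Nat.ble need n) = true at h
    rw [hle, hg'] at h
    change Bool.rec (motive := fun _ => Bool) false (search qs q l (Nat.pred n) need g)
          (Bool.rec (motive := fun _ => Bool)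
            (search qs q l (Nat.pred n) (Nat.pred need) (g' + 1)) true
            (bad qs (g' + 1))) = true at h
    have hn' : l.length = Nat.pred n := by simp [← hn]
    by_cases hχ : χ t
    · have hg2 : ∀ s, (g' + 1).testBit s = true → χ s := by
        intro s hs
        rw [← hg', hbit] at hs
        rcases hs with hs | rfl
        exacts [hg s hs, hχ]
      rw [hbad _ hg2] at h
      have h2 : search qs q l (Nat.pred n) (Nat.pred need) (g' + 1) = true := by
        revert h
        cases search qs q l (Nat.pred n) (Nat.pred need) (g' + 1) <;> simp
      rw [List.filter_cons_of_pos (by simpa using hχ), List.length_cons] at hneed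
      obtain ⟨f, hf, hft⟩ := ih _ _ _ hn' hg2 h2 (by simpa using Nat.pred_le_pred hneed)
      refine ⟨f, hf, fun s => ?_⟩
      rw [hft, ← hg', hbit, List.mem_cons]
      constructor
      · rintro ((h | rfl) | h)
        exacts [Or.inl h, Or.inr ⟨Or.inl rfl, hχ⟩, Or.inr ⟨Or.inr h.1, h.2⟩]
      · rintro (h | ⟨rfl | h, h'⟩)
        exacts [Or.inl (Or.inl h), Or.inl (Or.inr rfl), Or.inr ⟨h, h'⟩]
    · have h2 : search qs q l (Nat.pred n) need g = true := by
        revert h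
        generalize Bool.rec (motive := fun _ => Bool)
            (search qs q l (Nat.pred n) (Nat.pred need) (g' + 1)) true
            (bad qs (g' + 1)) = b
        cases b <;> simp
      rw [List.filter_cons_of_neg (by simpa using hχ)] at hneed
      obtain ⟨f, hf, hft⟩ := ih _ _ _ hn' hg h2 hneed
      refine ⟨f, hf, fun s => ?_⟩
      rw [hft, List.mem_cons]
      constructor
      · rintro (h | h)
        exacts [Or.inl h, Or.inr ⟨Or.inr h.1, h.2⟩]
      · rintro (h | ⟨rfl | h, h'⟩)
        exacts [Or.inl h, absurd h' hχ, Or.inr ⟨h, h'⟩]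

/-- The triple at position `t` of the list `triples`. -/
def tripleAt (t : ℕ) : Finset ℕ :=
  let p := triples.getD t (0, 0, 0)
  {p.1, p.2.1, p.2.2}

/-- The code of the set of all triples that contain the pair `{i, j}`. -/
def pairCode (i j : ℕ) : ℕ :=
  (List.range 56).foldr (fun t s => if i ∈ tripleAt t ∧ j ∈ tripleAt t then s ||| 2 ^ t else s) 0

/-- The row `e, a, b` belongs to the pair `{i, j}`. -/
def Rows.HeadValid (i j : ℕ) : Rows → Prop
  | .nil => False
  | .cons e a b _ => e ||| a ||| b = pairCode i j

/-- The list of rows without its head. -/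
def Rows.tail : Rows → Rows
  | .nil => .nil
  | .cons _ _ _ r => r

instance (i j : ℕ) : DecidablePred (Rows.HeadValid i j)
  | .nil => inferInstanceAs (Decidable False)
  | .cons e a b _ => inferInstanceAs (Decidable (e ||| a ||| b = pairCode i j))

/-- The rows in `q` belong to the pairs of the 4-sets in `q`, which are subsets of `{0, …, K-1}`. -/
def Quads.Valid (K : ℕ) : Quads → Prop
  | .nil => True
  | .cons i j k l r q => (i < j ∧ j < k ∧ k < l ∧ l < K) ∧ (r.HeadValid i j ∧
      r.tail.HeadValid i k ∧ r.tail.tail.HeadValid i l ∧ r.tail.tail.tail.HeadValid j k ∧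
      r.tail.tail.tail.tail.HeadValid j l ∧ r.tail.tail.tail.tail.tail.HeadValid k l) ∧
      q.Valid K

instance Quads.decidableValid (K : ℕ) : DecidablePred (Quads.Valid K)
  | .nil => inferInstanceAs (Decidable True)
  | .cons _ _ _ _ _ q =>
    have := Quads.decidableValid K q
    inferInstanceAs (Decidable ((_ ∧ _ ∧ _ ∧ _) ∧ (_ ∧ _ ∧ _ ∧ _ ∧ _ ∧ _) ∧ _))

lemma tripleAt_spec : ∀ K < 9, ∀ t < K.choose 3,
    tripleAt t ⊆ Finset.range K ∧ (tripleAt t).card = 3 := by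
  decide +kernel

lemma exists_tripleAt_eq : ∀ K < 9, ∀ s ∈ (Finset.range K).powersetCard 3,
    ∃ t < K.choose 3, tripleAt t = s := by
  decide +kernel

lemma tripleAt_injOn : ∀ t < 56, ∀ t' < 56, tripleAt t = tripleAt t' → t = t' := by
  decide +kernel

lemma mem_tripleAt_of_testBit_pairCode {i j t : ℕ} (h : (pairCode i j).testBit t = true) :
    i ∈ tripleAt t ∧ j ∈ tripleAt t := by
  rw [pairCode] at h
  generalize List.range 56 = l at h
  induction l with
  | nil => simp at h
  | cons a l ih =>
    rw [List.foldr_cons] at h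
    split_ifs at h with ha
    · rw [Nat.testBit_or, Nat.testBit_two_pow, Bool.or_eq_true, decide_eq_true_eq] at h
      rcases h with h | rfl
      exacts [ih h, ha]
    · exact ih h

/-- Some 4-subsets of the first six vertices. -/
def quads6 : Quads :=
  .cons 0 1 2 3 (.cons 34360787984 1 2 <| .cons 68721575968 1 4 <| .cons 274886303872 2 4 <| .cons 137443151936 1 8 <| .cons 549772607744 2 8 <| .cons 1099545215488 4 8 <| .nil) <|
  .cons 0 1 2 4 (.cons 34360787970 1 16 <| .cons 68721575940 1 32 <| .cons 2199090430080 16 32 <| .cons 137443151880 1 64 <| .cons 4398180860160 16 64 <| .cons 8796361720320 32 64 <| .nil) <|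
  .cons 0 1 3 4 (.cons 34360787969 2 16 <| .cons 274886303748 2 128 <| .cons 2199090429984 16 128 <| .cons 549772607496 2 256 <| .cons 4398180859968 16 256 <| .cons 17592723440128 128 256 <| .nil) <|
  .cons 0 2 3 4 (.cons 68721575937 4 32 <| .cons 274886303746 4 128 <| .cons 2199090429968 32 128 <| .cons 1099545214984 4 512 <| .cons 8796361719872 32 512 <| .cons 17592723439872 128 512 <| .nil) <|
  .cons 1 2 3 4 (.cons 137443151873 8 64 <| .cons 549772607490 8 256 <| .cons 4398180859920 64 256 <| .cons 1099545214980 8 512 <| .cons 8796361719840 64 512 <| .cons 17592723439744 256 512 <| .nil) <|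
  .cons 0 1 2 5 (.cons 34360786962 1 1024 <| .cons 68721573924 1 2048 <| .cons 35185445904384 1024 2048 <| .cons 137443147848 1 4096 <| .cons 70370891808768 1024 4096 <| .cons 140741783617536 2048 4096 <| .nil) <|
  .cons 0 1 3 5 (.cons 34360786961 2 1024 <| .cons 274886295684 2 8192 <| .cons 35185445898240 1024 8192 <| .cons 549772591368 2 16384 <| .cons 70370891796480 1024 16384 <| .cons 281483567202304 8192 16384 <| .nil) <|
  .cons 0 2 3 5 (.cons 68721573921 4 2048 <| .cons 274886295682 4 8192 <| .cons 35185445897216 2048 8192 <| .cons 1099545182728 4 32768 <| .cons 140741783588864 2048 32768 <| .cons 281483567185920 8192 32768 <| .nil) <|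
  .cons 1 2 3 5 (.cons 137443147841 8 4096 <| .cons 549772591362 8 16384 <| .cons 70370891793408 4096 16384 <| .cons 1099545182724 8 32768 <| .cons 140741783586816 4096 32768 <| .cons 281483567177728 16384 32768 <| .nil) <|
  .cons 0 1 4 5 (.cons 34360786947 16 1024 <| .cons 2199090364576 16 65536 <| .cons 35185445840896 1024 65536 <| .cons 4398180729152 16 131072 <| .cons 70370891681792 1024 131072 <| .cons 562967134076928 65536 131072 <| .nil) <|
  .cons 0 2 4 5 (.cons 68721573893 32 2048 <| .cons 2199090364560 32 65536 <| .cons 35185445839872 2048 65536 <| .cons 8796361458240 32 262144 <| .cons 140741783359488 2048 262144 <| .cons 562967133945856 65536 262144 <| .nil) <|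
  .cons 1 2 4 5 (.cons 137443147785 64 4096 <| .cons 4398180729104 64 131072 <| .cons 70370891678720 4096 131072 <| .cons 8796361458208 64 262144 <| .cons 140741783357440 4096 262144 <| .cons 562967133880320 131072 262144 <| .nil) <|
  .cons 0 3 4 5 (.cons 274886295558 128 8192 <| .cons 2199090364464 128 65536 <| .cons 35185445833728 8192 65536 <| .cons 17592722916096 128 524288 <| .cons 281483566694400 8192 524288 <| .cons 562967133683712 65536 524288 <| .nil) <|
  .cons 1 3 4 5 (.cons 549772591114 256 16384 <| .cons 4398180728912 256 131072 <| .cons 70370891666432 16384 131072 <| .cons 17592722915968 256 524288 <| .cons 281483566686208 16384 524288 <| .cons 562967133618176 131072 524288 <| .nil) <|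
  .cons 2 3 4 5 (.cons 1099545182220 512 32768 <| .cons 8796361457760 512 262144 <| .cons 140741783328768 32768 262144 <| .cons 17592722915712 512 524288 <| .cons 281483566669824 32768 524288 <| .cons 562967133487104 262144 524288 <| .nil) <|
  .nil
/-- Some 4-subsets of the first seven vertices. -/
def quads7 : Quads :=
  .cons 0 1 2 6 (.cons 34359739410 1 1048576 <| .cons 68719478820 1 2097152 <| .cons 1125901056081920 1048576 2097152 <| .cons 137438957640 1 4194304 <| .cons 2251802112163840 1048576 4194304 <| .cons 4503604224327680 2097152 4194304 <| .nil) <|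
  .cons 0 1 3 6 (.cons 34359739409 2 1048576 <| .cons 274877915268 2 8388608 <| .cons 1125901049790464 1048576 8388608 <| .cons 549755830536 2 16777216 <| .cons 2251802099580928 1048576 16777216 <| .cons 9007208415100928 8388608 16777216 <| .nil) <|
  .cons 0 2 3 6 (.cons 68719478817 4 2097152 <| .cons 274877915266 4 8388608 <| .cons 1125901048741888 2097152 8388608 <| .cons 1099511661064 4 33554432 <| .cons 4503604194967552 2097152 33554432 <| .cons 9007208398323712 8388608 33554432 <| .nil) <|
  .cons 1 2 3 6 (.cons 137438957633 8 4194304 <| .cons 549755830530 8 16777216 <| .cons 2251802096435200 4194304 16777216 <| .cons 1099511661060 8 33554432 <| .cons 4503604192870400 4194304 33554432 <| .cons 9007208389935104 16777216 33554432 <| .nil) <|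
  .cons 0 1 4 6 (.cons 34359739395 16 1048576 <| .cons 2199023321248 16 67108864 <| .cons 1125900991070208 1048576 67108864 <| .cons 4398046642496 16 134217728 <| .cons 2251801982140416 1048576 134217728 <| .cons 18014416494657536 67108864 134217728 <| .nil) <|
  .cons 0 2 4 6 (.cons 68719478789 32 2097152 <| .cons 2199023321232 32 67108864 <| .cons 1125900990021632 2097152 67108864 <| .cons 8796093284928 32 268435456 <| .cons 4503603960086528 2097152 268435456 <| .cons 18014416360439808 67108864 268435456 <| .nil) <|
  .cons 1 2 4 6 (.cons 137438957577 64 4194304 <| .cons 4398046642448 64 134217728 <| .cons 2251801978994688 4194304 134217728 <| .cons 8796093284896 64 268435456 <| .cons 4503603957989376 4194304 268435456 <| .cons 18014416293330944 134217728 268435456 <| .nil) <|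
  .cons 0 3 4 6 (.cons 274877915142 128 8388608 <| .cons 2199023321136 128 67108864 <| .cons 1125900983730176 8388608 67108864 <| .cons 17592186569472 128 536870912 <| .cons 9007207895007232 8388608 536870912 <| .cons 18014416092004352 67108864 536870912 <| .nil) <|
  .cons 1 3 4 6 (.cons 549755830282 256 16777216 <| .cons 4398046642256 256 134217728 <| .cons 2251801966411776 16777216 134217728 <| .cons 17592186569344 256 536870912 <| .cons 9007207886618624 16777216 536870912 <| .cons 18014416024895488 134217728 536870912 <| .nil) <|
  .cons 2 3 4 6 (.cons 1099511660556 512 33554432 <| .cons 8796093284448 512 268435456 <| .cons 4503603928629248 33554432 268435456 <| .cons 17592186569088 512 536870912 <| .cons 9007207869841408 33554432 536870912 <| .cons 18014415890677760 268435456 536870912 <| .nil) <|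
  .cons 0 1 5 6 (.cons 34359738387 1024 1048576 <| .cons 35184372164608 1024 1073741824 <| .cons 1125899984437248 1048576 1073741824 <| .cons 70368744329216 1024 2147483648 <| .cons 2251799968874496 1048576 2147483648 <| .cons 36028827083735040 1073741824 2147483648 <| .nil) <|
  .cons 0 2 5 6 (.cons 68719476773 2048 2097152 <| .cons 35184372163584 2048 1073741824 <| .cons 1125899983388672 2097152 1073741824 <| .cons 140737488654336 2048 4294967296 <| .cons 4503599933554688 2097152 4294967296 <| .cons 36028824936251392 1073741824 4294967296 <| .nil) <|
  .cons 1 2 5 6 (.cons 137438953545 4096 4194304 <| .cons 70368744326144 4096 2147483648 <| .cons 2251799965728768 4194304 2147483648 <| .cons 140737488652288 4096 4294967296 <| .cons 4503599931457536 4194304 4294967296 <| .cons 36028823862509568 2147483648 4294967296 <| .nil) <|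
  .cons 0 3 5 6 (.cons 274877907078 8192 8388608 <| .cons 35184372157440 8192 1073741824 <| .cons 1125899977097216 8388608 1073741824 <| .cons 281474977284096 8192 8589934592 <| .cons 9007199841943552 8388608 8589934592 <| .cons 36028820641284096 1073741824 8589934592 <| .nil) <|
  .cons 1 3 5 6 (.cons 549755814154 16384 16777216 <| .cons 70368744313856 16384 2147483648 <| .cons 2251799953145856 16777216 2147483648 <| .cons 281474977275904 16384 8589934592 <| .cons 9007199833554944 16777216 8589934592 <| .cons 36028819567542272 2147483648 8589934592 <| .nil) <|
  .cons 2 3 5 6 (.cons 1099511628300 32768 33554432 <| .cons 140737488623616 32768 4294967296 <| .cons 4503599902097408 33554432 4294967296 <| .cons 281474977259520 32768 8589934592 <| .cons 9007199816777728 33554432 8589934592 <| .cons 36028817420058624 4294967296 8589934592 <| .nil) <|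
  .cons 0 4 5 6 (.cons 2199023255728 65536 67108864 <| .cons 35184372100096 65536 1073741824 <| .cons 1125899918376960 67108864 1073741824 <| .cons 562949954338816 65536 17179869184 <| .cons 18014399449006080 67108864 17179869184 <| .cons 36028812051349504 1073741824 17179869184 <| .nil) <|
  .cons 1 4 5 6 (.cons 4398046511440 131072 134217728 <| .cons 70368744199168 131072 2147483648 <| .cons 2251799835705344 134217728 2147483648 <| .cons 562949954273280 131072 17179869184 <| .cons 18014399381897216 134217728 17179869184 <| .cons 36028810977607680 2147483648 17179869184 <| .nil) <|
  .cons 2 4 5 6 (.cons 8796093022816 262144 268435456 <| .cons 140737488394240 262144 4294967296 <| .cons 4503599667216384 268435456 4294967296 <| .cons 562949954142208 262144 17179869184 <| .cons 18014399247679488 268435456 17179869184 <| .cons 36028808830124032 4294967296 17179869184 <| .nil) <|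
  .cons 3 4 5 6 (.cons 17592186045312 524288 536870912 <| .cons 281474976768000 524288 8589934592 <| .cons 9007199313461248 536870912 8589934592 <| .cons 562949953880064 524288 17179869184 <| .cons 18014398979244032 536870912 17179869184 <| .cons 36028804535156736 8589934592 17179869184 <| .nil) <|
  quads6
/-- Some 4-subsets of the first eight vertices. -/
def quads8 : Quads :=
  .cons 0 1 2 7 (.cons 1049618 1 34359738368 <| .cons 2099236 1 68719476736 <| .cons 1163558180093952 34359738368 68719476736 <| .cons 4198472 1 137438953472 <| .cons 2327116360187904 34359738368 137438953472 <| .cons 4654232720375808 68719476736 137438953472 <| .nil) <|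
  .cons 0 1 3 7 (.cons 1049617 2 34359738368 <| .cons 8396932 2 274877906944 <| .cons 1163352021663744 34359738368 274877906944 <| .cons 16793864 2 549755813888 <| .cons 2326704043327488 34359738368 549755813888 <| .cons 9307365929123840 274877906944 549755813888 <| .nil) <|
  .cons 0 2 3 7 (.cons 2099233 4 68719476736 <| .cons 8396930 4 274877906944 <| .cons 1163317661925376 68719476736 274877906944 <| .cons 33587720 4 1099511627776 <| .cons 4653270647701504 68719476736 1099511627776 <| .cons 9306816173309952 274877906944 1099511627776 <| .nil) <|
  .cons 1 2 3 7 (.cons 4198465 8 137438953472 <| .cons 16793858 8 549755813888 <| .cons 2326600964112384 137438953472 549755813888 <| .cons 33587716 8 1099511627776 <| .cons 4653201928224768 137438953472 1099511627776 <| .cons 9306541295403008 549755813888 1099511627776 <| .nil) <|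
  .cons 0 1 4 7 (.cons 1049603 16 34359738368 <| .cons 67174560 16 2199023255552 <| .cons 1161427876315136 34359738368 2199023255552 <| .cons 134349120 16 4398046511104 <| .cons 2322855752630272 34359738368 4398046511104 <| .cons 18603736741969920 2199023255552 4398046511104 <| .nil) <|
  .cons 0 2 4 7 (.cons 2099205 32 68719476736 <| .cons 67174544 32 2199023255552 <| .cons 1161393516576768 68719476736 2199023255552 <| .cons 268698176 32 8796093022208 <| .cons 4645574066307072 68719476736 8796093022208 <| .cons 18599338695458816 2199023255552 8796093022208 <| .nil) <|
  .cons 1 2 4 7 (.cons 4198409 64 137438953472 <| .cons 134349072 64 4398046511104 <| .cons 2322752673415168 137438953472 4398046511104 <| .cons 268698144 64 8796093022208 <| .cons 4645505346830336 137438953472 8796093022208 <| .cons 18597139672203264 4398046511104 8796093022208 <| .nil) <|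
  .cons 0 3 4 7 (.cons 8396806 128 274877906944 <| .cons 67174448 128 2199023255552 <| .cons 1161187358146560 274877906944 2199023255552 <| .cons 537395968 128 17592186044416 <| .cons 9290323498893312 274877906944 17592186044416 <| .cons 18590542602436608 2199023255552 17592186044416 <| .nil) <|
  .cons 1 3 4 7 (.cons 16793610 256 549755813888 <| .cons 134348880 256 4398046511104 <| .cons 2322340356554752 549755813888 4398046511104 <| .cons 537395840 256 17592186044416 <| .cons 9290048620986368 549755813888 17592186044416 <| .cons 18588343579181056 4398046511104 17592186044416 <| .nil) <|
  .cons 2 3 4 7 (.cons 33587212 512 1099511627776 <| .cons 268697696 512 8796093022208 <| .cons 4644543274156032 1099511627776 8796093022208 <| .cons 537395584 512 17592186044416 <| .cons 9289498865172480 1099511627776 17592186044416 <| .cons 18583945532669952 8796093022208 17592186044416 <| .nil) <|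
  .cons 0 1 5 7 (.cons 1048595 1024 34359738368 <| .cons 1073817600 1024 35184372088832 <| .cons 1128442527481856 34359738368 35184372088832 <| .cons 2147635200 1024 70368744177664 <| .cons 2256885054963712 34359738368 70368744177664 <| .cons 37013959437451264 35184372088832 70368744177664 <| .nil) <|
  .cons 0 2 5 7 (.cons 2097189 2048 68719476736 <| .cons 1073816576 2048 35184372088832 <| .cons 1128408167743488 68719476736 35184372088832 <| .cons 4295266304 2048 140737488355328 <| .cons 4513632670973952 68719476736 140737488355328 <| .cons 36943590693273600 35184372088832 140737488355328 <| .nil) <|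
  .cons 1 2 5 7 (.cons 4194377 4096 137438953472 <| .cons 2147632128 4096 70368744177664 <| .cons 2256781975748608 137438953472 70368744177664 <| .cons 4295264256 4096 140737488355328 <| .cons 4513563951497216 137438953472 140737488355328 <| .cons 36908406321184768 70368744177664 140737488355328 <| .nil) <|
  .cons 0 3 5 7 (.cons 8388742 8192 274877906944 <| .cons 1073810432 8192 35184372088832 <| .cons 1128202009313280 274877906944 35184372088832 <| .cons 8590508032 8192 281474976710656 <| .cons 9026440708227072 274877906944 281474976710656 <| .cons 36802853204918272 35184372088832 281474976710656 <| .nil) <|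
  .cons 1 3 5 7 (.cons 16777482 16384 549755813888 <| .cons 2147619840 16384 70368744177664 <| .cons 2256369658888192 549755813888 70368744177664 <| .cons 8590499840 16384 281474976710656 <| .cons 9026165830320128 549755813888 281474976710656 <| .cons 36767668832829440 70368744177664 281474976710656 <| .nil) <|
  .cons 2 3 5 7 (.cons 33554956 32768 1099511627776 <| .cons 4295235584 32768 140737488355328 <| .cons 4512601878822912 1099511627776 140737488355328 <| .cons 8590483456 32768 281474976710656 <| .cons 9025616074506240 1099511627776 281474976710656 <| .cons 36697300088651776 140737488355328 281474976710656 <| .nil) <|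
  .cons 0 4 5 7 (.cons 67109040 65536 2199023255552 <| .cons 1073753088 65536 35184372088832 <| .cons 1126277863964672 2199023255552 35184372088832 <| .cons 17180786688 65536 562949953421312 <| .cons 18045184835059712 2199023255552 562949953421312 <| .cons 36521378228207616 35184372088832 562949953421312 <| .nil) <|
  .cons 1 4 5 7 (.cons 134218064 131072 4398046511104 <| .cons 2147505152 131072 70368744177664 <| .cons 2252521368190976 4398046511104 70368744177664 <| .cons 17180721152 131072 562949953421312 <| .cons 18042985811804160 4398046511104 562949953421312 <| .cons 36486193856118784 70368744177664 562949953421312 <| .nil) <|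
  .cons 2 4 5 7 (.cons 268436064 262144 8796093022208 <| .cons 4295006208 262144 140737488355328 <| .cons 4504905297428480 8796093022208 140737488355328 <| .cons 17180590080 262144 562949953421312 <| .cons 18038587765293056 8796093022208 562949953421312 <| .cons 36415825111941120 140737488355328 562949953421312 <| .nil) <|
  .cons 3 4 5 7 (.cons 536871808 524288 17592186044416 <| .cons 8589991936 524288 281474976710656 <| .cons 9009123400089600 17592186044416 281474976710656 <| .cons 17180327936 524288 562949953421312 <| .cons 18029791672270848 17592186044416 562949953421312 <| .cons 36275087623585792 281474976710656 562949953421312 <| .nil) <|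
  .cons 0 1 6 7 (.cons 1043 1048576 34359738368 <| .cons 1151336448 1048576 1125899906842624 <| .cons 37726992728064 34359738368 1125899906842624 <| .cons 2302672896 1048576 2251799813685248 <| .cons 75453985456128 34359738368 2251799813685248 <| .cons 67553994410557440 1125899906842624 2251799813685248 <| .nil) <|
  .cons 0 2 6 7 (.cons 2085 2097152 68719476736 <| .cons 1150287872 2097152 1125899906842624 <| .cons 37692632989696 68719476736 1125899906842624 <| .cons 4601151488 2097152 4503599627370496 <| .cons 150770531958784 68719476736 4503599627370496 <| .cons 65302194596872192 1125899906842624 4503599627370496 <| .nil) <|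
  .cons 1 2 6 7 (.cons 4169 4194304 137438953472 <| .cons 2299527168 4194304 2251799813685248 <| .cons 75350906241024 137438953472 2251799813685248 <| .cons 4599054336 4194304 4503599627370496 <| .cons 150701812482048 137438953472 4503599627370496 <| .cons 64176294690029568 2251799813685248 4503599627370496 <| .nil) <|
  .cons 0 3 6 7 (.cons 8326 8388608 274877906944 <| .cons 1143996416 8388608 1125899906842624 <| .cons 37486474559488 274877906944 1125899906842624 <| .cons 9177137152 8388608 9007199254740992 <| .cons 300716430196736 274877906944 9007199254740992 <| .cons 60798594969501696 1125899906842624 9007199254740992 <| .nil) <|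
  .cons 1 3 6 7 (.cons 16650 16777216 549755813888 <| .cons 2286944256 16777216 2251799813685248 <| .cons 74938589380608 549755813888 2251799813685248 <| .cons 9168748544 16777216 9007199254740992 <| .cons 300441552289792 549755813888 9007199254740992 <| .cons 59672695062659072 2251799813685248 9007199254740992 <| .nil) <|
  .cons 2 3 6 7 (.cons 33292 33554432 1099511627776 <| .cons 4569694208 33554432 4503599627370496 <| .cons 149739739807744 1099511627776 4503599627370496 <| .cons 9151971328 33554432 9007199254740992 <| .cons 299891796475904 1099511627776 9007199254740992 <| .cons 57420895248973824 4503599627370496 9007199254740992 <| .nil) <|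
  .cons 0 4 6 7 (.cons 65712 67108864 2199023255552 <| .cons 1085276160 67108864 1125899906842624 <| .cons 35562329210880 2199023255552 1125899906842624 <| .cons 18119393280 67108864 18014398509481984 <| .cons 593736278999040 2199023255552 18014398509481984 <| .cons 51791395714760704 1125899906842624 18014398509481984 <| .nil) <|
  .cons 1 4 6 7 (.cons 131408 134217728 4398046511104 <| .cons 2169503744 134217728 2251799813685248 <| .cons 71090298683392 4398046511104 2251799813685248 <| .cons 18052284416 134217728 18014398509481984 <| .cons 591537255743488 4398046511104 18014398509481984 <| .cons 50665495807918080 2251799813685248 18014398509481984 <| .nil) <|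
  .cons 2 4 6 7 (.cons 262752 268435456 8796093022208 <| .cons 4334813184 268435456 4503599627370496 <| .cons 142043158413312 8796093022208 4503599627370496 <| .cons 17918066688 268435456 18014398509481984 <| .cons 587139209232384 8796093022208 18014398509481984 <| .cons 48413695994232832 4503599627370496 18014398509481984 <| .nil) <|
  .cons 3 4 6 7 (.cons 525184 536870912 17592186044416 <| .cons 8648654848 536870912 9007199254740992 <| .cons 283399122059264 17592186044416 9007199254740992 <| .cons 17649631232 536870912 18014398509481984 <| .cons 578343116210176 17592186044416 18014398509481984 <| .cons 43910096366862336 9007199254740992 18014398509481984 <| .nil) <|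
  .cons 0 5 6 7 (.cons 76800 1073741824 35184372088832 <| .cons 78643200 1073741824 1125899906842624 <| .cons 2576980377600 35184372088832 1125899906842624 <| .cons 32212254720 1073741824 36028797018963968 <| .cons 1055531162664960 35184372088832 36028797018963968 <| .cons 33776997205278720 1125899906842624 36028797018963968 <| .nil) <|
  .cons 1 5 6 7 (.cons 152576 2147483648 70368744177664 <| .cons 156237824 2147483648 2251799813685248 <| .cons 5119601016832 70368744177664 2251799813685248 <| .cons 31138512896 2147483648 36028797018963968 <| .cons 1020346790576128 70368744177664 36028797018963968 <| .cons 32651097298436096 2251799813685248 36028797018963968 <| .nil) <|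
  .cons 2 5 6 7 (.cons 301056 4294967296 140737488355328 <| .cons 308281344 4294967296 4503599627370496 <| .cons 10101763080192 140737488355328 4503599627370496 <| .cons 28991029248 4294967296 36028797018963968 <| .cons 949978046398464 140737488355328 36028797018963968 <| .cons 30399297484750848 4503599627370496 36028797018963968 <| .nil) <|
  .cons 3 5 6 7 (.cons 581632 8589934592 281474976710656 <| .cons 595591168 8589934592 9007199254740992 <| .cons 19516331393024 281474976710656 9007199254740992 <| .cons 24696061952 8589934592 36028797018963968 <| .cons 809240558043136 281474976710656 36028797018963968 <| .cons 25895697857380352 9007199254740992 36028797018963968 <| .nil) <|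
  .cons 4 5 6 7 (.cons 983040 17179869184 562949953421312 <| .cons 1006632960 17179869184 18014398509481984 <| .cons 32985348833280 562949953421312 18014398509481984 <| .cons 16106127360 17179869184 36028797018963968 <| .cons 527765581332480 562949953421312 36028797018963968 <| .cons 16888498602639360 18014398509481984 36028797018963968 <| .nil) <|
  quads7

/-- The codes of some sets of eight triples on six vertices without a Berge-`K₄`. -/
def leaves6 : List ℕ :=
  [197663, 329775, 397391, 598159, 672015, 819727, 25715, 7571, 807075, 796995]

/-- The codes of some sets of twelve triples on seven vertices without a Berge-`K₄`. -/
def leaves7 : List ℕ :=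
  [19396317347, 12896194723, 827084963, 18389674307, 816589123, 12906670403]

set_option maxRecDepth 100000 in
lemma valid_quads6 : quads6.Valid 6 := by decide +kernel

set_option maxRecDepth 100000 in
lemma valid_quads7 : quads7.Valid 7 := by decide +kernel

set_option maxRecDepth 100000 in
lemma valid_quads8 : quads8.Valid 8 := by decide +kernel

set_option maxRecDepth 100000 in
lemma search_quads6 :
    search quads6 (fun g => List.elem g leaves6) (List.range' 2 18) 18 6 3 = true := by
  decide +kernel

set_option maxRecDepth 100000 in
lemma search_quads7 : ∀ g ∈ leaves6,
    search quads7 (fun g => List.elem g leaves7) (List.range' 20 15) 15 4 g = true := by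
  decide +kernel

set_option maxRecDepth 100000 in
lemma search_quads8 : ∀ g ∈ leaves7,
    search quads8 (fun g => List.elem g []) (List.range' 35 21) 21 7 g = true := by
  decide +kernel

lemma card_filter_testBit_leaves6 : ∀ g ∈ leaves6,
    ((Finset.range 20).filter fun t => g.testBit t = true).card = 8 := by
  decide +kernel

lemma card_filter_testBit_leaves7 : ∀ g ∈ leaves7,
    ((Finset.range 35).filter fun t => g.testBit t = true).card = 12 := by
  decide +kernel

lemma Rows.HeadValid.exists_of_selects {i j : ℕ} {r : Rows} {ts : List ℕ} (h : r.HeadValid i j)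
    (hs : r.Selects ts) :
    ∃ t ts', ts = t :: ts' ∧ (i ∈ tripleAt t ∧ j ∈ tripleAt t) ∧ r.tail.Selects ts' := by
  cases r with
  | nil => exact h.elim
  | cons e a b r =>
    obtain ⟨t, ts', rfl, ht, hs⟩ := hs
    rw [show e ||| a ||| b = pairCode i j from h] at ht
    exact ⟨t, ts', rfl, mem_tripleAt_of_testBit_pairCode ht, hs⟩

lemma hasShortBergeK4_of_bad {V : Type*} [DecidableEq V] {H : Finset (Finset V)} {x : ℕ → V}
    {K : ℕ} (hK : K < 9) (hx : Set.InjOn x (Finset.range K)) (q : Quads) (hq : q.Valid K) {g : ℕ}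
    (hg : ∀ t, g.testBit t = true → t < K.choose 3 ∧ (tripleAt t).image x ∈ H)
    (h : bad q g = true) : HasShortBergeK4 H := by
  induction q with
  | nil => exact absurd h (by simp [bad])
  | cons i j k l r q ih =>
    obtain ⟨⟨hij, hjk, hkl, hlK⟩, ⟨h₁, h₂, h₃, h₄, h₅, h₆⟩, hq⟩ := hq
    change Bool.rec (motive := fun _ => Bool) (bad q g) true (hasSDR r g) = true at h
    rcases hr : hasSDR r g with _ | _
    · rw [hr] at h
      exact ih hq h
    obtain ⟨ts, hts, hnd, hmem⟩ := exists_selects_of_hasSDR r g hr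
    obtain ⟨t₁, ts, rfl, m₁, hts⟩ := h₁.exists_of_selects hts
    obtain ⟨t₂, ts, rfl, m₂, hts⟩ := h₂.exists_of_selects hts
    obtain ⟨t₃, ts, rfl, m₃, hts⟩ := h₃.exists_of_selects hts
    obtain ⟨t₄, ts, rfl, m₄, hts⟩ := h₄.exists_of_selects hts
    obtain ⟨t₅, ts, rfl, m₅, hts⟩ := h₅.exists_of_selects hts
    obtain ⟨t₆, ts, rfl, m₆, -⟩ := h₆.exists_of_selects hts
    have hpair : ∀ {u v t}, u ∈ tripleAt t ∧ v ∈ tripleAt t →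
        ({x u, x v} : Finset V) ⊆ (tripleAt t).image x := by
      intro u v t hm
      rw [Finset.insert_subset_iff, Finset.singleton_subset_iff]
      exact ⟨Finset.mem_image_of_mem x hm.1, Finset.mem_image_of_mem x hm.2⟩
    have hsub : ∀ t, g.testBit t = true → (tripleAt t).image x ⊆ (Finset.range K).image x :=
      fun t ht => Finset.image_subset_image (tripleAt_spec K hK t (hg t ht).1).1
    have hne : ∀ u v, u < v → v < K → x u ≠ x v := fun u v huv hv h =>
      huv.ne (hx (by simpa using huv.trans hv) (by simpa using hv) h)
    have hinj : ∀ s t, g.testBit s = true → g.testBit t = true →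
        (tripleAt s).image x = (tripleAt t).image x → s = t := by
      intro s t hs ht hst
      have hK56 : K.choose 3 ≤ 56 := by
        calc K.choose 3 ≤ Nat.choose 8 3 := Nat.choose_le_choose 3 (by omega)
          _ = 56 := by decide
      have hs' := tripleAt_spec K hK s (hg s hs).1
      have ht' := tripleAt_spec K hK t (hg t ht).1
      refine tripleAt_injOn s ((hg s hs).1.trans_le hK56) t ((hg t ht).1.trans_le hK56) ?_
      rw [← Finset.coe_inj]
      refine (hx.image_eq_image_iff (Finset.coe_subset.2 hs'.1) (Finset.coe_subset.2 ht'.1)).1 ?_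
      rw [← Finset.coe_image, ← Finset.coe_image, hst]
    have hnd' : ((t₁ :: t₂ :: t₃ :: t₄ :: t₅ :: t₆ :: ts).map
        fun t => (tripleAt t).image x).Nodup :=
      hnd.map_on fun s hs t ht => hinj s t (hmem s hs) (hmem t ht)
    have b₁ := hmem t₁ (by simp)
    have b₂ := hmem t₂ (by simp)
    have b₃ := hmem t₃ (by simp)
    have b₄ := hmem t₄ (by simp)
    have b₅ := hmem t₅ (by simp)
    have b₆ := hmem t₆ (by simp)
    refine ⟨x i, x j, x k, x l, _, _, _, _, _, _, hne i j hij (by omega),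
      hne i k (by omega) (by omega), hne i l (by omega) hlK, hne j k hjk (by omega),
      hne j l (by omega) hlK, hne k l hkl hlK, hnd'.sublist ?_, (hg t₁ b₁).2, (hg t₂ b₂).2,
      (hg t₃ b₃).2, (hg t₄ b₄).2, (hg t₅ b₅).2, (hg t₆ b₆).2, hpair m₁, hpair m₂, hpair m₃,
      hpair m₄, hpair m₅, hpair m₆, ?_⟩
    · rw [List.map_cons, List.map_cons, List.map_cons, List.map_cons, List.map_cons, List.map_cons]
      repeat refine List.Sublist.cons_cons _ ?_
      exact List.nil_sublist _
    · refine (Finset.card_le_card (t := (Finset.range K).image x) ?_).trans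
        (Finset.card_image_le.trans ?_)
      · simp only [Finset.union_subset_iff]
        exact ⟨⟨⟨⟨⟨hsub _ b₁, hsub _ b₂⟩, hsub _ b₃⟩, hsub _ b₄⟩, hsub _ b₅⟩, hsub _ b₆⟩
      · rw [Finset.card_range]
        omega

/-- The triples of `H` on the vertices `x 0, …, x (K-1)`, which are the elements of `W`, have the
code `g`. -/
structure IsCode {V : Type*} [DecidableEq V] (H : Finset (Finset V)) (W : Finset V) (K : ℕ)
    (x : ℕ → V) (g : ℕ) : Prop where
  injOn : Set.InjOn x (Finset.range K)
  image_eq : (Finset.range K).image x = W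
  testBit_iff : ∀ t, g.testBit t = true ↔ t < K.choose 3 ∧ (tripleAt t).image x ∈ H

lemma exists_image_tripleAt_eq {V : Type*} [DecidableEq V] {x : ℕ → V} {K : ℕ} (hK : K < 9)
    (hx : Set.InjOn x (Finset.range K)) {h : Finset V} (hh : h.card = 3)
    (hsub : h ⊆ (Finset.range K).image x) :
    ∃ t < K.choose 3, (tripleAt t).image x = h := by
  obtain ⟨s, hs, rfl⟩ := Finset.subset_image_iff.1 hsub
  rw [Finset.card_image_of_injOn (hx.mono hs)] at hh
  obtain ⟨t, ht, rfl⟩ := exists_tripleAt_eq K hK s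
    (Finset.mem_powersetCard.2 ⟨Finset.coe_subset.1 hs, hh⟩)
  exact ⟨t, ht, rfl⟩

lemma IsCode.card_le {V : Type*} [DecidableEq V] {H : Finset (Finset V)} {W : Finset V} {K : ℕ}
    {x : ℕ → V} {g : ℕ} (h : IsCode H W K x g) (hK : K < 9)
    (hH : ∀ h ∈ H, h.card = 3 ∧ h ⊆ W) :
    H.card ≤ ((Finset.range (K.choose 3)).filter fun t => g.testBit t = true).card := by
  refine (Finset.card_le_card (t := Finset.image (fun t => (tripleAt t).image x)
    ((Finset.range (K.choose 3)).filter fun t => g.testBit t = true)) fun e he => ?_).trans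
    Finset.card_image_le
  obtain ⟨t, ht, rfl⟩ := exists_image_tripleAt_eq hK h.injOn (hH e he).1
    ((hH e he).2.trans h.image_eq.symm.subset)
  exact Finset.mem_image_of_mem _
    (Finset.mem_filter.2 ⟨Finset.mem_range.2 ht, (h.testBit_iff t).2 ⟨ht, he⟩⟩)

lemma IsCode.extend {V : Type*} [DecidableEq V] {H : Finset (Finset V)} {W : Finset V} {w : V}
    {K : ℕ} {x : ℕ → V} {g : ℕ} (h : IsCode (H.filter (w ∉ ·)) (W.erase w) K x g) (hw : w ∈ W)
    (hK : K + 1 < 9) (hH : ∀ h ∈ H, h.card = 3 ∧ h ⊆ W) (hno : ¬ HasShortBergeK4 H) {q : Quads}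
    (hq : q.Valid (K + 1)) {L : List ℕ} {n need : ℕ} (hn : (K + 1).choose 3 = K.choose 3 + n)
    (hs : search q (fun g => List.elem g L) (List.range' (K.choose 3) n) n need g = true)
    (hneed : need ≤ (H.filter (w ∈ ·)).card) :
    ∃ x' : ℕ → V, ∃ g' ∈ L, IsCode H W (K + 1) x' g' := by
  set x' := Function.update x K w with hx'
  have hx'lt : ∀ i ∈ Finset.range K, x' i = x i := fun i hi =>
    Function.update_of_ne (Finset.mem_range.1 hi).ne _ _
  have hximg : (Finset.range K).image x' = W.erase w :=
    (Finset.image_congr fun i hi => hx'lt i hi).trans h.image_eq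
  have himg : (Finset.range (K + 1)).image x' = W := by
    rw [Finset.range_add_one, Finset.image_insert, hximg, hx', Function.update_self,
      Finset.insert_erase hw]
  have hinj : Set.InjOn x' (Finset.range (K + 1)) := by
    rw [Finset.range_add_one, Finset.coe_insert, Set.injOn_insert (by simp)]
    refine ⟨h.injOn.congr fun i hi => (hx'lt i hi).symm, ?_⟩
    rw [← Finset.coe_image, hximg, hx', Function.update_self]
    simp
  have himgt : ∀ t < K.choose 3, (tripleAt t).image x' = (tripleAt t).image x := fun t ht =>
    Finset.image_congr fun i hi => hx'lt i ((tripleAt_spec K (by omega) t ht).1 hi)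
  have hnw : ∀ t < K.choose 3, w ∉ (tripleAt t).image x' := by
    intro t ht hwt
    have := Finset.image_subset_image (f := x') (tripleAt_spec K (by omega) t ht).1 hwt
    rw [hximg] at this
    simp at this
  have hold : ∀ t, g.testBit t = true ↔ t < K.choose 3 ∧ (tripleAt t).image x' ∈ H := by
    intro t
    rw [h.testBit_iff, Finset.mem_filter]
    constructor
    · rintro ⟨ht, ht', -⟩
      exact ⟨ht, himgt t ht ▸ ht'⟩
    · rintro ⟨ht, ht'⟩
      have := hnw t ht
      rw [himgt t ht] at ht' this
      exact ⟨ht, ht', this⟩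
  classical
  let χ : ℕ → Prop := fun t => t < (K + 1).choose 3 ∧ (tripleAt t).image x' ∈ H
  have hlen : need ≤ ((List.range' (K.choose 3) n).filter χ).length := by
    refine hneed.trans ?_
    have hsub : H.filter (w ∈ ·) ⊆ (((List.range' (K.choose 3) n).filter χ).toFinset).image
        fun t => (tripleAt t).image x' := by
      intro e he
      rw [Finset.mem_filter] at he
      obtain ⟨t, ht, rfl⟩ := exists_image_tripleAt_eq hK hinj (hH e he.1).1
        ((hH e he.1).2.trans himg.symm.subset)
      refine Finset.mem_image_of_mem _ ?_
      rw [List.mem_toFinset, List.mem_filter, List.mem_range'_1, decide_eq_true_eq, ← hn]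
      exact ⟨⟨not_lt.1 fun h => hnw t h he.2, ht⟩, ht, he.1⟩
    exact (Finset.card_le_card hsub).trans
      (Finset.card_image_le.trans (List.toFinset_card_le _))
  obtain ⟨g', hg', hbit⟩ := exists_of_search q (fun g => List.elem g L) χ
    (fun g hg => by
      by_contra hb
      exact hno (hasShortBergeK4_of_bad hK hinj q hq hg (by simpa using hb)))
    (List.range' (K.choose 3) n) n need g (by simp)
    (fun t ht => ⟨((hold t).1 ht).1.trans_le (by omega), ((hold t).1 ht).2⟩) hs hlen
  refine ⟨x', g', by simpa using hg', hinj, himg, fun t => ?_⟩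
  rw [hbit, hold, List.mem_range'_1, ← hn]
  constructor
  · rintro (⟨ht, ht'⟩ | ⟨-, h⟩)
    exacts [⟨by omega, ht'⟩, h]
  · intro h
    rcases lt_or_ge t (K.choose 3) with ht | ht
    exacts [Or.inl ⟨ht, h.2⟩, Or.inr ⟨⟨ht, h.1⟩, h⟩]

lemma exists_isCode_six {V : Type*} [DecidableEq V] {H : Finset (Finset V)} {W : Finset V}
    (hW : W.card = 6) (hH : ∀ h ∈ H, h.card = 3 ∧ h ⊆ W) (hno : ¬ HasShortBergeK4 H)
    (hcard : 8 ≤ H.card) : ∃ x : ℕ → V, ∃ g ∈ leaves6, IsCode H W 6 x g := by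
  obtain ⟨h₁, hh₁, h₂, hh₂, hne, p, hp₁, hp₂⟩ : ∃ h₁ ∈ H, ∃ h₂ ∈ H, h₁ ≠ h₂ ∧
      ∃ p, p ∈ h₁.powersetCard 2 ∧ p ∈ h₂.powersetCard 2 := by
    by_contra! hcon
    have hdis : (H : Set (Finset V)).PairwiseDisjoint (Finset.powersetCard 2) :=
      fun h₁ hh₁ h₂ hh₂ hne => Finset.disjoint_left.2 fun p hp => hcon h₁ hh₁ h₂ hh₂ hne p hp
    have hc := Finset.card_biUnion hdis
    rw [Finset.sum_congr rfl fun h hh => by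
      rw [Finset.card_powersetCard, (hH h hh).1], Finset.sum_const] at hc
    have hle := Finset.card_le_card (s := H.biUnion (Finset.powersetCard 2))
      (t := W.powersetCard 2) (Finset.biUnion_subset.2 fun h hh =>
        Finset.powersetCard_mono (hH h hh).2)
    rw [hc, Finset.card_powersetCard, hW] at hle
    have : Nat.choose 6 2 = 15 := by decide
    have : Nat.choose 3 2 = 3 := by decide
    simp only [smul_eq_mul, *] at hle
    omega
  rw [Finset.mem_powersetCard] at hp₁ hp₂
  obtain ⟨a, b, hab, rfl⟩ := Finset.card_eq_two.1 hp₁.2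
  have third : ∀ h ∈ H, {a, b} ⊆ h → ∃ c, c ∉ ({a, b} : Finset V) ∧ insert c {a, b} = h := by
    intro h hh hs
    refine Finset.covBy_iff_exists_insert.1 ?_
    rw [Finset.covBy_iff_card_sdiff_eq_one, Finset.card_sdiff_of_subset hs, (hH h hh).1, hp₁.2]
    exact ⟨hs, rfl⟩
  obtain ⟨c, hc, rfl⟩ := third h₁ hh₁ hp₁.1
  obtain ⟨d, hd, rfl⟩ := third h₂ hh₂ hp₂.1
  have hcd : c ≠ d := by
    rintro rfl
    exact hne rfl
  have hsub : ({a, b, c, d} : Finset V) ⊆ W := by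
    have h₁ := (hH _ hh₁).2
    have h₂ := (hH _ hh₂).2
    simp only [Finset.insert_subset_iff, Finset.singleton_subset_iff] at h₁ h₂ ⊢
    exact ⟨h₁.2.1, h₁.2.2, h₁.1, h₂.1⟩
  rw [Finset.mem_insert, Finset.mem_singleton, not_or] at hc hd
  have hrest : (W \ {a, b, c, d}).card = 2 := by
    rw [Finset.card_sdiff_of_subset hsub, hW, Finset.card_eq_four.2
      ⟨a, b, c, d, hab, Ne.symm hc.1, Ne.symm hd.1, Ne.symm hc.2, Ne.symm hd.2, hcd, rfl⟩]
  obtain ⟨e, f, hef, hWef⟩ := Finset.card_eq_two.1 hrest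
  have he : e ∈ W \ {a, b, c, d} := by simp [hWef]
  have hf : f ∈ W \ {a, b, c, d} := by simp [hWef]
  simp only [Finset.mem_sdiff, Finset.mem_insert, Finset.mem_singleton, not_or] at he hf
  let x : ℕ → V := fun n => [a, b, c, d, e, f].getD n a
  have himg : (Finset.range 6).image x = W := by
    have : (Finset.range 6).image x = {a, b, c, d} ∪ {e, f} := by
      ext v
      simp only [Finset.mem_image, Finset.mem_range, Finset.mem_union, Finset.mem_insert,
        Finset.mem_singleton]
      constructor
      · rintro ⟨i, hi, rfl⟩
        interval_cases i <;> simp [x]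
      · rintro ((rfl | rfl | rfl | rfl) | rfl | rfl)
        exacts [⟨0, by simp [x]⟩, ⟨1, by simp [x]⟩, ⟨2, by simp [x]⟩, ⟨3, by simp [x]⟩,
          ⟨4, by simp [x]⟩, ⟨5, by simp [x]⟩]
    rw [this, ← hWef, Finset.union_sdiff_of_subset hsub]
  have hinj : Set.InjOn x (Finset.range 6) := by
    rw [← Finset.card_image_iff, himg, hW, Finset.card_range]
  have ht₀ : (tripleAt 0).image x ∈ H := by
    rw [show tripleAt 0 = {2, 0, 1} by decide]
    simpa [x, Finset.image_insert] using hh₁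
  have ht₁ : (tripleAt 1).image x ∈ H := by
    rw [show tripleAt 1 = {3, 0, 1} by decide]
    simpa [x, Finset.image_insert] using hh₂
  have hold : ∀ t, Nat.testBit 3 t = true ↔ t < 2 := by
    intro t
    rw [show 3 = 2 ^ 2 - 1 by norm_num, Nat.testBit_two_pow_sub_one, decide_eq_true_eq]
  have hH₂ : ∀ t < 2, (tripleAt t).image x ∈ H := by
    intro t ht
    interval_cases t
    exacts [ht₀, ht₁]
  have h20 : Nat.choose 6 3 = 20 := by decide
  classical
  let χ : ℕ → Prop := fun t => t < Nat.choose 6 3 ∧ (tripleAt t).image x ∈ H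
  have hlen : 6 ≤ ((List.range' 2 18).filter χ).length := by
    have hsub : H ⊆ ((List.range 2 ++ (List.range' 2 18).filter χ).toFinset).image
        fun t => (tripleAt t).image x := by
      intro e he
      obtain ⟨t, ht, rfl⟩ := exists_image_tripleAt_eq (by norm_num) hinj (hH e he).1
        ((hH e he).2.trans himg.symm.subset)
      refine Finset.mem_image_of_mem _ ?_
      rw [List.mem_toFinset, List.mem_append, List.mem_range, List.mem_filter, List.mem_range'_1,
        decide_eq_true_eq]
      rcases lt_or_ge t 2 with ht' | ht'
      exacts [Or.inl ht', Or.inr ⟨⟨ht', by omega⟩, ht, he⟩]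
    have := hcard.trans ((Finset.card_le_card hsub).trans
      (Finset.card_image_le.trans (List.toFinset_card_le _)))
    rw [List.length_append, List.length_range] at this
    omega
  obtain ⟨g', hg', hbit⟩ := exists_of_search quads6 (fun g => List.elem g leaves6) χ
    (fun g hg => by
      by_contra hb
      exact hno (hasShortBergeK4_of_bad (by norm_num) hinj quads6 valid_quads6 hg
        (by simpa using hb)))
    (List.range' 2 18) 18 6 3 (by simp)
    (fun t ht => ⟨((hold t).1 ht).trans_le (by omega), hH₂ t ((hold t).1 ht)⟩) search_quads6 hlen
  refine ⟨x, g', by simpa using hg', hinj, himg, fun t => ?_⟩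
  rw [hbit, hold, List.mem_range'_1]
  constructor
  · rintro (h | ⟨-, h⟩)
    exacts [⟨by omega, hH₂ t h⟩, h]
  · intro h
    rcases lt_or_ge t 2 with ht | ht
    exacts [Or.inl ht, Or.inr ⟨⟨ht, by omega⟩, h⟩]

lemma exists_isCode_seven {V : Type*} [DecidableEq V] {H : Finset (Finset V)} {W : Finset V}
    {w : V} (hw : w ∈ W) (hW : W.card = 7) (hH : ∀ h ∈ H, h.card = 3 ∧ h ⊆ W)
    (hno : ¬ HasShortBergeK4 H) (h₁ : 8 ≤ (H.filter (w ∉ ·)).card)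
    (h₂ : 4 ≤ (H.filter (w ∈ ·)).card) : ∃ x : ℕ → V, ∃ g ∈ leaves7, IsCode H W 7 x g := by
  obtain ⟨x, g, hg, hc⟩ := exists_isCode_six (H := H.filter (w ∉ ·)) (W := W.erase w)
    (by rw [Finset.card_erase_of_mem hw, hW]) (fun h hh => by
      rw [Finset.mem_filter] at hh
      exact ⟨(hH h hh.1).1, Finset.subset_erase.2 ⟨(hH h hh.1).2, hh.2⟩⟩)
    (fun h => hno (h.mono (Finset.filter_subset _ _))) h₁
  exact hc.extend hw (by norm_num) hH hno valid_quads7 (by decide) (search_quads7 g hg) h₂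

end SmallSearch

/-- A triple system on a 6-set without a Berge-`K₄` has at most eight triples. -/
lemma card_le_eight {V : Type*} [DecidableEq V] {H : Finset (Finset V)} {W : Finset V}
    (hW : W.card = 6) (hH : ∀ h ∈ H, h.card = 3 ∧ h ⊆ W) (hno : ¬ HasShortBergeK4 H) :
    H.card ≤ 8 := by
  by_contra! hcard
  obtain ⟨x, g, hg, hc⟩ := SmallSearch.exists_isCode_six hW hH hno hcard.le
  have := hc.card_le (by norm_num) hH
  rw [show Nat.choose 6 3 = 20 by decide, SmallSearch.card_filter_testBit_leaves6 g hg] at this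
  omega

lemma card_le_twelve_of_vertex {V : Type*} [DecidableEq V] {H : Finset (Finset V)} {W : Finset V}
    {w : V} (hw : w ∈ W) (hW : W.card = 7) (hH : ∀ h ∈ H, h.card = 3 ∧ h ⊆ W)
    (hno : ¬ HasShortBergeK4 H) (h₁ : 8 ≤ (H.filter (w ∉ ·)).card)
    (h₂ : 4 ≤ (H.filter (w ∈ ·)).card) : H.card ≤ 12 := by
  obtain ⟨x, g, hg, hc⟩ := SmallSearch.exists_isCode_seven hw hW hH hno h₁ h₂
  have := hc.card_le (by norm_num) hH
  rwa [show Nat.choose 7 3 = 35 by decide, SmallSearch.card_filter_testBit_leaves7 g hg] at this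

lemma hasShortBergeK4_of_two_vertices {V : Type*} [DecidableEq V] {H : Finset (Finset V)}
    {W : Finset V} {v w : V} (hv : v ∈ W) (hw : w ∈ W) (hvw : v ≠ w) (hW : W.card = 8)
    (hH : ∀ h ∈ H, h.card = 3 ∧ h ⊆ W) (h₁ : 8 ≤ ((H.filter (v ∉ ·)).filter (w ∉ ·)).card)
    (h₂ : 4 ≤ ((H.filter (v ∉ ·)).filter (w ∈ ·)).card) (h₃ : 7 ≤ (H.filter (v ∈ ·)).card) :
    HasShortBergeK4 H := by
  by_contra hno
  obtain ⟨x, g, hg, hc⟩ := SmallSearch.exists_isCode_seven (H := H.filter (v ∉ ·))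
    (W := W.erase v) (Finset.mem_erase.2 ⟨hvw.symm, hw⟩)
    (by rw [Finset.card_erase_of_mem hv, hW]) (fun h hh => by
      rw [Finset.mem_filter] at hh
      exact ⟨(hH h hh.1).1, Finset.subset_erase.2 ⟨(hH h hh.1).2, hh.2⟩⟩)
    (fun h => hno (h.mono (Finset.filter_subset _ _))) h₁ h₂
  obtain ⟨x', g', hg', -⟩ := hc.extend hv (by norm_num) hH hno SmallSearch.valid_quads8 (by decide)
    (SmallSearch.search_quads8 g hg) h₃
  simp at hg'

/-! ### Counting, and the cases of six to nine vertices -/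

section SmallCases

variable {V : Type*} [DecidableEq V]

/-- The number of triples in `H` that contain `v`. -/
def vertexDegree (H : Finset (Finset V)) (v : V) : ℕ := (H.filter (v ∈ ·)).card

/-- The number of triples in `H` that contain `u` and `v`. -/
def codegree (H : Finset (Finset V)) (u v : V) : ℕ := (H.filter fun h => u ∈ h ∧ v ∈ h).card

lemma card_filter_notMem_add_vertexDegree (H : Finset (Finset V)) (v : V) :
    (H.filter (v ∉ ·)).card + vertexDegree H v = H.card := by
  rw [add_comm]
  exact Finset.card_filter_add_card_filter_not _

lemma sum_vertexDegree {H : Finset (Finset V)} {W : Finset V}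
    (hH : ∀ h ∈ H, h.card = 3 ∧ h ⊆ W) : ∑ v ∈ W, vertexDegree H v = 3 * H.card := by
  have := Finset.sum_card_bipartiteAbove_eq_sum_card_bipartiteBelow (s := W) (t := H)
    (fun v h => v ∈ h)
  simp only [Finset.bipartiteAbove, Finset.bipartiteBelow] at this
  unfold vertexDegree
  rw [this, Finset.sum_congr rfl fun h hh => by
    rw [Finset.filter_mem_eq_inter, Finset.inter_eq_right.2 (hH h hh).2, (hH h hh).1],
    Finset.sum_const, smul_eq_mul, mul_comm]

lemma sum_codegree {H : Finset (Finset V)} {W : Finset V}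
    (hH : ∀ h ∈ H, h.card = 3 ∧ h ⊆ W) (u : V) :
    ∑ v ∈ W.erase u, codegree H u v = 2 * vertexDegree H u := by
  have := Finset.sum_card_bipartiteAbove_eq_sum_card_bipartiteBelow (s := W.erase u)
    (t := H.filter (u ∈ ·)) (fun v h => v ∈ h)
  simp only [Finset.bipartiteAbove, Finset.bipartiteBelow, Finset.filter_filter] at this
  unfold codegree vertexDegree
  rw [this, Finset.sum_congr rfl fun h hh => by
    rw [Finset.filter_mem_eq_inter, Finset.erase_inter, Finset.inter_eq_right.2
      (hH h (Finset.mem_filter.1 hh).1).2, Finset.card_erase_of_mem (Finset.mem_filter.1 hh).2,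
      (hH h (Finset.mem_filter.1 hh).1).1],
    Finset.sum_const, smul_eq_mul, mul_comm]

/-- Every triple system on an `n`-subset of `V` without a short Berge-`K₄` has at most `b`
triples. -/
def SizeBound (V : Type*) [DecidableEq V] (n b : ℕ) : Prop :=
  ∀ (H : Finset (Finset V)) (W : Finset V), W.card = n → (∀ h ∈ H, h.card = 3 ∧ h ⊆ W) →
    ¬ HasShortBergeK4 H → H.card ≤ b

lemma SizeBound.card_filter_notMem_le {n b : ℕ} (hb : SizeBound V n b) {H : Finset (Finset V)}
    {W : Finset V} (hW : W.card = n + 1) (hH : ∀ h ∈ H, h.card = 3 ∧ h ⊆ W)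
    (hno : ¬ HasShortBergeK4 H) {v : V} (hv : v ∈ W) : (H.filter (v ∉ ·)).card ≤ b := by
  refine hb _ (W.erase v) (by rw [Finset.card_erase_of_mem hv, hW, Nat.add_sub_cancel])
    (fun h hh => ?_) fun h => hno (h.mono (Finset.filter_subset _ _))
  rw [Finset.mem_filter] at hh
  exact ⟨(hH h hh.1).1, Finset.subset_erase.2 ⟨(hH h hh.1).2, hh.2⟩⟩

lemma SizeBound.le_add_vertexDegree {n b : ℕ} (hb : SizeBound V n b) {H : Finset (Finset V)}
    {W : Finset V} (hW : W.card = n + 1) (hH : ∀ h ∈ H, h.card = 3 ∧ h ⊆ W)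
    (hno : ¬ HasShortBergeK4 H) {v : V} (hv : v ∈ W) : H.card ≤ b + vertexDegree H v := by
  rw [← card_filter_notMem_add_vertexDegree H v]
  exact Nat.add_le_add_right (hb.card_filter_notMem_le hW hH hno hv) _

lemma SizeBound.succ {n b c : ℕ} (hb : SizeBound V n b)
    (h : ∀ x, (n + 1) * x ≤ (n + 1) * b + 3 * x → x ≤ c) : SizeBound V (n + 1) c := by
  intro H W hW hH hno
  refine h _ ?_
  have := Finset.sum_le_sum fun v hv => hb.le_add_vertexDegree hW hH hno hv
  rwa [Finset.sum_const, Finset.sum_add_distrib, Finset.sum_const, sum_vertexDegree hH, hW,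
    smul_eq_mul, smul_eq_mul] at this

lemma SizeBound.of_card_eq {n b : ℕ} (h : ∀ (H : Finset (Finset V)) (W : Finset V), W.card = n →
    (∀ h ∈ H, h.card = 3 ∧ h ⊆ W) → ¬ HasShortBergeK4 H → H.card ≠ b + 1) : SizeBound V n b := by
  intro H W hW hH hno
  by_contra! hcard
  obtain ⟨H', hH', hc⟩ := Finset.exists_subset_card_eq (show b + 1 ≤ H.card from hcard)
  exact h H' W hW (fun h hh => hH h (hH' hh)) (fun h => hno (h.mono hH')) hc

lemma sizeBound_six : SizeBound V 6 8 := fun _ _ hW hH hno => card_le_eight hW hH hno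

lemma sizeBound_seven : SizeBound V 7 12 := by
  refine .of_card_eq fun H W hW hH hno hcard => ?_
  obtain ⟨w, hw, hdw⟩ : ∃ w ∈ W, vertexDegree H w < 6 := by
    refine Finset.exists_lt_of_sum_lt ?_
    rw [sum_vertexDegree hH, Finset.sum_const, hW, hcard]
    norm_num
  have h₁ := card_filter_notMem_add_vertexDegree H w
  have h₂ := sizeBound_six.le_add_vertexDegree hW hH hno hw
  have := card_le_twelve_of_vertex hw hW hH hno (by omega)
    (show 4 ≤ vertexDegree H w by omega)
  omega

/-- The representatives can be chosen greedily if every pair of vertices is in a triple and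
every vertex is in at most one pair with just one triple. -/
lemma hasShortBergeK4_of_codegree {H : Finset (Finset V)} {W : Finset V} (hW : W.card ≤ 9)
    (hH : ∀ h ∈ H, h.card = 3 ∧ h ⊆ W)
    (h₁ : ∀ u ∈ W, ∀ v ∈ W, u ≠ v → 1 ≤ codegree H u v)
    (h₂ : ∀ u ∈ W, ∀ v ∈ W, ∀ w ∈ W, u ≠ v → u ≠ w → v ≠ w → codegree H u v ≤ 1 →
      2 ≤ codegree H u w)
    {K : Finset V} (hKW : K ⊆ W) (hK : K.card = 4) (hin : (H.filter (· ⊆ K)).card ≤ 1) :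
    HasShortBergeK4 H := by
  obtain ⟨h₀, p₀, hh₀, hp₀⟩ : ∃ h₀ p₀, (∀ h ∈ H, h ≠ h₀ → ¬ h ⊆ K) ∧
      (∀ p ∈ K.powersetCard 2, p = p₀ ∧ h₀ ∈ H ∧ p ⊆ h₀ ∧ h₀ ⊆ K ∨
        ∃ h ∈ H, h ≠ h₀ ∧ p ⊆ h) := by
    have hmem : ∀ p ∈ K.powersetCard 2, ∃ u v, u ∈ W ∧ v ∈ W ∧ u ≠ v ∧ p = {u, v} := by
      intro p hp
      rw [Finset.mem_powersetCard] at hp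
      obtain ⟨u, v, huv, rfl⟩ := Finset.card_eq_two.1 hp.2
      exact ⟨u, v, hKW (hp.1 (by simp)), hKW (hp.1 (by simp)), huv, rfl⟩
    have hex : ∀ u v h, 2 ≤ codegree H u v → ∃ h' ∈ H, h' ≠ h ∧ ({u, v} : Finset V) ⊆ h' := by
      intro u v h huv
      obtain ⟨h', hh', hne⟩ := Finset.exists_mem_ne (show 1 < _ from huv) h
      rw [Finset.mem_filter] at hh'
      exact ⟨h', hh'.1, hne, Finset.insert_subset hh'.2.1 (Finset.singleton_subset_iff.2 hh'.2.2)⟩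
    have hex₁ : ∀ u v, 1 ≤ codegree H u v → ∃ h' ∈ H, ({u, v} : Finset V) ⊆ h' := by
      intro u v huv
      obtain ⟨h', hh'⟩ := Finset.card_pos.1 (show 0 < _ from huv)
      rw [Finset.mem_filter] at hh'
      exact ⟨h', hh'.1, Finset.insert_subset hh'.2.1 (Finset.singleton_subset_iff.2 hh'.2.2)⟩
    rcases (H.filter (· ⊆ K)).eq_empty_or_nonempty with he | ⟨h₀, hh₀⟩
    · have hnot : ∀ h ∈ H, ¬ h ⊆ K := fun h hh hK => by
        have : h ∈ H.filter (· ⊆ K) := Finset.mem_filter.2 ⟨hh, hK⟩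
        rw [he] at this
        simp at this
      refine ⟨K, ∅, fun h hh _ => hnot h hh, fun p hp => Or.inr ?_⟩
      obtain ⟨u, v, hu, hv, huv, rfl⟩ := hmem p hp
      obtain ⟨h, hh, hs⟩ := hex₁ u v (h₁ u hu v hv huv)
      exact ⟨h, hh, fun he => hnot h hh he.subset, hs⟩
    · have huniq : ∀ h ∈ H, h ≠ h₀ → ¬ h ⊆ K := fun h hh hne hK =>
        hne (Finset.card_le_one.1 hin h (Finset.mem_filter.2 ⟨hh, hK⟩) h₀ hh₀)
      rw [Finset.mem_filter] at hh₀
      by_cases hp : ∃ p₀ ∈ K.powersetCard 2, ¬ ∃ h ∈ H, h ≠ h₀ ∧ p₀ ⊆ h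
      · obtain ⟨p₀, hp₀, hn₀⟩ := hp
        have hcov : ∀ p ∈ K.powersetCard 2, (¬ ∃ h ∈ H, h ≠ h₀ ∧ p ⊆ h) → p ⊆ h₀ := by
          intro p hp hn
          obtain ⟨u, v, hu, hv, huv, rfl⟩ := hmem p hp
          obtain ⟨h, hh, hs⟩ := hex₁ u v (h₁ u hu v hv huv)
          by_cases he : h = h₀
          · exact he ▸ hs
          · exact absurd ⟨h, hh, he, hs⟩ hn
        refine ⟨h₀, p₀, huniq, fun p hp => ?_⟩
        by_contra! hcon
        obtain ⟨hc₁, hc₂⟩ := hcon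
        have hn : ¬ ∃ h ∈ H, h ≠ h₀ ∧ p ⊆ h := by
          rintro ⟨h, hh, hne, hs⟩
          exact hc₂ h hh hne hs
        have hpsub := hcov p hp hn
        have hp₀sub := hcov p₀ hp₀ hn₀
        have hne : p ≠ p₀ := fun he => hc₁ he hh₀.1 hpsub hh₀.2
        rw [Finset.mem_powersetCard] at hp hp₀
        -- two pairs inside a triple share a vertex
        obtain ⟨u, hu⟩ : (p ∩ p₀).Nonempty := by
          rw [← Finset.card_pos]
          have := Finset.card_union_add_card_inter p p₀
          have := Finset.card_le_card (Finset.union_subset hpsub hp₀sub)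
          have := (hH _ hh₀.1).1
          omega
        rw [Finset.mem_inter] at hu
        have hpair : ∀ p : Finset V, p ⊆ K → p.card = 2 → u ∈ p → ∃ v, u ≠ v ∧ p = {u, v} := by
          intro p _ hp hu
          obtain ⟨v, hv, hne⟩ := Finset.exists_mem_ne (show 1 < p.card by omega) u
          refine ⟨v, hne.symm, (Finset.eq_of_subset_of_card_le ?_ ?_).symm⟩
          · exact Finset.insert_subset hu (Finset.singleton_subset_iff.2 hv)
          · rw [hp, Finset.card_pair hne.symm]
        obtain ⟨v, huv, rfl⟩ := hpair p hp.1 hp.2 hu.1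
        obtain ⟨w, huw, rfl⟩ := hpair p₀ hp₀.1 hp₀.2 hu.2
        have hc : codegree H u v ≤ 1 := by
          by_contra! hc
          exact hn (hex u v h₀ hc)
        exact hn₀ (hex u w h₀ (h₂ u (hKW (hp.1 (by simp))) v (hKW (hp.1 (by simp))) w
          (hKW (hp₀.1 (by simp))) huv huw (fun h => hne (h ▸ rfl)) hc))
      · push Not at hp
        exact ⟨h₀, ∅, huniq, fun p hpK => Or.inr (hp p hpK)⟩
  have hm : ∀ p ∈ K.powersetCard 2, ∃ h ∈ H, p ⊆ h ∧ (h ∩ K = p ∨ p = p₀ ∧ h = h₀ ∧ h₀ ⊆ K) := by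
    intro p hp
    rcases hp₀ p hp with ⟨hpp, hh, hs, hK⟩ | ⟨h, hh, hne, hs⟩
    · exact ⟨h₀, hh, hs, Or.inr ⟨hpp, rfl, hK⟩⟩
    · refine ⟨h, hh, hs, Or.inl (Finset.eq_of_subset_of_card_le
        (Finset.subset_inter hs (Finset.mem_powersetCard.1 hp).1) ?_).symm⟩
      rw [(Finset.mem_powersetCard.1 hp).2]
      have h₃ := (hH h hh).1
      have := Finset.card_lt_card (Finset.ssubset_iff_subset_ne.2
        ⟨Finset.inter_subset_left, fun he => hh₀ h hh hne (Finset.inter_eq_left.1 he)⟩)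
      omega
  choose! m hmH hmp hmK using hm
  refine hasShortBergeK4_of_injOn hK m (fun p hp q hq hpq => ?_) (fun p hp => ⟨hmH p hp, hmp p hp⟩)
    ((Finset.card_le_card (Finset.biUnion_subset.2 fun p hp => (hH _ (hmH p hp)).2)).trans hW)
  have hcard : ∀ p ∈ K.powersetCard 2, m p ∩ K = p → ¬ m p ⊆ K := by
    intro p hp he hs
    have h₃ := (hH _ (hmH p hp)).1
    rw [Finset.inter_eq_left.2 hs] at he
    rw [he, (Finset.mem_powersetCard.1 hp).2] at h₃
    omega
  rcases hmK p hp with h | h <;> rcases hmK q hq with h' | h'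
  · rw [← h, ← h', hpq]
  · exact absurd (hpq.subset.trans (h'.2.1.subset.trans h'.2.2)) (hcard p hp h)
  · exact absurd (hpq.symm.subset.trans (h.2.1.subset.trans h.2.2)) (hcard q hq h')
  · rw [h.1, h'.1]

lemma exists_card_filter_subset_le_one {H : Finset (Finset V)} {W : Finset V} (hW : W.card = 8)
    (hH : ∀ h ∈ H, h.card = 3 ∧ h ⊆ W) (hcard : H.card < 28) :
    ∃ K ⊆ W, K.card = 4 ∧ (H.filter (· ⊆ K)).card ≤ 1 := by
  obtain ⟨K, hK, hlt⟩ : ∃ K ∈ W.powersetCard 4, (H.filter (· ⊆ K)).card < 2 := by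
    refine Finset.exists_lt_of_sum_lt ?_
    have := Finset.sum_card_bipartiteAbove_eq_sum_card_bipartiteBelow (s := W.powersetCard 4)
      (t := H) (fun K h => h ⊆ K)
    simp only [Finset.bipartiteAbove, Finset.bipartiteBelow] at this
    rw [this, Finset.sum_const, Finset.card_powersetCard, hW, smul_eq_mul,
      show Nat.choose 8 4 = 70 by decide]
    have hle : ∀ h ∈ H, ((W.powersetCard 4).filter (h ⊆ ·)).card ≤ 5 := by
      intro h hh
      obtain ⟨h₃, hs⟩ := hH h hh
      have hsub : (W.powersetCard 4).filter (h ⊆ ·) ⊆ (W \ h).image (insert · h) := by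
        intro K hK
        rw [Finset.mem_filter, Finset.mem_powersetCard] at hK
        obtain ⟨⟨hKW, hK⟩, hhK⟩ := hK
        have : h ⋖ K := by
          rw [Finset.covBy_iff_card_sdiff_eq_one, Finset.card_sdiff_of_subset hhK, hK, h₃]
          exact ⟨hhK, rfl⟩
        obtain ⟨x, hx, rfl⟩ := Finset.covBy_iff_exists_insert.1 this
        exact Finset.mem_image_of_mem _
          (Finset.mem_sdiff.2 ⟨hKW (Finset.mem_insert_self _ _), hx⟩)
      refine (Finset.card_le_card hsub).trans (Finset.card_image_le.trans ?_)
      rw [Finset.card_sdiff_of_subset hs, hW, h₃]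
    have := Finset.sum_le_card_nsmul _ _ _ hle
    rw [smul_eq_mul] at this
    omega
  rw [Finset.mem_powersetCard] at hK
  exact ⟨K, hK.1, hK.2, by omega⟩

lemma card_filter_notMem_notMem_add (H : Finset (Finset V)) (u v : V) :
    ((H.filter (u ∉ ·)).filter (v ∉ ·)).card + vertexDegree H u + vertexDegree H v =
      H.card + codegree H u v := by
  have h₁ := card_filter_notMem_add_vertexDegree H u
  have h₂ := card_filter_notMem_add_vertexDegree (H.filter (u ∉ ·)) v
  have h₃ : vertexDegree (H.filter (u ∉ ·)) v + codegree H u v = vertexDegree H v := by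
    have := Finset.card_filter_add_card_filter_not (s := H.filter (v ∈ ·)) (u ∈ ·)
    rw [Finset.filter_filter, Finset.filter_filter] at this
    unfold vertexDegree codegree
    rw [← this, Finset.filter_filter, add_comm]
    simp only [and_comm]
  omega

lemma codegree_comm (H : Finset (Finset V)) (u v : V) : codegree H u v = codegree H v u := by
  simp only [codegree, and_comm]

lemma sizeBound_eight : SizeBound V 8 18 := by
  refine .of_card_eq fun H W hW hH hno hcard => ?_
  have hdeg : ∀ v ∈ W, 7 ≤ vertexDegree H v := fun v hv => by
    have := sizeBound_seven.le_add_vertexDegree hW hH hno hv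
    omega
  have hsum := sum_vertexDegree hH
  have hdeg₂ : ∀ u ∈ W, ∀ v ∈ W, u ≠ v → vertexDegree H u + vertexDegree H v ≤ 15 := by
    intro u hu v hv huv
    rw [← Finset.add_sum_erase _ _ hu,
      ← Finset.add_sum_erase _ _ (Finset.mem_erase.2 ⟨huv.symm, hv⟩)] at hsum
    have := Finset.card_nsmul_le_sum ((W.erase u).erase v) (fun v => vertexDegree H v) 7
      fun w hw => hdeg w (Finset.mem_of_mem_erase (Finset.mem_of_mem_erase hw))
    rw [Finset.card_erase_of_mem (Finset.mem_erase.2 ⟨huv.symm, hv⟩),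
      Finset.card_erase_of_mem hu, hW, smul_eq_mul] at this
    omega
  have havoid : ∀ u ∈ W, ∀ v ∈ W, u ≠ v →
      ((H.filter (u ∉ ·)).filter (v ∉ ·)).card ≤ 7 := by
    have key : ∀ u ∈ W, ∀ v ∈ W, u ≠ v → vertexDegree H u = 7 →
        ((H.filter (u ∉ ·)).filter (v ∉ ·)).card ≤ 7 := by
      intro u hu v hv huv hd
      by_contra! h8
      have h₁ := card_filter_notMem_add_vertexDegree H u
      have h₂ := card_filter_notMem_add_vertexDegree (H.filter (u ∉ ·)) v
      have h₃ : ((H.filter (u ∉ ·)).filter (v ∉ ·)).card ≤ 8 := by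
        refine sizeBound_six _ ((W.erase u).erase v) ?_ (fun h hh => ?_)
          fun h => hno (h.mono ((Finset.filter_subset _ _).trans (Finset.filter_subset _ _)))
        · rw [Finset.card_erase_of_mem (Finset.mem_erase.2 ⟨huv.symm, hv⟩),
            Finset.card_erase_of_mem hu, hW]
        · rw [Finset.mem_filter, Finset.mem_filter] at hh
          exact ⟨(hH h hh.1.1).1,
            Finset.subset_erase.2 ⟨Finset.subset_erase.2 ⟨(hH h hh.1.1).2, hh.1.2⟩, hh.2⟩⟩
      exact hno (hasShortBergeK4_of_two_vertices hu hv huv hW hH h8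
        (show 4 ≤ vertexDegree (H.filter (u ∉ ·)) v by omega) hd.ge)
    intro u hu v hv huv
    have h₁ := hdeg u hu
    have h₂ := hdeg v hv
    have h₃ := hdeg₂ u hu v hv huv
    rcases h₁.lt_or_eq with h | h
    · have := key v hv u hu huv.symm (by omega)
      have h₄ := card_filter_notMem_notMem_add H u v
      have h₅ := card_filter_notMem_notMem_add H v u
      rw [codegree_comm H v u] at h₅
      omega
    · exact key u hu v hv huv h.symm
  have hrel := fun u v => card_filter_notMem_notMem_add H u v
  have hdef : ∀ u ∈ W, ∑ v ∈ W.erase u, (7 - ((H.filter (u ∉ ·)).filter (v ∉ ·)).card) + 27 =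
      4 * vertexDegree H u := by
    intro u hu
    have h₁ := sum_codegree hH u
    have h₂ : ∑ v ∈ W.erase u, ((7 - ((H.filter (u ∉ ·)).filter (v ∉ ·)).card) +
        codegree H u v + 12) = ∑ v ∈ W.erase u, (vertexDegree H u + vertexDegree H v) := by
      refine Finset.sum_congr rfl fun v hv => ?_
      rw [Finset.mem_erase] at hv
      have := havoid u hu v hv.2 hv.1.symm
      have := hrel u v
      omega
    rw [Finset.sum_add_distrib, Finset.sum_add_distrib, h₁, Finset.sum_add_distrib,
      Finset.sum_const, Finset.sum_const, Finset.card_erase_of_mem hu, hW, smul_eq_mul,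
      smul_eq_mul] at h₂
    rw [← Finset.add_sum_erase _ _ hu] at hsum
    omega
  have hdef₁ : ∀ u ∈ W, ∀ v ∈ W, u ≠ v → vertexDegree H u = 7 →
      6 ≤ ((H.filter (u ∉ ·)).filter (v ∉ ·)).card := by
    intro u hu v hv huv hd
    have h₁ := hdef u hu
    have h₂ := Finset.single_le_sum
      (f := fun v => 7 - ((H.filter (u ∉ ·)).filter (v ∉ ·)).card)
      (fun _ _ => Nat.zero_le _) (Finset.mem_erase.2 ⟨huv.symm, hv⟩)
    omega
  have hcod : ∀ u ∈ W, ∀ v ∈ W, u ≠ v → 1 ≤ codegree H u v ∧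
      (vertexDegree H u ≠ 7 → 2 ≤ codegree H u v) := by
    intro u hu v hv huv
    have h₁ := hdeg u hu
    have h₂ := hdeg v hv
    have h₃ := hdeg₂ u hu v hv huv
    have h₄ := hrel u v
    have h₅ := hrel v u
    rw [codegree_comm H v u] at h₅
    rcases h₁.lt_or_eq with h | h
    · have := hdef₁ v hv u hu huv.symm (by omega)
      omega
    · have := hdef₁ u hu v hv huv h.symm
      omega
  obtain ⟨K, hKW, hK, hin⟩ := exists_card_filter_subset_le_one hW hH (by omega)
  refine hno (hasShortBergeK4_of_codegree (by omega) hH (fun u hu v hv huv =>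
    (hcod u hu v hv huv).1) (fun u hu v hv w hw huv huw hvw hc => ?_) hKW hK hin)
  by_cases hd : vertexDegree H u = 7
  · by_contra! hc'
    have h₁ := hdef u hu
    rw [← Finset.add_sum_erase _ _ (Finset.mem_erase.2 ⟨huv.symm, hv⟩),
      ← Finset.add_sum_erase _ _ (Finset.mem_erase.2
        ⟨hvw.symm, Finset.mem_erase.2 ⟨huw.symm, hw⟩⟩)] at h₁
    have := hrel u v
    have := hrel u w
    have := hdeg v hv
    have := hdeg w hw
    omega
  · exact absurd ((hcod u hu v hv huv).2 hd) (by omega)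

lemma sizeBound_nine : SizeBound V 9 27 := sizeBound_eight.succ (by omega)

end SmallCases

/-! ### Representatives for pairs -/

lemma exists_injOn_of_card_le_card_biUnion {ι α : Type*} [DecidableEq ι] [DecidableEq α]
    [Nonempty α] (s : Finset ι) (t : ι → Finset α)
    (h : ∀ A ⊆ s, A.card ≤ (A.biUnion t).card) :
    ∃ f : ι → α, Set.InjOn f s ∧ ∀ i ∈ s, f i ∈ t i := by
  obtain ⟨f, hf, hft⟩ := (Finset.all_card_le_biUnion_card_iff_exists_injective
    (fun i : s => t i)).1 fun A => by
      have := h (A.map (Function.Embedding.subtype _)) fun i hi => by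
        obtain ⟨j, -, rfl⟩ := Finset.mem_map.1 hi
        exact j.2
      rw [Finset.card_map] at this
      refine this.trans (Finset.card_le_card fun a ha => ?_)
      obtain ⟨i, hi, ha⟩ := Finset.mem_biUnion.1 ha
      obtain ⟨j, hj, rfl⟩ := Finset.mem_map.1 hi
      exact Finset.mem_biUnion.2 ⟨j, hj, ha⟩
  refine ⟨fun i => if hi : i ∈ s then f ⟨i, hi⟩ else Classical.arbitrary α, fun i hi j hj hij => ?_,
    fun i hi => ?_⟩
  · rw [Finset.mem_coe] at hi hj
    simp only [hi, hj, dif_pos] at hij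
    exact congrArg Subtype.val (hf hij)
  · simp only [hi, dif_pos]
    exact hft ⟨i, hi⟩

section Representatives

variable {V : Type*} [DecidableEq V]

/-- The pairs contained in a triple of `S`. -/
def shadowPairs (S : Finset (Finset V)) : Finset (Finset V) := S.biUnion (Finset.powersetCard 2)

/-- A triple system splits into two parts, such that there are representatives for the pairs in
the triples of the first part, and for as many other pairs as there are triples in the second
part. -/
lemma exists_representatives (H : Finset (Finset V)) :
    ∃ (S R : Finset (Finset V)) (m : Finset V → Finset V), S ⊆ H ∧ R.card + S.card = H.card ∧
      Disjoint (shadowPairs S) R ∧ Set.InjOn m (shadowPairs S ∪ R : Finset (Finset V)) ∧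
      ∀ p ∈ shadowPairs S ∪ R, p.card = 2 ∧ m p ∈ H ∧ p ⊆ m p := by
  obtain ⟨S, hS, hmax⟩ := Finset.exists_max_image H.powerset
    (fun S => (S.card : ℤ) - (shadowPairs S).card) ⟨∅, Finset.empty_mem_powerset _⟩
  rw [Finset.mem_powerset] at hS
  obtain ⟨f, hf, hft⟩ := exists_injOn_of_card_le_card_biUnion (H \ S)
    (fun h => h.powersetCard 2 \ shadowPairs S) fun A hA => by
      have h₁ := hmax (S ∪ A) (Finset.mem_powerset.2
        (Finset.union_subset hS (hA.trans Finset.sdiff_subset)))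
      have h₂ : shadowPairs (S ∪ A) ⊆
          shadowPairs S ∪ A.biUnion fun h => h.powersetCard 2 \ shadowPairs S := by
        intro p hp
        by_cases hpS : p ∈ shadowPairs S
        · exact Finset.mem_union_left _ hpS
        · obtain ⟨h, hh, hph⟩ := Finset.mem_biUnion.1 hp
          rcases Finset.mem_union.1 hh with hh | hh
          · exact absurd (Finset.mem_biUnion.2 ⟨h, hh, hph⟩) hpS
          · exact Finset.mem_union_right _ (Finset.mem_biUnion.2
              ⟨h, hh, Finset.mem_sdiff.2 ⟨hph, hpS⟩⟩)
      have h₃ := (Finset.card_le_card h₂).trans (Finset.card_union_le _ _)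
      have h₄ : (S ∪ A).card = S.card + A.card := Finset.card_union_of_disjoint
        (Finset.disjoint_of_subset_right hA Finset.disjoint_sdiff)
      omega
  obtain ⟨g, hg, hgt⟩ := exists_injOn_of_card_le_card_biUnion (shadowPairs S)
    (fun p => S.filter (p ⊆ ·)) fun A hA => by
      have h₁ := hmax (S \ A.biUnion fun p => S.filter (p ⊆ ·)) (Finset.mem_powerset.2
        (Finset.sdiff_subset.trans hS))
      have h₂ : shadowPairs (S \ A.biUnion fun p => S.filter (p ⊆ ·)) ⊆ shadowPairs S \ A := by
        intro p hp
        obtain ⟨h, hh, hph⟩ := Finset.mem_biUnion.1 hp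
        rw [Finset.mem_sdiff] at hh
        refine Finset.mem_sdiff.2 ⟨Finset.mem_biUnion.2 ⟨h, hh.1, hph⟩, fun hpA => hh.2 ?_⟩
        exact Finset.mem_biUnion.2
          ⟨p, hpA, Finset.mem_filter.2 ⟨hh.1, (Finset.mem_powersetCard.1 hph).1⟩⟩
      have h₃ := Finset.card_le_card h₂
      rw [Finset.card_sdiff_of_subset hA] at h₃
      have h₄ := Finset.card_le_card hA
      have h₅ : (A.biUnion fun p => S.filter (p ⊆ ·)) ⊆ S :=
        Finset.biUnion_subset.2 fun p _ => Finset.filter_subset _ _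
      rw [Finset.card_sdiff_of_subset h₅] at h₁
      have h₆ := Finset.card_le_card h₅
      omega
  have hf₂ : ∀ h ∈ H \ S, f h ∉ shadowPairs S := fun h hh => (Finset.mem_sdiff.1 (hft h hh)).2
  have hinv : ∀ h ∈ H \ S, Function.invFunOn f (H \ S : Finset (Finset V)) (f h) = h := fun h hh =>
    hf.leftInvOn_invFunOn hh
  set m : Finset V → Finset V := fun p => if p ∈ shadowPairs S then g p else
    Function.invFunOn f (H \ S : Finset (Finset V)) p with hm
  have hmS : ∀ p ∈ shadowPairs S, m p = g p := fun p hp => if_pos hp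
  have hmR : ∀ h ∈ H \ S, m (f h) = h := fun h hh => (if_neg (hf₂ h hh)).trans (hinv h hh)
  refine ⟨S, (H \ S).image f, m, hS, ?_, ?_, ?_, ?_⟩
  · rw [Finset.card_image_of_injOn hf, Finset.card_sdiff_of_subset hS]
    exact Nat.sub_add_cancel (Finset.card_le_card hS)
  · refine Finset.disjoint_right.2 fun p hp => ?_
    obtain ⟨h, hh, rfl⟩ := Finset.mem_image.1 hp
    exact hf₂ h hh
  · have hne : ∀ p ∈ shadowPairs S, ∀ h ∈ H \ S, m p ≠ m (f h) := by
      intro p hp h hh he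
      rw [hmS p hp, hmR h hh] at he
      exact (Finset.mem_sdiff.1 hh).2 (he ▸ (Finset.mem_filter.1 (hgt p hp)).1)
    intro p hp q hq hpq
    rcases Finset.mem_union.1 hp with hp | hp <;> rcases Finset.mem_union.1 hq with hq | hq
    · rw [hmS p hp, hmS q hq] at hpq
      exact hg hp hq hpq
    · obtain ⟨h, hh, rfl⟩ := Finset.mem_image.1 hq
      exact absurd hpq (hne p hp h hh)
    · obtain ⟨h, hh, rfl⟩ := Finset.mem_image.1 hp
      exact absurd hpq.symm (hne q hq h hh)
    · obtain ⟨h, hh, rfl⟩ := Finset.mem_image.1 hp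
      obtain ⟨h', hh', rfl⟩ := Finset.mem_image.1 hq
      rw [hmR h hh, hmR h' hh'] at hpq
      rw [hpq]
  · intro p hp
    rcases Finset.mem_union.1 hp with hp | hp
    · obtain ⟨h, hh, hph⟩ := Finset.mem_biUnion.1 hp
      rw [hmS p hp]
      have := Finset.mem_filter.1 (hgt p hp)
      exact ⟨(Finset.mem_powersetCard.1 hph).2, hS this.1, this.2⟩
    · obtain ⟨h, hh, rfl⟩ := Finset.mem_image.1 hp
      rw [hmR h hh]
      have := Finset.mem_powersetCard.1 (Finset.mem_sdiff.1 (hft h hh)).1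
      exact ⟨this.2, (Finset.mem_sdiff.1 hh).1, this.1⟩

/-- In a triple system without a short Berge-`K₄`, the representatives of the pairs in a 4-set have
distinct vertices outside the 4-set. -/
lemma not_sdiff_subset_biUnion {H : Finset (Finset V)} (hH : ∀ h ∈ H, h.card = 3)
    (hno : ¬ HasShortBergeK4 H) {K : Finset V} (hK : K.card = 4) {m : Finset V → Finset V}
    (hinj : Set.InjOn m (K.powersetCard 2)) (hm : ∀ p ∈ K.powersetCard 2, m p ∈ H ∧ p ⊆ m p)
    {q : Finset V} (hq : q ∈ K.powersetCard 2) :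
    ¬ m q \ K ⊆ ((K.powersetCard 2).erase q).biUnion fun p => m p \ K := by
  intro hsub
  refine hno (hasShortBergeK4_of_injOn hK m hinj hm ?_)
  have h₁ : (K.powersetCard 2).biUnion m ⊆
      K ∪ ((K.powersetCard 2).erase q).biUnion fun p => m p \ K := by
    intro v hv
    by_cases hvK : v ∈ K
    · exact Finset.mem_union_left _ hvK
    refine Finset.mem_union_right _ ?_
    obtain ⟨p, hp, hvp⟩ := Finset.mem_biUnion.1 hv
    rcases eq_or_ne p q with rfl | hpq
    · exact hsub (Finset.mem_sdiff.2 ⟨hvp, hvK⟩)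
    · exact Finset.mem_biUnion.2 ⟨p, Finset.mem_erase.2 ⟨hpq, hp⟩, Finset.mem_sdiff.2 ⟨hvp, hvK⟩⟩
  have h₂ : ∀ p ∈ (K.powersetCard 2).erase q, (m p \ K).card ≤ 1 := by
    intro p hp
    have hp := Finset.mem_of_mem_erase hp
    have h₃ := hH _ (hm p hp).1
    have h₄ := Finset.card_le_card
      (Finset.sdiff_subset_sdiff (le_refl (m p)) (Finset.mem_powersetCard.1 hp).1)
    rw [Finset.card_sdiff_of_subset (hm p hp).2, h₃, (Finset.mem_powersetCard.1 hp).2] at h₄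
    exact h₄
  have h₃ := Finset.card_biUnion_le_card_mul _ _ _ h₂
  rw [Finset.card_erase_of_mem hq, Finset.card_powersetCard, hK,
    show Nat.choose 4 2 = 6 by decide] at h₃
  have h₄ := (Finset.card_le_card h₁).trans (Finset.card_union_le _ _)
  omega

lemma disjoint_sdiff_of_representatives {H : Finset (Finset V)} (hH : ∀ h ∈ H, h.card = 3)
    (hno : ¬ HasShortBergeK4 H) {K : Finset V} (hK : K.card = 4) {m : Finset V → Finset V}
    (hinj : Set.InjOn m (K.powersetCard 2)) (hm : ∀ p ∈ K.powersetCard 2, m p ∈ H ∧ p ⊆ m p)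
    {p q : Finset V} (hp : p ∈ K.powersetCard 2) (hq : q ∈ K.powersetCard 2) (hpq : p ≠ q) :
    Disjoint (m p \ K) (m q \ K) := by
  refine Finset.disjoint_left.2 fun v hvp hvq => ?_
  refine not_sdiff_subset_biUnion hH hno hK hinj hm hq fun w hw =>
    Finset.mem_biUnion.2 ⟨p, Finset.mem_erase.2 ⟨hpq, hp⟩, ?_⟩
  have h₁ : (m q \ K).card ≤ 1 := by
    have h₄ := Finset.card_le_card
      (Finset.sdiff_subset_sdiff (le_refl (m q)) (Finset.mem_powersetCard.1 hq).1)
    rw [Finset.card_sdiff_of_subset (hm q hq).2, hH _ (hm q hq).1,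
      (Finset.mem_powersetCard.1 hq).2] at h₄
    exact h₄
  rwa [Finset.card_le_one.1 h₁ w hw v hvq]

lemma not_subset_of_representatives {H : Finset (Finset V)} (hH : ∀ h ∈ H, h.card = 3)
    (hno : ¬ HasShortBergeK4 H) {K : Finset V} (hK : K.card = 4) {m : Finset V → Finset V}
    (hinj : Set.InjOn m (K.powersetCard 2)) (hm : ∀ p ∈ K.powersetCard 2, m p ∈ H ∧ p ⊆ m p)
    {h : Finset V} (hh : h ∈ H) : ¬ h ⊆ K := by
  intro hhK
  have hmK : ∀ p ∈ K.powersetCard 2, m p ≠ h := by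
    rintro p hp rfl
    refine not_sdiff_subset_biUnion hH hno hK hinj hm hp ?_
    rw [Finset.sdiff_eq_empty_iff_subset.2 hhK]
    exact Finset.empty_subset _
  obtain ⟨p, hph, hp⟩ := Finset.exists_subset_card_eq (show 2 ≤ h.card by rw [hH h hh]; norm_num)
  have hpK : p ∈ K.powersetCard 2 := Finset.mem_powersetCard.2 ⟨hph.trans hhK, hp⟩
  have hne : ∀ q, q ≠ p → Function.update m p h q = m q := fun q hq => Function.update_of_ne hq _ _
  refine not_sdiff_subset_biUnion (m := Function.update m p h) hH hno hK (fun q hq r hr hqr => ?_)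
    (fun q hq => ?_) hpK ?_
  · rcases eq_or_ne q p with rfl | hqp <;> rcases eq_or_ne r q with rfl | hrq
    · rfl
    · rw [Function.update_self, hne r hrq] at hqr
      exact absurd hqr.symm (hmK r hr)
    · rfl
    · rcases eq_or_ne r p with rfl | hrp
      · rw [Function.update_self, hne q hqp] at hqr
        exact absurd hqr (hmK q hq)
      · rw [hne q hqp, hne r hrp] at hqr
        exact hinj hq hr hqr
  · rcases eq_or_ne q p with rfl | hqp
    · rw [Function.update_self]
      exact ⟨hh, hph⟩
    · rw [hne q hqp]
      exact hm q hq
  · rw [Function.update_self, Finset.sdiff_eq_empty_iff_subset.2 hhK]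
    exact Finset.empty_subset _

end Representatives

/-! ### A graph inequality -/

section PairSum

variable {V : Type*} [DecidableEq V]

/-- The sum of `ω` over the pairs in `N`. -/
def pairSum (ω : Finset V → ℕ) (N : Finset V) : ℕ := ∑ q ∈ N.powersetCard 2, ω q

lemma pairSum_insert (ω : Finset V → ℕ) {N : Finset V} {v : V} (hv : v ∉ N) :
    pairSum ω (insert v N) = pairSum ω N + ∑ x ∈ N, ω {v, x} := by
  unfold pairSum
  rw [Finset.powersetCard_succ_insert hv, Finset.sum_union, Finset.sum_image]
  · congr 1
    rw [Finset.powersetCard_one, Finset.sum_map]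
    rfl
  · intro p hp q hq hpq
    rw [← Finset.erase_insert fun h => hv ((Finset.mem_powersetCard.1 hp).1 h), hpq,
      Finset.erase_insert fun h => hv ((Finset.mem_powersetCard.1 hq).1 h)]
  · refine Finset.disjoint_left.2 fun p hp hp' => ?_
    obtain ⟨q, -, rfl⟩ := Finset.mem_image.1 hp'
    exact hv ((Finset.mem_powersetCard.1 hp).1 (Finset.mem_insert_self _ _))

lemma pairSum_le_of_pair {ω : Finset V → ℕ} {d : V → ℕ} {N p : Finset V}
    (hp : p ∈ N.powersetCard 2)
    (h : ∀ x ∈ N \ p, ∃ u ∈ p, ω {u, x} = 0) (hd : ∀ x ∈ N \ p, ∀ u ∈ p, ω {u, x} ≤ d x) :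
    pairSum ω N ≤ ω p + ∑ x ∈ N \ p, d x + pairSum ω (N \ p) := by
  rw [Finset.mem_powersetCard] at hp
  obtain ⟨u, w, huw, rfl⟩ := Finset.card_eq_two.1 hp.2
  have hN : N = insert u (insert w (N \ {u, w})) := by
    rw [← Finset.singleton_union, ← Finset.singleton_union, ← Finset.union_assoc,
      Finset.singleton_union, Finset.union_sdiff_of_subset hp.1]
  have hw : w ∉ N \ {u, w} := by simp
  have hu : u ∉ insert w (N \ {u, w}) := by simp [huw]
  have hle : ∑ x ∈ N \ {u, w}, (ω {w, x} + ω {u, x}) ≤ ∑ x ∈ N \ {u, w}, d x := by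
    refine Finset.sum_le_sum fun x hx => ?_
    have h₁ := hd x hx u (by simp)
    have h₂ := hd x hx w (by simp)
    obtain ⟨y, hy, h₀⟩ := h x hx
    rw [Finset.mem_insert, Finset.mem_singleton] at hy
    rcases hy with rfl | rfl <;> omega
  rw [Finset.sum_add_distrib] at hle
  conv_lhs => rw [hN]
  rw [pairSum_insert ω hu, pairSum_insert ω hw, Finset.sum_insert hw]
  omega

/-- A weighted form of Mantel's theorem. -/
lemma pairSum_le_mul_sq_div_four {ω : Finset V → ℕ} {L : Finset (Finset V)} {k : ℕ}
    (hω : ∀ q, ω q ≤ k) (hωL : ∀ q ∉ L, 2 * ω q ≤ k) (N : Finset V)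
    (h : ∀ p ∈ L, ∀ x ∈ N, x ∉ p → ∃ u ∈ p, ω {u, x} = 0) :
    pairSum ω N ≤ k * (N.card ^ 2 / 4) := by
  induction hn : N.card using Nat.strong_induction_on generalizing N with
  | _ n ih =>
  by_cases hL : ∃ p ∈ L, p ∈ N.powersetCard 2
  · obtain ⟨p, hpL, hp⟩ := hL
    have hp' := Finset.mem_powersetCard.1 hp
    have h₁ := pairSum_le_of_pair (ω := ω) (d := fun _ => k) hp
      (fun x hx => h p hpL x (Finset.mem_sdiff.1 hx).1 (Finset.mem_sdiff.1 hx).2)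
      fun _ _ _ _ => hω _
    have hc : (N \ p).card = n - 2 := by rw [Finset.card_sdiff_of_subset hp'.1, hn, hp'.2]
    have h2n : 2 ≤ n := by
      rw [← hn, ← hp'.2]
      exact Finset.card_le_card hp'.1
    have h₂ := ih (n - 2) (by omega) (N \ p)
      (fun q hq x hx => h q hq x (Finset.mem_sdiff.1 hx).1) hc
    rw [Finset.sum_const, hc, smul_eq_mul] at h₁
    have h₃ := hω p
    obtain ⟨n, rfl⟩ := Nat.exists_eq_add_of_le' h2n
    rw [Nat.add_sub_cancel] at h₁ h₂
    have h₄ : (n + 2) ^ 2 / 4 = n ^ 2 / 4 + n + 1 := by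
      rw [show (n + 2) ^ 2 = n ^ 2 + 4 * (n + 1) by ring, Nat.add_mul_div_left _ _ (by norm_num)]
      ring
    rw [h₄]
    calc pairSum ω N ≤ k + n * k + k * (n ^ 2 / 4) := by omega
      _ = k * (n ^ 2 / 4 + n + 1) := by ring
  · have h₁ : 2 * pairSum ω N ≤ n.choose 2 * k := by
      unfold pairSum
      rw [Finset.mul_sum, ← hn, ← Finset.card_powersetCard, ← smul_eq_mul]
      exact Finset.sum_le_card_nsmul _ _ _ fun q hq => hωL q fun hqL => hL ⟨q, hqL, hq⟩
    have h₂ : n.choose 2 ≤ 2 * (n ^ 2 / 4) := by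
      have h₃ := Nat.choose_two_right n
      rcases Nat.even_or_odd' n with ⟨j, rfl | rfl⟩
      · rw [show (2 * j) ^ 2 = 4 * j ^ 2 by ring, Nat.mul_div_cancel_left _ (by norm_num), h₃,
          mul_assoc, Nat.mul_div_cancel_left _ (by norm_num)]
        have := Nat.mul_le_mul_left j (Nat.sub_le (2 * j) 1)
        nlinarith
      · rw [h₃, Nat.add_sub_cancel, show (2 * j + 1) * (2 * j) = 2 * ((2 * j + 1) * j) by ring,
          Nat.mul_div_cancel_left _ (by norm_num),
          show (2 * j + 1) ^ 2 = 1 + 4 * (j * (j + 1)) by ring,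
          Nat.add_mul_div_left _ _ (by norm_num)]
        have : 1 / 4 = 0 := by norm_num
        rw [this]
        nlinarith
    have h₅ := h₁.trans (Nat.mul_le_mul_right k h₂)
    rw [mul_assoc, mul_comm (n ^ 2 / 4)] at h₅
    exact Nat.le_of_mul_le_mul_left h₅ (by norm_num)

lemma pairSum_indicator (L : Finset (Finset V)) (N : Finset V) :
    pairSum (fun q => if q ∈ L then 1 else 0) N = ((N.powersetCard 2).filter (· ∈ L)).card := by
  rw [pairSum, Finset.card_filter]

end PairSum

/-! ### A bound for partial representatives -/

section GraphBound

variable {V : Type*} [DecidableEq V]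

/-- A bound for the pairs in a neighbourhood `N`, where `Z ⊆ N` is the set of neighbours along
edges in `R` and `L` is a link. -/
lemma mul_card_add_mul_card_add_le {L R : Finset (Finset V)} {N Z : Finset V} {a : ℕ} (ha : 1 ≤ a)
    (hL : ∀ p ∈ L, p ⊆ N \ Z ∧ p.card = 2) (hLR : Disjoint L R) (hZ : Z ⊆ N)
    (h : ∀ p ∈ L, ∀ x ∈ N \ p, ∃ u ∈ p, {u, x} ∉ L ∧ {u, x} ∉ R) :
    a * (L.card + Z.card) + ((N.powersetCard 2).filter (· ∈ R)).card ≤ a * (N.card ^ 2 / 4) ∨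
      a * (L.card + Z.card) + ((N.powersetCard 2).filter (· ∈ R)).card ≤
        a * N.card + (L.card + ((N.powersetCard 2).filter (· ∈ R)).card) := by
  have hLN : ∀ p ∈ L, p ∈ N.powersetCard 2 := fun p hp =>
    Finset.mem_powersetCard.2 ⟨(hL p hp).1.trans Finset.sdiff_subset, (hL p hp).2⟩
  have hpZ : ∀ p ∈ L, Disjoint p Z := fun p hp =>
    Finset.disjoint_of_subset_left (hL p hp).1 Finset.sdiff_disjoint
  have hxZ : ∀ x ∈ Z, ∀ u, ({u, x} : Finset V) ∉ L := fun x hx u hp =>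
    Finset.disjoint_right.1 (hpZ _ hp) hx (by simp)
  have hZc := Finset.card_le_card hZ
  have hsum : ∀ (M : Finset V) (b c : ℕ), Z ⊆ M →
      ∑ x ∈ M, (if x ∈ Z then b else c) + c * Z.card = c * M.card + b * Z.card := by
    intro M b c hM
    rw [← Finset.sum_sdiff hM, Finset.sum_congr rfl fun x hx => if_neg (Finset.mem_sdiff.1 hx).2,
      Finset.sum_congr (s₁ := Z) rfl fun x hx => if_pos hx, Finset.sum_const, Finset.sum_const,
      Finset.card_sdiff_of_subset hM, smul_eq_mul, smul_eq_mul]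
    obtain ⟨k, hk⟩ := Nat.exists_eq_add_of_le (Finset.card_le_card hM)
    rw [hk, Nat.add_sub_cancel_left]
    ring
  by_cases hdis : ∃ p ∈ L, ∃ q ∈ L, Disjoint p q
  · rcases ha.eq_or_lt with rfl | ha
    · right; omega
    left
    obtain ⟨p, hp, q, hq, hpq⟩ := hdis
    set ω : Finset V → ℕ := fun q => if q ∈ L then a else if q ∈ R then 1 else 0 with hω
    have hωa : ∀ q, ω q ≤ a := by
      intro q
      simp only [hω]
      split_ifs <;> omega
    have hωL : ∀ q ∉ L, ω q ≤ 1 := by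
      intro q hq
      simp only [hω, if_neg hq]
      split_ifs <;> omega
    have hω₀ : ∀ p ∈ L, ∀ x ∈ N, x ∉ p → ∃ u ∈ p, ω {u, x} = 0 := by
      intro p hp x hx hxp
      obtain ⟨u, hu, h₁, h₂⟩ := h p hp x (Finset.mem_sdiff.2 ⟨hx, hxp⟩)
      exact ⟨u, hu, by simp only [hω, if_neg h₁, if_neg h₂]⟩
    have hd : ∀ x u, ω {u, x} ≤ if x ∈ Z then 1 else a := by
      intro x u
      split_ifs with hx
      · exact hωL _ (hxZ x hx u)
      · exact hωa _
    have hω₁ : pairSum ω N = a * L.card + ((N.powersetCard 2).filter (· ∈ R)).card := by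
      have h₁ : ∀ q, ω q = a * (if q ∈ L then 1 else 0) + if q ∈ R then 1 else 0 := by
        intro q
        by_cases hq : q ∈ L
        · simp [hω, hq, Finset.disjoint_left.1 hLR hq]
        · simp [hω, hq]
      unfold pairSum
      rw [Finset.sum_congr rfl fun q _ => h₁ q, Finset.sum_add_distrib, ← Finset.mul_sum,
        ← Finset.card_filter, ← Finset.card_filter]
      congr 3
      ext q
      simp only [Finset.mem_filter]
      exact ⟨fun hq => hq.2, fun hq => ⟨hLN q hq, hq⟩⟩
    have hq₁ : q ∈ (N \ p).powersetCard 2 := Finset.mem_powersetCard.2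
      ⟨Finset.subset_sdiff.2 ⟨(Finset.mem_powersetCard.1 (hLN q hq)).1, hpq.symm⟩, (hL q hq).2⟩
    have h₁ := pairSum_le_of_pair (ω := ω) (hLN p hp)
      (fun x hx => hω₀ p hp x (Finset.mem_sdiff.1 hx).1 (Finset.mem_sdiff.1 hx).2)
      fun x _ u _ => hd x u
    have h₂ := pairSum_le_of_pair (ω := ω) hq₁
      (fun x hx => hω₀ q hq x (Finset.mem_sdiff.1 (Finset.mem_sdiff.1 hx).1).1
        (Finset.mem_sdiff.1 hx).2)
      fun x _ u _ => hd x u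
    have h₃ := pairSum_le_mul_sq_div_four hωa (fun q hq => by have := hωL q hq; omega)
      ((N \ p) \ q) fun p hp x hx => hω₀ p hp x
        (Finset.mem_sdiff.1 (Finset.mem_sdiff.1 hx).1).1
    have hZp : Z ⊆ N \ p := Finset.subset_sdiff.2 ⟨hZ, (hpZ p hp).symm⟩
    have hZq : Z ⊆ (N \ p) \ q := Finset.subset_sdiff.2 ⟨hZp, (hpZ q hq).symm⟩
    have h₄ := hsum _ 1 a hZp
    have h₅ := hsum _ 1 a hZq
    have h₆ := hωa p
    have h₇ := hωa q
    have hc₁ := Finset.card_sdiff_add_card_eq_card (Finset.mem_powersetCard.1 (hLN p hp)).1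
    have hc₂ := Finset.card_sdiff_add_card_eq_card (Finset.mem_powersetCard.1 hq₁).1
    rw [(hL p hp).2] at hc₁
    rw [(hL q hq).2] at hc₂
    rw [← hc₁, ← hc₂]
    rw [← hc₂] at h₄
    generalize ((N \ p) \ q).card = j at *
    have h₈ : (j + 2 + 2) ^ 2 / 4 = j ^ 2 / 4 + (2 * j + 4) := by
      rw [show (j + 2 + 2) ^ 2 = j ^ 2 + 4 * (2 * j + 4) by ring,
        Nat.add_mul_div_left _ _ (by norm_num)]
    rw [h₈]
    have h₉ : 2 * Z.card ≤ a * Z.card := Nat.mul_le_mul_right _ ha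
    rw [mul_add] at h₄ ⊢
    rw [mul_add, mul_add]
    rw [show a * (2 * j) = a * j + a * j by ring]
    omega
  · right
    rcases L.eq_empty_or_nonempty with rfl | ⟨p, hp⟩
    · have := Nat.mul_le_mul_left a hZc
      simpa using this
    have h₁ := pairSum_le_of_pair (ω := fun q => if q ∈ L then 1 else 0)
      (d := fun x => if x ∈ Z then 0 else 1) (hLN p hp)
      (fun x hx => by
        obtain ⟨u, hu, h₁, -⟩ := h p hp x hx
        exact ⟨u, hu, if_neg h₁⟩)
      (fun x _ u _ => by
        by_cases hx : x ∈ Z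
        · simp [hxZ x hx u]
        · rw [if_neg hx]
          split_ifs <;> omega)
    have h₂ : ((N.powersetCard 2).filter (· ∈ L)) = L := by
      ext q
      simp only [Finset.mem_filter]
      exact ⟨fun hq => hq.2, fun hq => ⟨hLN q hq, hq⟩⟩
    have h₃ : (((N \ p).powersetCard 2).filter (· ∈ L)) = ∅ := by
      refine Finset.filter_false_of_mem fun q hq hqL => hdis ⟨p, hp, q, hqL, ?_⟩
      exact (Finset.subset_sdiff.1 (Finset.mem_powersetCard.1 hq).1).2.symm
    rw [pairSum_indicator, pairSum_indicator, h₂, h₃, if_pos hp, Finset.card_empty] at h₁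
    have h₄ := hsum _ 0 1 (Finset.subset_sdiff.2 ⟨hZ, (hpZ p hp).symm⟩)
    have hc₁ := Finset.card_sdiff_add_card_eq_card (Finset.mem_powersetCard.1 (hLN p hp)).1
    rw [(hL p hp).2] at hc₁
    obtain ⟨a, rfl⟩ := Nat.exists_eq_add_of_le' ha
    have h₅ : a * (L.card + Z.card) ≤ a * N.card := Nat.mul_le_mul_left a (by omega)
    rw [add_mul, add_mul]
    omega

lemma card_filter_not_subset_le {H : Finset (Finset V)} {W N : Finset V} (hH : ∀ h ∈ H, h ⊆ W) :
    (H.filter (¬ · ⊆ N)).card ≤ ∑ u ∈ W \ N, vertexDegree H u := by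
  refine (Finset.card_le_card fun h hh => ?_).trans Finset.card_biUnion_le
  rw [Finset.mem_filter, Finset.not_subset] at hh
  obtain ⟨hh, u, hu, huN⟩ := hh
  exact Finset.mem_biUnion.2 ⟨u, Finset.mem_sdiff.2 ⟨hH h hh hu, huN⟩, Finset.mem_filter.2 ⟨hh, hu⟩⟩

lemma card_add_card_le_of_shadowPairs {S R : Finset (Finset V)} {W : Finset V} (hW : W.Nonempty)
    (hS : ∀ h ∈ S, h.card = 3 ∧ h ⊆ W) (hR : ∀ p ∈ R, p.card = 2 ∧ p ⊆ W)
    (hSR : Disjoint (shadowPairs S) R)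
    (h : ∀ h ∈ S, ∀ d ∉ h, ∃ u ∈ h, {u, d} ∉ shadowPairs S ∪ R) (e : ℕ → ℕ)
    (he : ∀ v ∈ W, ∀ N ⊆ W, (∀ u ∈ N, u ≠ v ∧ {u, v} ∈ shadowPairs S ∪ R) →
      ((N.powersetCard 2).filter (· ∈ shadowPairs S ∪ R)).card ≤ e N.card) :
    ∃ a m, 1 ≤ a ∧ a + m = W.card ∧
      (S.card + R.card ≤ a * (m ^ 2 / 4) ∨ S.card + R.card ≤ a * m + e m) := by
  obtain ⟨v, hv, hmax⟩ := Finset.exists_max_image W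
    (fun v => vertexDegree S v + vertexDegree R v) hW
  set N := W.filter fun u => u ≠ v ∧ {u, v} ∈ shadowPairs S ∪ R with hN
  have hNW : N ⊆ W := Finset.filter_subset _ _
  have hvN : v ∉ N := fun hv => (Finset.mem_filter.1 hv).2.1 rfl
  have hcard := Finset.card_sdiff_add_card_eq_card hNW
  have hA : 1 ≤ (W \ N).card := Finset.card_pos.2 ⟨v, Finset.mem_sdiff.2 ⟨hv, hvN⟩⟩
  refine ⟨(W \ N).card, N.card, hA, hcard, ?_⟩
  have hSN : S.filter (¬ · ⊆ N) = S := by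
    refine Finset.filter_true_of_mem fun s hs hsN => ?_
    obtain ⟨u, hu, huv⟩ := h s hs v fun hvs => hvN (hsN hvs)
    exact huv (Finset.mem_filter.1 (hsN hu)).2.2
  have hRN : R.filter (· ⊆ N) = (N.powersetCard 2).filter (· ∈ R) := by
    ext p
    simp only [Finset.mem_filter, Finset.mem_powersetCard]
    exact ⟨fun hp => ⟨⟨hp.2, (hR p hp.1).1⟩, hp.1⟩, fun hp => ⟨hp.2, hp.1.1⟩⟩
  have hS₁ := card_filter_not_subset_le (N := N) fun s hs => (hS s hs).2
  have hR₁ := card_filter_not_subset_le (N := N) fun p hp => (hR p hp).2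
  have hR₂ := Finset.card_filter_add_card_filter_not (s := R) (· ⊆ N)
  rw [hSN] at hS₁
  rw [hRN] at hR₂
  have hsum : ∑ u ∈ W \ N, (vertexDegree S u + vertexDegree R u) ≤
      (W \ N).card * (vertexDegree S v + vertexDegree R v) :=
    Finset.sum_le_card_nsmul _ _ _ fun u hu => hmax u (Finset.mem_sdiff.1 hu).1
  rw [Finset.sum_add_distrib] at hsum
  set L := (S.filter (v ∈ ·)).image (Finset.erase · v) with hLdef
  set Z := N.filter fun u => {u, v} ∈ R with hZ
  have hLS : ∀ p ∈ L, v ∉ p ∧ p.card = 2 ∧ insert v p ∈ S := by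
    intro p hp
    obtain ⟨s, hs, rfl⟩ := Finset.mem_image.1 hp
    rw [Finset.mem_filter] at hs
    refine ⟨Finset.notMem_erase _ _, ?_, by rw [Finset.insert_erase hs.2]; exact hs.1⟩
    rw [Finset.card_erase_of_mem hs.2, (hS s hs.1).1]
  have hcL : L.card = vertexDegree S v := by
    refine Finset.card_image_of_injOn fun s hs t ht hst => ?_
    rw [Finset.mem_coe, Finset.mem_filter] at hs ht
    rw [← Finset.insert_erase hs.2, ← Finset.insert_erase ht.2]
    exact congrArg _ hst
  have hcZ : vertexDegree R v ≤ Z.card := by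
    refine (Finset.card_le_card fun p hp => ?_).trans
      (Finset.card_image_le (f := fun u => ({u, v} : Finset V)))
    rw [Finset.mem_filter] at hp
    obtain ⟨u, hu⟩ := Finset.card_eq_one.1
      (show (p.erase v).card = 1 by rw [Finset.card_erase_of_mem hp.2, (hR p hp.1).1])
    have huv : u ≠ v ∧ u ∈ p := Finset.mem_erase.1 (hu ▸ Finset.mem_singleton_self u)
    have hpu : ({u, v} : Finset V) = p := by
      rw [Finset.pair_comm, ← hu, Finset.insert_erase hp.2]
    refine Finset.mem_image.2 ⟨u, Finset.mem_filter.2 ⟨Finset.mem_filter.2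
      ⟨(hR p hp.1).2 huv.2, huv.1, ?_⟩, hpu ▸ hp.1⟩, hpu⟩
    exact Finset.mem_union_right _ (hpu ▸ hp.1)
  have hpair : ∀ s ∈ S, ∀ p ⊆ s, p.card = 2 → p ∈ shadowPairs S := fun s hs p hp hc =>
    Finset.mem_biUnion.2 ⟨s, hs, Finset.mem_powersetCard.2 ⟨hp, hc⟩⟩
  have hLsh : ∀ p ∈ L, p ∈ shadowPairs S := fun p hp =>
    hpair _ (hLS p hp).2.2 p (Finset.subset_insert _ _) (hLS p hp).2.1
  have hLN : ∀ p ∈ L, p ⊆ N \ Z := by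
    intro p hp u hu
    obtain ⟨hvp, hc, hs⟩ := hLS p hp
    have huv : u ≠ v := fun h => hvp (h ▸ hu)
    have huv' : {u, v} ∈ shadowPairs S := hpair _ hs _ (Finset.insert_subset
      (Finset.mem_insert_of_mem hu) (Finset.singleton_subset_iff.2 (Finset.mem_insert_self _ _)))
      (Finset.card_pair huv)
    refine Finset.mem_sdiff.2 ⟨Finset.mem_filter.2 ⟨(hS _ hs).2 (Finset.mem_insert_of_mem hu), huv,
      Finset.mem_union_left _ huv'⟩, fun hZ => ?_⟩
    exact Finset.disjoint_left.1 hSR huv' (Finset.mem_filter.1 hZ).2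
  have hLR : Disjoint L R :=
    Finset.disjoint_left.2 fun p hp => Finset.disjoint_left.1 hSR (hLsh p hp)
  have hloc : L.card + ((N.powersetCard 2).filter (· ∈ R)).card ≤ e N.card := by
    rw [← Finset.card_union_of_disjoint (Finset.disjoint_of_subset_right
      (fun p hp => (Finset.mem_filter.1 hp).2) hLR)]
    refine (Finset.card_le_card fun p hp => ?_).trans (he v hv N hNW fun u hu =>
      (Finset.mem_filter.1 hu).2)
    rcases Finset.mem_union.1 hp with hp | hp
    · exact Finset.mem_filter.2 ⟨Finset.mem_powersetCard.2
        ⟨(hLN p hp).trans Finset.sdiff_subset, (hLS p hp).2.1⟩,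
        Finset.mem_union_left _ (hLsh p hp)⟩
    · rw [Finset.mem_filter] at hp
      exact Finset.mem_filter.2 ⟨hp.1, Finset.mem_union_right _ hp.2⟩
  have hmain := mul_card_add_mul_card_add_le hA (fun p hp => ⟨hLN p hp, (hLS p hp).2.1⟩) hLR
    (Finset.filter_subset _ N) fun p hp x hx => by
      obtain ⟨hxN, hxp⟩ := Finset.mem_sdiff.1 hx
      have hxv := (Finset.mem_filter.1 hxN).2
      obtain ⟨u, hu, hux⟩ := h _ (hLS p hp).2.2 x fun hx =>
        (Finset.mem_insert.1 hx).elim hxv.1 hxp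
      rcases Finset.mem_insert.1 hu with rfl | hu
      · rw [Finset.pair_comm] at hux
        exact absurd hxv.2 hux
      · exact ⟨u, hu, fun h => hux (Finset.mem_union_left _ (hLsh _ h)),
          fun h => hux (Finset.mem_union_right _ h)⟩
  have hle : (W \ N).card * (vertexDegree S v + vertexDegree R v) ≤
      (W \ N).card * (L.card + Z.card) := Nat.mul_le_mul_left _ (by omega)
  refine hmain.imp (fun hm => ?_) fun hm => ?_ <;> omega

end GraphBound

/-! ### The general bound -/

section GeneralBound

variable {V : Type*} [DecidableEq V]

lemma exists_card_le_of_not_hasShortBergeK4 {H : Finset (Finset V)} {W : Finset V}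
    (hW : W.Nonempty) (hH : ∀ h ∈ H, h.card = 3 ∧ h ⊆ W) (hno : ¬ HasShortBergeK4 H) (e : ℕ → ℕ)
    (he : ∀ (E : Finset (Finset V)) (m : Finset V → Finset V), Set.InjOn m E →
      (∀ p ∈ E, p.card = 2 ∧ m p ∈ H ∧ p ⊆ m p) → ∀ v ∈ W, ∀ N ⊆ W,
      (∀ u ∈ N, u ≠ v ∧ {u, v} ∈ E) → ((N.powersetCard 2).filter (· ∈ E)).card ≤ e N.card) :
    ∃ a m, 1 ≤ a ∧ a + m = W.card ∧ (H.card ≤ a * (m ^ 2 / 4) ∨ H.card ≤ a * m + e m) := by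
  obtain ⟨S, R, m, hS, hcard, hdis, hinj, hm⟩ := exists_representatives H
  rw [← hcard, add_comm R.card]
  refine card_add_card_le_of_shadowPairs hW (fun h hh => hH h (hS hh)) (fun p hp => ?_) hdis
    (fun h hh d hd => ?_) e (he _ m hinj hm)
  · have := hm p (Finset.mem_union_right _ hp)
    exact ⟨this.1, this.2.2.trans (hH _ this.2.1).2⟩
  · by_contra! hcon
    have hK : (insert d h).card = 4 := by rw [Finset.card_insert_of_notMem hd, (hH h (hS hh)).1]
    have hE : (insert d h).powersetCard 2 ⊆ shadowPairs S ∪ R := by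
      intro p hp
      rw [Finset.mem_powersetCard] at hp
      by_cases hdp : d ∈ p
      · obtain ⟨u, hu⟩ := Finset.card_eq_one.1
          (show (p.erase d).card = 1 by rw [Finset.card_erase_of_mem hdp, hp.2])
        have hud := Finset.mem_erase.1 (hu ▸ Finset.mem_singleton_self u)
        have hpu : ({u, d} : Finset V) = p := by
          rw [Finset.pair_comm, ← hu, Finset.insert_erase hdp]
        rw [← hpu]
        exact hcon u (Finset.mem_of_mem_insert_of_ne (hp.1 hud.2) hud.1)
      · exact Finset.mem_union_left _ (Finset.mem_biUnion.2 ⟨h, hh, Finset.mem_powersetCard.2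
          ⟨(Finset.subset_insert_iff_of_notMem hdp).1 hp.1, hp.2⟩⟩)
    exact not_subset_of_representatives (fun h hh => (hH h hh).1) hno hK (hinj.mono hE)
      (fun p hp => (hm p (hE hp)).2) (hS hh) (Finset.subset_insert d h)

end GeneralBound

/-! ### Ten and eleven vertices -/

section MinDegree

variable {V : Type*} [DecidableEq V] {H : Finset (Finset V)} {K : Finset V}
  {m : Finset V → Finset V}

lemma inter_eq_of_representatives (hH : ∀ h ∈ H, h.card = 3) (hno : ¬ HasShortBergeK4 H)
    (hK : K.card = 4) (hinj : Set.InjOn m (K.powersetCard 2))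
    (hm : ∀ p ∈ K.powersetCard 2, m p ∈ H ∧ p ⊆ m p) {h p : Finset V} (hh : h ∈ H)
    (hp : p ∈ K.powersetCard 2) (hph : p ⊆ h) : h ∩ K = p := by
  rw [Finset.mem_powersetCard] at hp
  refine (Finset.eq_of_subset_of_card_le (Finset.subset_inter hph hp.1) ?_).symm
  have : (h ∩ K).card < h.card := Finset.card_lt_card (Finset.ssubset_iff_subset_ne.2
    ⟨Finset.inter_subset_left, fun he => not_subset_of_representatives hH hno hK hinj hm hh
      (Finset.inter_eq_left.1 he)⟩)
  rw [hH h hh] at this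
  omega

lemma card_le_of_representatives (hH : ∀ h ∈ H, h.card = 3) (hno : ¬ HasShortBergeK4 H)
    (hK : K.card = 4) (hinj : Set.InjOn m (K.powersetCard 2))
    (hm : ∀ p ∈ K.powersetCard 2, m p ∈ H ∧ p ⊆ m p) {C : Finset (Finset V)} {Y : Finset V}
    (hC : ∀ h ∈ C, h ∈ H ∧ (h ∩ K).card = 2 ∧ h \ K ⊆ Y) : C.card ≤ Y.card := by
  have hc : ∀ h ∈ C, (h \ K).card = 1 := by
    intro h hh
    have := Finset.card_sdiff_add_card_inter h K
    rw [hH h (hC h hh).1, (hC h hh).2.1] at this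
    omega
  have hp : ∀ h ∈ C, h ∩ K ∈ K.powersetCard 2 := fun h hh =>
    Finset.mem_powersetCard.2 ⟨Finset.inter_subset_right, (hC h hh).2.1⟩
  refine (Finset.card_le_card_biUnion (f := (· \ K)) (fun h hh h' hh' hne => ?_) fun h hh =>
    Finset.card_pos.1 (hc h hh ▸ Nat.one_pos)).trans
    (Finset.card_le_card (Finset.biUnion_subset.2 fun h hh => (hC h hh).2.2))
  rw [Finset.mem_coe] at hh hh'
  by_cases hpq : h ∩ K = h' ∩ K
  · obtain ⟨x, hx⟩ := Finset.card_eq_one.1 (hc h hh)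
    obtain ⟨y, hy⟩ := Finset.card_eq_one.1 (hc h' hh')
    simp only [Function.onFun, hx, hy, Finset.disjoint_singleton]
    rintro rfl
    exact hne (by rw [← Finset.sdiff_union_inter h K, ← Finset.sdiff_union_inter h' K, hx, hy, hpq])
  · set m' := Function.update (Function.update m (h ∩ K) h) (h' ∩ K) h' with hm'
    have h₁ : m' (h ∩ K) = h := by
      rw [hm', Function.update_of_ne hpq, Function.update_self]
    have h₂ : m' (h' ∩ K) = h' := Function.update_self _ _ _
    have hm₂ : ∀ p ∈ K.powersetCard 2, m' p ∈ H ∧ p ⊆ m' p := by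
      intro p hp
      by_cases hp₂ : p = h' ∩ K
      · rw [hp₂, h₂]
        exact ⟨(hC h' hh').1, Finset.inter_subset_left⟩
      by_cases hp₁ : p = h ∩ K
      · rw [hp₁, h₁]
        exact ⟨(hC h hh).1, Finset.inter_subset_left⟩
      rw [hm', Function.update_of_ne hp₂, Function.update_of_ne hp₁]
      exact hm p hp
    have hinj₂ : Set.InjOn m' (K.powersetCard 2) := by
      intro p hp q hq he
      rw [← inter_eq_of_representatives hH hno hK hinj hm (hm₂ p hp).1 hp (hm₂ p hp).2, he]
      exact inter_eq_of_representatives hH hno hK hinj hm (hm₂ q hq).1 hq (hm₂ q hq).2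
    have := disjoint_sdiff_of_representatives hH hno hK hinj₂ hm₂ (hp h hh) (hp h' hh') hpq
    rwa [h₁, h₂] at this

/-- If the pairs in a 4-set have representatives, then the links outside the 4-set are sparse at a
vertex that is active in three of them. -/
lemma sum_card_link_le {W : Finset V} (hH : ∀ h ∈ H, h.card = 3 ∧ h ⊆ W)
    (hno : ¬ HasShortBergeK4 H) (hK : K.card = 4) (hinj : Set.InjOn m (K.powersetCard 2))
    (hm : ∀ p ∈ K.powersetCard 2, m p ∈ H ∧ p ⊆ m p) {T : Finset V} (hT : T ⊆ K)
    (hTc : T.card = 3) {x : V} (hx : x ∈ W \ K)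
    (hact : ∀ v ∈ T, ∃ h ∈ H, h ∩ K = {v} ∧ x ∈ h) :
    ∑ v ∈ T, (H.filter fun h => h ∩ K = {v} ∧ x ∈ h).card + 4 ≤ (W \ K).card := by
  have hH₃ : ∀ h ∈ H, h.card = 3 := fun h hh => (hH h hh).1
  have hxK := (Finset.mem_sdiff.1 hx).2
  have hxT : x ∉ T := fun h => hxK (hT h)
  choose! l hlH hlK hlx using hact
  have hTK : ∀ p ∈ T.powersetCard 2, p ∈ K.powersetCard 2 := fun p hp =>
    Finset.powersetCard_mono hT hp
  have hmK : ∀ p ∈ T.powersetCard 2, m p ∩ K = p := fun p hp =>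
    inter_eq_of_representatives hH₃ hno hK hinj hm (hm p (hTK p hp)).1 (hTK p hp)
      (hm p (hTK p hp)).2
  set K' := insert x T with hK'
  have hK'c : K'.card = 4 := by rw [hK', Finset.card_insert_of_notMem hxT, hTc]
  have hpair : ∀ p ∈ K'.powersetCard 2, p ∈ T.powersetCard 2 ∨
      ∃ v ∈ T, p = {x, v} := by
    intro p hp
    rw [Finset.mem_powersetCard] at hp
    by_cases hxp : x ∈ p
    · obtain ⟨v, hv⟩ := Finset.card_eq_one.1
        (show (p.erase x).card = 1 by rw [Finset.card_erase_of_mem hxp, hp.2])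
      have hvp := Finset.mem_erase.1 (hv ▸ Finset.mem_singleton_self v)
      exact Or.inr ⟨v, Finset.mem_of_mem_insert_of_ne (hp.1 hvp.2) hvp.1,
        by rw [← hv, Finset.insert_erase hxp]⟩
    · exact Or.inl (Finset.mem_powersetCard.2
        ⟨(Finset.subset_insert_iff_of_notMem hxp).1 hp.1, hp.2⟩)
  have hrep : ∀ p ∈ K'.powersetCard 2, ∃ h ∈ H, p ⊆ h ∧ h ∩ K = p.erase x := by
    intro p hp
    rcases hpair p hp with hp | ⟨v, hv, rfl⟩
    · refine ⟨m p, (hm p (hTK p hp)).1, (hm p (hTK p hp)).2, ?_⟩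
      rw [hmK p hp, Finset.erase_eq_of_notMem fun h => hxT ((Finset.mem_powersetCard.1 hp).1 h)]
    · have hxv : x ∉ ({v} : Finset V) := fun h => hxT (Finset.mem_singleton.1 h ▸ hv)
      refine ⟨l v, hlH v hv, Finset.insert_subset (hlx v hv) ?_, ?_⟩
      · rw [← hlK v hv]
        exact Finset.inter_subset_left
      · rw [hlK v hv, Finset.erase_insert hxv]
  choose! m' hm'H hm'p hm'K using hrep
  have hinj' : Set.InjOn m' (K'.powersetCard 2) := by
    intro p hp q hq he
    have h₁ := hm'K p hp
    rw [he, hm'K q hq] at h₁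
    have hp₂ := (Finset.mem_powersetCard.1 hp).2
    have hq₂ := (Finset.mem_powersetCard.1 hq).2
    have h₃ := congrArg Finset.card h₁
    by_cases hxp : x ∈ p <;> by_cases hxq : x ∈ q
    · rw [← Finset.insert_erase hxp, ← Finset.insert_erase hxq, h₁]
    · rw [Finset.card_erase_of_mem hxp, Finset.erase_eq_of_notMem hxq] at h₃
      omega
    · rw [Finset.card_erase_of_mem hxq, Finset.erase_eq_of_notMem hxp] at h₃
      omega
    · rwa [Finset.erase_eq_of_notMem hxp, Finset.erase_eq_of_notMem hxq, eq_comm] at h₁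
  set D := T.biUnion fun v => H.filter fun h => h ∩ K = {v} ∧ x ∈ h with hD
  have hDc : D.card = ∑ v ∈ T, (H.filter fun h => h ∩ K = {v} ∧ x ∈ h).card := by
    refine Finset.card_biUnion fun v _ w _ hvw => Finset.disjoint_left.2 fun h hh hh' => hvw ?_
    have h₁ := (Finset.mem_filter.1 hh).2.1
    rw [(Finset.mem_filter.1 hh').2.1] at h₁
    exact (Finset.singleton_injective h₁).symm
  have hMc : ((T.powersetCard 2).image m).card = 3 := by
    rw [Finset.card_image_of_injOn (hinj.mono hTK), Finset.card_powersetCard, hTc]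
    rfl
  have hdis : Disjoint D ((T.powersetCard 2).image m) := by
    refine Finset.disjoint_left.2 fun h hh hh' => ?_
    obtain ⟨v, -, hv⟩ := Finset.mem_biUnion.1 hh
    obtain ⟨p, hp, rfl⟩ := Finset.mem_image.1 hh'
    have h₁ := congrArg Finset.card (Finset.mem_filter.1 hv).2.1
    rw [hmK p hp, (Finset.mem_powersetCard.1 hp).2, Finset.card_singleton] at h₁
    omega
  have hinter : ∀ h, h ∩ K ⊆ T → h ∩ K' = if x ∈ h then insert x (h ∩ K) else h ∩ K := by
    intro h hT'
    ext y
    have : y ∈ h → y ∈ K → y ∈ T := fun h₁ h₂ => hT' (Finset.mem_inter.2 ⟨h₁, h₂⟩)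
    have := @hT y
    split_ifs with hxh
    · simp only [hK', Finset.mem_inter, Finset.mem_insert]
      constructor
      · rintro ⟨h₁, rfl | h₂⟩
        · exact Or.inl rfl
        · exact Or.inr ⟨h₁, hT h₂⟩
      · rintro (rfl | ⟨h₁, h₂⟩)
        · exact ⟨hxh, Or.inl rfl⟩
        · exact ⟨h₁, Or.inr (by tauto)⟩
    · simp only [hK', Finset.mem_inter, Finset.mem_insert]
      constructor
      · rintro ⟨h₁, rfl | h₂⟩
        · exact absurd h₁ hxh
        · exact ⟨h₁, hT h₂⟩
      · rintro ⟨h₁, h₂⟩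
        exact ⟨h₁, Or.inr (by tauto)⟩
  have hout : ∀ h ∈ H, h ∩ K ⊆ T → h \ K' ⊆ (W \ K).erase x := by
    intro h hh hT' y hy
    simp only [hK', Finset.mem_sdiff, Finset.mem_insert, not_or] at hy
    exact Finset.mem_erase.2 ⟨hy.2.1, Finset.mem_sdiff.2 ⟨(hH h hh).2 hy.1,
      fun hyK => hy.2.2 (hT' (Finset.mem_inter.2 ⟨hy.1, hyK⟩))⟩⟩
  have hmain := card_le_of_representatives hH₃ hno hK'c hinj' (fun p hp => ⟨hm'H p hp, hm'p p hp⟩)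
    (C := D ∪ (T.powersetCard 2).image m) (Y := (W \ K).erase x) fun h hh => by
      rcases Finset.mem_union.1 hh with hh | hh
      · obtain ⟨v, hvT, hv⟩ := Finset.mem_biUnion.1 hh
        obtain ⟨hh, hhK, hxh⟩ := Finset.mem_filter.1 hv
        have hsub : h ∩ K ⊆ T := by
          rw [hhK]
          exact Finset.singleton_subset_iff.2 hvT
        refine ⟨hh, ?_, hout h hh hsub⟩
        rw [hinter h hsub, if_pos hxh, hhK]
        exact Finset.card_pair fun h => hxT (h ▸ hvT)
      · obtain ⟨p, hp, rfl⟩ := Finset.mem_image.1 hh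
        have hp₂ := Finset.mem_powersetCard.1 hp
        have hsub : m p ∩ K ⊆ T := by
          rw [hmK p hp]
          exact hp₂.1
        refine ⟨(hm p (hTK p hp)).1, ?_, hout _ (hm p (hTK p hp)).1 hsub⟩
        have hpK' : p ∈ K'.powersetCard 2 :=
          Finset.powersetCard_mono (Finset.subset_insert _ _) hp
        rw [inter_eq_of_representatives hH₃ hno hK'c hinj'
          (fun p hp => ⟨hm'H p hp, hm'p p hp⟩) (hm p (hTK p hp)).1 hpK' (hm p (hTK p hp)).2]
        exact hp₂.2
  rw [Finset.card_union_of_disjoint hdis, hDc, hMc, Finset.card_erase_of_mem hx] at hmain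
  have : 0 < (W \ K).card := Finset.card_pos.2 ⟨x, hx⟩
  omega

end MinDegree

section SmallBounds

variable {V : Type*} [DecidableEq V]

lemma not_representatives_of_vertexDegree {H : Finset (Finset V)} {W K : Finset V}
    {m : Finset V → Finset V} (hW : W.card ≤ 11) (hH : ∀ h ∈ H, h.card = 3 ∧ h ⊆ W)
    (hno : ¬ HasShortBergeK4 H) (hdeg : ∀ v ∈ W, 2 * W.card ≤ vertexDegree H v + 10)
    (hK : K.card = 4) (hinj : Set.InjOn m (K.powersetCard 2))
    (hm : ∀ p ∈ K.powersetCard 2, m p ∈ H ∧ p ⊆ m p) : False := by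
  have hH₃ : ∀ h ∈ H, h.card = 3 := fun h hh => (hH h hh).1
  have hKW : K ⊆ W := by
    intro v hv
    obtain ⟨w, hw, hwv⟩ := Finset.exists_mem_ne (by omega : 1 < K.card) v
    have hp := hm {v, w} (Finset.mem_powersetCard.2 ⟨Finset.insert_subset hv
      (Finset.singleton_subset_iff.2 hw), Finset.card_pair hwv.symm⟩)
    exact (hH _ hp.1).2 (hp.2 (by simp))
  have hX : (W \ K).card + 4 = W.card := hK ▸ Finset.card_sdiff_add_card_eq_card hKW
  set L := fun v => H.filter fun h => h ∩ K = {v} with hL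
  set d := fun v x => (H.filter fun h => h ∩ K = {v} ∧ x ∈ h).card with hd
  have hLcard : ∀ v ∈ K, (W \ K).card + 1 ≤ (L v).card := by
    intro v hv
    have h₁ := card_le_of_representatives hH₃ hno hK hinj hm
      (C := H.filter fun h => (h ∩ K).card = 2) (Y := W \ K) fun h hh => by
        rw [Finset.mem_filter] at hh
        exact ⟨hh.1, hh.2, Finset.sdiff_subset_sdiff (hH h hh.1).2 (le_refl K)⟩
    rw [← card_filter_notMem_add_vertexDegree _ v] at h₁
    have h₂ : 3 ≤ ((H.filter fun h => (h ∩ K).card = 2).filter (v ∉ ·)).card := by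
      have hpK : (K.erase v).powersetCard 2 ⊆ K.powersetCard 2 :=
        Finset.powersetCard_mono (Finset.erase_subset _ _)
      have h₃ : (((K.erase v).powersetCard 2).image m).card = 3 := by
        rw [Finset.card_image_of_injOn (hinj.mono hpK), Finset.card_powersetCard,
          Finset.card_erase_of_mem hv, hK]
        rfl
      rw [← h₃]
      refine Finset.card_le_card (Finset.image_subset_iff.2 fun p hp => ?_)
      have h₄ := hm p (hpK hp)
      have h₅ := inter_eq_of_representatives hH₃ hno hK hinj hm h₄.1 (hpK hp) h₄.2
      rw [Finset.mem_powersetCard] at hp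
      refine Finset.mem_filter.2 ⟨Finset.mem_filter.2 ⟨h₄.1, by rw [h₅, hp.2]⟩, fun hvm => ?_⟩
      have h₆ : v ∈ p := by
        rw [← h₅]
        exact Finset.mem_inter.2 ⟨hvm, hv⟩
      exact Finset.notMem_erase v K (hp.1 h₆)
    have h₃ : vertexDegree H v ≤
        (L v).card + vertexDegree (H.filter fun h => (h ∩ K).card = 2) v := by
      refine (Finset.card_le_card fun h hh => ?_).trans (Finset.card_union_le _ _)
      rw [Finset.mem_filter] at hh
      have hv' : {v} ⊆ h ∩ K := Finset.singleton_subset_iff.2 (Finset.mem_inter.2 ⟨hh.2, hv⟩)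
      by_cases hc : 2 ≤ (h ∩ K).card
      · obtain ⟨p, hp, hpc⟩ := Finset.exists_subset_card_eq hc
        have := inter_eq_of_representatives hH₃ hno hK hinj hm hh.1 (Finset.mem_powersetCard.2
          ⟨hp.trans Finset.inter_subset_right, hpc⟩) (hp.trans Finset.inter_subset_left)
        exact Finset.mem_union_right _ (Finset.mem_filter.2
          ⟨Finset.mem_filter.2 ⟨hh.1, by rw [this, hpc]⟩, hh.2⟩)
      · refine Finset.mem_union_left _ (Finset.mem_filter.2 ⟨hh.1, ?_⟩)
        refine (Finset.eq_of_subset_of_card_le hv' ?_).symm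
        rw [Finset.card_singleton]
        omega
    have h₄ := hdeg v (hKW hv)
    omega
  set Y := (W \ K).filter fun x => 3 ≤ (K.filter fun v => 0 < d v x).card with hY
  have hYW : Y ⊆ W \ K := Finset.filter_subset _ _
  have hYc := Finset.card_sdiff_add_card_eq_card hYW
  have hYd : ∀ x ∈ Y, ∀ w ∈ K, d w x ≤ 1 := by
    intro x hx w hw
    rw [Finset.mem_filter] at hx
    by_cases hwx : 0 < d w x
    · obtain ⟨T, hwT, hTA, hT⟩ := Finset.exists_subsuperset_card_eq (s := {w})
        (Finset.singleton_subset_iff.2 (Finset.mem_filter.2 ⟨hw, hwx⟩)) (by simp) hx.2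
      rw [Finset.singleton_subset_iff] at hwT
      have h₁ := sum_card_link_le hH hno hK hinj hm (hTA.trans (Finset.filter_subset _ _)) hT hx.1
        fun v hv => by
          obtain ⟨h, hh⟩ := Finset.card_pos.1 (Finset.mem_filter.1 (hTA hv)).2
          exact ⟨h, Finset.mem_filter.1 hh⟩
      have h₂ : (T.erase w).card • 1 ≤ ∑ v ∈ T.erase w, d v x :=
        Finset.card_nsmul_le_sum _ _ _ fun v hv =>
          (Finset.mem_filter.1 (hTA (Finset.mem_of_mem_erase hv))).2
      have h₃ := Finset.add_sum_erase T (d · x) hwT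
      rw [Finset.card_erase_of_mem hwT, hT, smul_eq_mul] at h₂
      simp only [hd] at h₂ h₃ ⊢
      omega
    · omega
  set F := fun v => ((W \ K) \ Y).filter fun x => 0 < d v x with hF
  obtain ⟨v, hv, hvF⟩ : ∃ v ∈ K, 2 * (F v).card ≤ ((W \ K) \ Y).card := by
    refine Finset.exists_le_of_sum_le (Finset.card_pos.1 (by omega)) ?_
    have h₁ := Finset.sum_card_bipartiteAbove_eq_sum_card_bipartiteBelow (s := K)
      (t := (W \ K) \ Y) fun v x => 0 < d v x
    simp only [Finset.bipartiteAbove, Finset.bipartiteBelow] at h₁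
    have h₂ : ∑ x ∈ (W \ K) \ Y, (K.filter fun v => 0 < d v x).card ≤ ((W \ K) \ Y).card • 2 := by
      refine Finset.sum_le_card_nsmul _ _ _ fun x hx => ?_
      rw [Finset.mem_sdiff] at hx
      by_contra! h
      exact hx.2 (Finset.mem_filter.2 ⟨hx.1, h⟩)
    rw [← Finset.mul_sum, h₁, Finset.sum_const, hK]
    rw [smul_eq_mul] at h₂ ⊢
    omega
  have hLv : (L v).card ≤ (F v).card.choose 2 + Y.card := by
    have hsub : L v ⊆ ((F v).powersetCard 2).image (insert v) ∪
        Y.biUnion fun x => H.filter fun h => h ∩ K = {v} ∧ x ∈ h := by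
      intro h hh
      rw [Finset.mem_filter] at hh
      have hvh : v ∈ h := (Finset.mem_inter.1 (hh.2 ▸ Finset.mem_singleton_self v)).1
      by_cases hY : ∃ x ∈ Y, x ∈ h
      · obtain ⟨x, hx, hxh⟩ := hY
        exact Finset.mem_union_right _ (Finset.mem_biUnion.2
          ⟨x, hx, Finset.mem_filter.2 ⟨hh.1, hh.2, hxh⟩⟩)
      · refine Finset.mem_union_left _ (Finset.mem_image.2
          ⟨h.erase v, Finset.mem_powersetCard.2 ⟨fun x hx => ?_, ?_⟩, Finset.insert_erase hvh⟩)
        · rw [Finset.mem_erase] at hx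
          have hxK : x ∉ K := fun hxK => hx.1 (Finset.mem_singleton.1
            (hh.2 ▸ Finset.mem_inter.2 ⟨hx.2, hxK⟩))
          exact Finset.mem_filter.2 ⟨Finset.mem_sdiff.2 ⟨Finset.mem_sdiff.2
            ⟨(hH h hh.1).2 hx.2, hxK⟩, fun hxY => hY ⟨x, hxY, hx.2⟩⟩,
            Finset.card_pos.2 ⟨h, Finset.mem_filter.2 ⟨hh.1, hh.2, hx.2⟩⟩⟩
        · rw [Finset.card_erase_of_mem hvh, hH₃ h hh.1]
    refine ((Finset.card_le_card hsub).trans (Finset.card_union_le _ _)).trans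
      (Nat.add_le_add ?_ ?_)
    · refine Finset.card_image_le.trans ?_
      rw [Finset.card_powersetCard]
    · exact (Finset.card_biUnion_le_card_mul _ _ 1 fun x hx => hYd x hx v hv).trans
        (Nat.mul_one _).le
  have h₁ := hLcard v hv
  have h₂ : (F v).card ≤ 3 := by omega
  generalize (F v).card = s at *
  interval_cases s <;> simp only [Nat.choose] at hLv <;> omega

lemma sizeBound_of_vertexDegree {n b : ℕ} (hn₁ : 1 ≤ n) (hn : n ≤ 11)
    (hdeg : ∀ (H : Finset (Finset V)) (W : Finset V), W.card = n →
      (∀ h ∈ H, h.card = 3 ∧ h ⊆ W) → ¬ HasShortBergeK4 H → H.card = b + 1 →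
      ∀ v ∈ W, 2 * n ≤ vertexDegree H v + 10)
    (hb : ∀ a m, a + m = n → a * (m ^ 2 / 4) ≤ b ∧ a * m + m ^ 2 / 4 ≤ b) : SizeBound V n b := by
  refine .of_card_eq fun H W hW hH hno hcard => ?_
  obtain ⟨a, m, -, ham, h⟩ := exists_card_le_of_not_hasShortBergeK4
    (Finset.card_pos.1 (by omega : 0 < W.card)) hH hno (fun m => m ^ 2 / 4)
    fun E m hinj hm v hv N hN hNE => by
      set E' := (N.powersetCard 2).filter (· ∈ E) with hE'
      have hEE : (N.powersetCard 2).filter (· ∈ E') = E' :=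
        Finset.filter_mem_eq_inter.trans (Finset.inter_eq_right.2 (Finset.filter_subset _ _))
      rw [← hEE, ← pairSum_indicator]
      refine (pairSum_le_mul_sq_div_four (L := E') (k := 1) (fun q => ?_) (fun q hq => ?_) N
        fun p hp x hx hxp => ?_).trans (one_mul _).le
      · split_ifs <;> omega
      · rw [if_neg hq]
        omega
      · by_contra! hcon
        have hpx : ∀ u ∈ p, {u, x} ∈ E := fun u hu => by
          have h := hcon u hu
          rw [ne_eq, ite_eq_right_iff, Classical.not_imp] at h
          exact (Finset.mem_filter.1 h.1).2
        obtain ⟨hp, hpE⟩ := Finset.mem_filter.1 hp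
        obtain ⟨u, w, huw, rfl⟩ := Finset.card_eq_two.1 (Finset.mem_powersetCard.1 hp).2
        have hu : u ∈ N := (Finset.mem_powersetCard.1 hp).1 (by simp)
        have hw : w ∈ N := (Finset.mem_powersetCard.1 hp).1 (by simp)
        simp only [Finset.mem_insert, Finset.mem_singleton, not_or] at hxp
        have hux := hpx u (by simp)
        have hwx := hpx w (by simp)
        have hKE : ({v, x, u, w} : Finset V).powersetCard 2 ⊆ E := by
          intro q hq
          rw [Finset.mem_powersetCard] at hq
          obtain ⟨y, z, hyz, rfl⟩ := Finset.card_eq_two.1 hq.2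
          have hy := hq.1 (Finset.mem_insert_self y {z})
          have hz := hq.1 (Finset.mem_insert_of_mem (Finset.mem_singleton_self z))
          have hNv := fun u hu => (hNE u hu).2
          simp only [Finset.mem_insert, Finset.mem_singleton] at hy hz
          rcases hy with rfl | rfl | rfl | rfl <;> rcases hz with rfl | rfl | rfl | rfl <;>
            first
            | exact absurd rfl hyz
            | assumption
            | exact hNv _ (by assumption)
            | rw [Finset.pair_comm]; assumption
            | rw [Finset.pair_comm]; exact hNv _ (by assumption)
        refine not_representatives_of_vertexDegree (by omega) hH hno
          (fun v hv => hW ▸ hdeg H W hW hH hno hcard v hv) ?_ (hinj.mono hKE)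
          fun q hq => (hm q (hKE hq)).2
        rw [Finset.card_eq_four]
        exact ⟨v, x, u, w, (hNE x hx).1.symm, (hNE u hu).1.symm, (hNE w hw).1.symm, hxp.1, hxp.2,
          huw, rfl⟩
  rw [hW] at ham
  have := hb a m ham
  omega

lemma sizeBound_ten : SizeBound V 10 36 := by
  refine sizeBound_of_vertexDegree (by norm_num) (by norm_num) (fun H W hW hH hno hcard v hv => ?_)
    fun a m ham => ?_
  · have := sizeBound_nine.le_add_vertexDegree hW hH hno hv
    omega
  · obtain rfl : a = 10 - m := by omega
    have : m ≤ 10 := by omega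
    interval_cases m <;> norm_num

lemma sizeBound_eleven : SizeBound V 11 48 := by
  refine sizeBound_of_vertexDegree (by norm_num) (by norm_num) (fun H W hW hH hno hcard v hv => ?_)
    fun a m ham => ?_
  · have := sizeBound_ten.le_add_vertexDegree hW hH hno hv
    omega
  · obtain rfl : a = 11 - m := by omega
    have : m ≤ 11 := by omega
    interval_cases m <;> norm_num

lemma sizeBound_twelve : SizeBound V 12 64 := sizeBound_eleven.succ (by omega)

end SmallBounds

/-! ### The theorem -/

lemma mul_mul_le_div_three (x y z : ℕ) :
    x * y * z ≤ (x + y + z) / 3 * ((x + y + z + 1) / 3) * ((x + y + z + 2) / 3) := by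
  induction x generalizing y z with
  | zero => simp
  | succ x ih =>
    rcases y with _ | y
    · simp
    rcases z with _ | z
    · simp
    have h₁ := ih y z
    have h₂ : 3 * (x * y + y * z + z * x) ≤ (x + y + z) ^ 2 := by
      zify
      nlinarith [sq_nonneg ((x : ℤ) - y), sq_nonneg ((y : ℤ) - z), sq_nonneg ((z : ℤ) - x)]
    have h₃ : (x + 1) * (y + 1) * (z + 1) =
        x * y * z + (x * y + y * z + z * x) + (x + y + z) + 1 := by ring
    have h₄ : x + 1 + (y + 1) + (z + 1) = x + y + z + 3 := by ring
    rw [h₃, h₄]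
    generalize x + y + z = n at *
    generalize x * y + y * z + z * x = e at *
    refine (Nat.add_le_add_right (Nat.add_le_add_right (Nat.add_le_add_right h₁ e) n) 1).trans ?_
    obtain ⟨k, rfl | rfl | rfl⟩ : ∃ k, n = 3 * k ∨ n = 3 * k + 1 ∨ n = 3 * k + 2 :=
      ⟨n / 3, by omega⟩
    · rw [show 3 * k / 3 = k by omega, show (3 * k + 1) / 3 = k by omega,
        show (3 * k + 2) / 3 = k by omega, show (3 * k + 3) / 3 = k + 1 by omega,
        show (3 * k + 3 + 1) / 3 = k + 1 by omega, show (3 * k + 3 + 2) / 3 = k + 1 by omega]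
      nlinarith
    · have : e ≤ 3 * k ^ 2 + 2 * k := by
        rw [show (3 * k + 1) ^ 2 = 3 * (3 * k ^ 2 + 2 * k) + 1 by ring] at h₂
        omega
      rw [show (3 * k + 1) / 3 = k by omega, show (3 * k + 1 + 1) / 3 = k by omega,
        show (3 * k + 1 + 2) / 3 = k + 1 by omega, show (3 * k + 1 + 3) / 3 = k + 1 by omega,
        show (3 * k + 1 + 3 + 1) / 3 = k + 1 by omega,
        show (3 * k + 1 + 3 + 2) / 3 = k + 2 by omega]
      nlinarith
    · have : e ≤ 3 * k ^ 2 + 4 * k + 1 := by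
        rw [show (3 * k + 2) ^ 2 = 3 * (3 * k ^ 2 + 4 * k + 1) + 1 by ring] at h₂
        omega
      rw [show (3 * k + 2) / 3 = k by omega, show (3 * k + 2 + 1) / 3 = k + 1 by omega,
        show (3 * k + 2 + 2) / 3 = k + 1 by omega, show (3 * k + 2 + 3) / 3 = k + 1 by omega,
        show (3 * k + 2 + 3 + 1) / 3 = k + 2 by omega,
        show (3 * k + 2 + 3 + 2) / 3 = k + 2 by omega]
      nlinarith

lemma mul_sq_div_four_le (a m : ℕ) :
    a * (m ^ 2 / 4) ≤ (a + m) / 3 * ((a + m + 1) / 3) * ((a + m + 2) / 3) := by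
  have h : m ^ 2 / 4 = m / 2 * (m - m / 2) := by
    rcases Nat.even_or_odd' m with ⟨j, rfl | rfl⟩
    · rw [show (2 * j) ^ 2 = 4 * j ^ 2 by ring, Nat.mul_div_cancel_left _ (by norm_num),
        Nat.mul_div_cancel_left _ (by norm_num), show 2 * j - j = j by omega, sq]
    · rw [show (2 * j + 1) ^ 2 = 1 + 4 * (j * (j + 1)) by ring,
        Nat.add_mul_div_left _ _ (by norm_num), show (2 * j + 1) / 2 = j by omega,
        show 2 * j + 1 - j = j + 1 by omega]
      omega
  have := mul_mul_le_div_three a (m / 2) (m - m / 2)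
  rwa [add_assoc a, Nat.add_sub_cancel' (Nat.div_le_self m 2), mul_assoc a, ← h] at this

lemma mul_add_choose_two_le {a m : ℕ} (h : 13 ≤ a + m) :
    a * m + m.choose 2 ≤ (a + m) / 3 * ((a + m + 1) / 3) * ((a + m + 2) / 3) := by
  have hc : ∀ n : ℕ, 2 * n.choose 2 + n = n ^ 2 := by
    intro n
    induction n with
    | zero => rfl
    | succ n ih =>
      rw [Nat.choose_succ_succ' n 1, Nat.choose_one_right]
      linarith
  have h₁ : a * m + m.choose 2 ≤ (a + m).choose 2 := by
    have h₂ := hc m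
    have h₃ := hc (a + m)
    have h₄ : a ≤ a ^ 2 := Nat.le_self_pow (by norm_num) a
    nlinarith
  refine h₁.trans ?_
  have h₂ := hc (a + m)
  generalize a + m = n at *
  obtain ⟨k, hk⟩ : ∃ k, n = 3 * (k + 4) + 1 ∨ n = 3 * (k + 4) + 2 ∨ n = 3 * (k + 4) + 3 :=
    ⟨(n - 13) / 3, by omega⟩
  generalize n.choose 2 = c at *
  rcases hk with rfl | rfl | rfl
  · rw [show (3 * (k + 4) + 1) / 3 = k + 4 by omega,
      show (3 * (k + 4) + 1 + 1) / 3 = k + 4 by omega,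
      show (3 * (k + 4) + 1 + 2) / 3 = k + 5 by omega]
    nlinarith [Nat.zero_le (k ^ 3)]
  · rw [show (3 * (k + 4) + 2) / 3 = k + 4 by omega,
      show (3 * (k + 4) + 2 + 1) / 3 = k + 5 by omega,
      show (3 * (k + 4) + 2 + 2) / 3 = k + 5 by omega]
    nlinarith [Nat.zero_le (k ^ 3)]
  · rw [show (3 * (k + 4) + 3) / 3 = k + 5 by omega,
      show (3 * (k + 4) + 3 + 1) / 3 = k + 5 by omega,
      show (3 * (k + 4) + 3 + 2) / 3 = k + 5 by omega]
    nlinarith [Nat.zero_le (k ^ 3)]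

lemma card_le_of_thirteen_le {V : Type*} [DecidableEq V] {H : Finset (Finset V)} {W : Finset V}
    (hW : 13 ≤ W.card) (hH : ∀ h ∈ H, h.card = 3 ∧ h ⊆ W) (hno : ¬ HasShortBergeK4 H) :
    H.card ≤ W.card / 3 * ((W.card + 1) / 3) * ((W.card + 2) / 3) := by
  obtain ⟨a, m, -, ham, h⟩ := exists_card_le_of_not_hasShortBergeK4
    (Finset.card_pos.1 (by omega : 0 < W.card)) hH hno (fun m => m.choose 2)
    fun E m _ _ v _ N _ _ => by
      rw [← Finset.card_powersetCard]
      exact Finset.card_filter_le _ _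
  rw [← ham] at hW ⊢
  exact h.elim (·.trans (mul_sq_div_four_le a m)) (·.trans (mul_add_choose_two_le hW))

/-- For every `n ≥ 6`, every triple system on an `n`-element
vertex set with more than `⌊n/3⌋ * ⌊(n+1)/3⌋ * ⌊(n+2)/3⌋` triples contains a
Berge-`K₄` whose six triples together span at most `9` vertices. -/
theorem bergeK4_span_le_nine (n : ℕ) (hn : 6 ≤ n)
    (V : Type*) [DecidableEq V] [Fintype V] (hV : Fintype.card V = n)
    (H : Finset (Finset V)) (hH3 : ∀ t ∈ H, t.card = 3)
    (hcard : n / 3 * ((n + 1) / 3) * ((n + 2) / 3) < H.card) :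
    ∃ v₁ v₂ v₃ v₄ : V, ∃ e₁₂ e₁₃ e₁₄ e₂₃ e₂₄ e₃₄ : Finset V,
      v₁ ≠ v₂ ∧ v₁ ≠ v₃ ∧ v₁ ≠ v₄ ∧ v₂ ≠ v₃ ∧ v₂ ≠ v₄ ∧ v₃ ≠ v₄ ∧
      ([e₁₂, e₁₃, e₁₄, e₂₃, e₂₄, e₃₄] : List (Finset V)).Nodup ∧
      e₁₂ ∈ H ∧ e₁₃ ∈ H ∧ e₁₄ ∈ H ∧ e₂₃ ∈ H ∧ e₂₄ ∈ H ∧ e₃₄ ∈ H ∧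
      {v₁, v₂} ⊆ e₁₂ ∧ {v₁, v₃} ⊆ e₁₃ ∧ {v₁, v₄} ⊆ e₁₄ ∧
      {v₂, v₃} ⊆ e₂₃ ∧ {v₂, v₄} ⊆ e₂₄ ∧ {v₃, v₄} ⊆ e₃₄ ∧
      (e₁₂ ∪ e₁₃ ∪ e₁₄ ∪ e₂₃ ∪ e₂₄ ∪ e₃₄).card ≤ 9 := by
  by_contra hno
  have hno : ¬ HasShortBergeK4 H := hno
  have hH : ∀ h ∈ H, h.card = 3 ∧ h ⊆ Finset.univ := fun h hh => ⟨hH3 h hh, Finset.subset_univ h⟩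
  have hW : (Finset.univ : Finset V).card = n := hV
  rcases Nat.lt_or_ge n 13 with h13 | h13
  · interval_cases n
    · exact absurd (sizeBound_six H _ hW hH hno) (by omega)
    · exact absurd (sizeBound_seven H _ hW hH hno) (by omega)
    · exact absurd (sizeBound_eight H _ hW hH hno) (by omega)
    · exact absurd (sizeBound_nine H _ hW hH hno) (by omega)
    · exact absurd (sizeBound_ten H _ hW hH hno) (by omega)
    · exact absurd (sizeBound_eleven H _ hW hH hno) (by omega)
    · exact absurd (sizeBound_twelve H _ hW hH hno) (by omega)
  · have h := card_le_of_thirteen_le (h13.trans_eq hW.symm) hH hno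
    rw [hW] at h
    omega
end

section
/- The maximum number of triples in a Berge-K4-free triple system on a 6-element vertex set is 8: every Berge-K4-free triple system on 6 vertices has at most 8 triples, and there is a triple system on 6 vertices with 8 triples that is Berge-K4-free. -/
/-- `HasBergeK4 H` : `H` contains a Berge-`K₄`, i.e. four distinct vertices
`v₁, v₂, v₃, v₄` and six pairwise distinct triples `e_{ij} ∈ H` with
`{vᵢ, vⱼ} ⊆ e_{ij}` for every `1 ≤ i < j ≤ 4`. -/
def HasBergeK4 {V : Type*} [DecidableEq V] (H : Finset (Finset V)) : Prop :=
  ∃ v₁ v₂ v₃ v₄ : V, ∃ e₁₂ e₁₃ e₁₄ e₂₃ e₂₄ e₃₄ : Finset V,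
    v₁ ≠ v₂ ∧ v₁ ≠ v₃ ∧ v₁ ≠ v₄ ∧ v₂ ≠ v₃ ∧ v₂ ≠ v₄ ∧ v₃ ≠ v₄ ∧
    ([e₁₂, e₁₃, e₁₄, e₂₃, e₂₄, e₃₄] : List (Finset V)).Nodup ∧
    e₁₂ ∈ H ∧ e₁₃ ∈ H ∧ e₁₄ ∈ H ∧ e₂₃ ∈ H ∧ e₂₄ ∈ H ∧ e₃₄ ∈ H ∧
    {v₁, v₂} ⊆ e₁₂ ∧ {v₁, v₃} ⊆ e₁₃ ∧ {v₁, v₄} ⊆ e₁₄ ∧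
    {v₂, v₃} ⊆ e₂₃ ∧ {v₂, v₄} ⊆ e₂₄ ∧ {v₃, v₄} ⊆ e₃₄

/-- Whether the bit of `H` at position `m` is set. -/
def hasBit (H m : ℕ) : Bool := Nat.beq 1 (Nat.land (Nat.shiftRight H m) 1)

/-- Tries to choose pairwise distinct bits of `H`, one from each of the given quadruples; the first
two members of a quadruple are taken without backtracking. -/
def hasSDR : List (ℕ × ℕ × ℕ × ℕ) → ℕ → Bool
  | [], _ => true
  | (o, o', i, i') :: l, H =>
    bif hasBit H o then hasSDR l (H ^^^ 2 ^ o)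
    else bif hasBit H o' then hasSDR l (H ^^^ 2 ^ o')
    else (hasBit H i && hasSDR l (H ^^^ 2 ^ i)) || (hasBit H i' && hasSDR l (H ^^^ 2 ^ i'))

/-- For each pair in the core `{a, b, c, d}`, the triples of `{a, b, c, d, x, y}` that contain it;
vertices are powers of two and sets are the sums of their members. -/
def candidates (a b c d x y : ℕ) : List (ℕ × ℕ × ℕ × ℕ) :=
  [(c + d + x, c + d + y, a + c + d, b + c + d), (b + d + x, b + d + y, a + b + d, b + c + d),
    (b + c + x, b + c + y, a + b + c, b + c + d), (a + d + x, a + d + y, a + b + d, a + c + d),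
    (a + c + x, a + c + y, a + b + c, a + c + d), (a + b + x, a + b + y, a + b + c, a + b + d)]

/-- Decides whether a set of triples contains a Berge-`K₄`. -/
def bergeTest (H : ℕ) : Bool :=
  hasSDR (candidates 1 2 4 8 16 32) H || hasSDR (candidates 1 2 4 16 8 32) H ||
  hasSDR (candidates 1 2 8 16 4 32) H || hasSDR (candidates 1 4 8 16 2 32) H ||
  hasSDR (candidates 2 4 8 16 1 32) H || hasSDR (candidates 1 2 4 32 8 16) H ||
  hasSDR (candidates 1 2 8 32 4 16) H || hasSDR (candidates 1 2 16 32 4 8) H ||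
  hasSDR (candidates 1 4 8 32 2 16) H || hasSDR (candidates 1 4 16 32 2 8) H ||
  hasSDR (candidates 1 8 16 32 2 4) H || hasSDR (candidates 2 4 8 32 1 16) H ||
  hasSDR (candidates 2 4 16 32 1 8) H || hasSDR (candidates 2 8 16 32 1 4) H ||
  hasSDR (candidates 4 8 16 32 1 2) H

/-- Checks that adding any `n` members of a list to `H` leads to a set satisfying `prune` on the way
or `leaf` at the end. -/
def search (prune leaf : ℕ → Bool) : ℕ → List ℕ → ℕ → Bool
  | 0, _, H => leaf H
  | _ + 1, [], _ => true
  | n + 1, t :: l, H =>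
    (prune (H ||| 2 ^ t) || search prune leaf n l (H ||| 2 ^ t)) && search prune leaf (n + 1) l H

/-- The triples of `{1, 2, 4, 8, 16, 32}` that avoid `32`. -/
def triplesAvoiding : List ℕ := [7, 11, 13, 14, 19, 21, 22, 25, 26, 28]

/-- The triples of `{1, 2, 4, 8, 16, 32}` that contain `32`. -/
def triplesThrough : List ℕ := [35, 37, 38, 41, 42, 44, 49, 50, 52, 56]

theorem search_six_avoiding : search (fun _ => false) bergeTest 6 triplesAvoiding 0 = true := by
  decide +kernel

theorem search_five_four :
    search (fun _ => false) (search bergeTest (fun _ => false) 4 triplesThrough)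
      5 triplesAvoiding 0 = true := by
  decide +kernel

/-- The set of vertices `v` for which the bit of `m` at position `e v` is set. -/
def ofMask {V : Type*} [Fintype V] (e : V ≃ Fin 6) (m : ℕ) : Finset V :=
  Finset.univ.filter fun v => m.testBit (e v)

theorem hasBit_eq_testBit (H m : ℕ) : hasBit H m = H.testBit m := by
  have h : ∀ b : ℕ, b < 2 → Nat.beq 1 b = (b != 0) := by decide
  have h1 : hasBit H m = Nat.beq 1 ((H >>> m) &&& 1) := rfl
  rw [h1, h _ (Nat.and_lt_two_pow _ (n := 1) (by norm_num)), Nat.testBit, Nat.and_comm]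

theorem testBit_or_two_pow {H m t : ℕ} :
    (H ||| 2 ^ t).testBit m = true ↔ H.testBit m = true ∨ m = t := by
  rw [Nat.testBit_or, Nat.testBit_two_pow, Bool.or_eq_true, decide_eq_true_iff, eq_comm (a := t)]

theorem testBit_xor_two_pow {H m t : ℕ} (ht : H.testBit t = true) :
    (H ^^^ 2 ^ t).testBit m = true ↔ H.testBit m = true ∧ m ≠ t := by
  rcases eq_or_ne m t with rfl | h
  · simp [ht]
  · simp [h, h.symm]

theorem exists_sdr_of_hasSDR (l : List (ℕ × ℕ × ℕ × ℕ)) (H : ℕ) (h : hasSDR l H = true) :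
    ∃ ts : List ℕ,
      List.Forall₂ (fun q t => t = q.1 ∨ t = q.2.1 ∨ t = q.2.2.1 ∨ t = q.2.2.2) l ts ∧
        ts.Nodup ∧ ∀ t ∈ ts, H.testBit t = true := by
  induction l generalizing H with
  | nil => exact ⟨[], .nil, List.nodup_nil, by simp⟩
  | cons q l ih =>
    obtain ⟨o, o', i, i'⟩ := q
    have key : ∃ m, (m = o ∨ m = o' ∨ m = i ∨ m = i') ∧ H.testBit m = true ∧
        hasSDR l (H ^^^ 2 ^ m) = true := by
      simp only [hasSDR, hasBit_eq_testBit, Bool.cond_eq_ite] at h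
      split_ifs at h with h1 h2
      · exact ⟨o, by simp, h1, h⟩
      · exact ⟨o', by simp, h2, h⟩
      · rw [Bool.or_eq_true, Bool.and_eq_true, Bool.and_eq_true] at h
        rcases h with h | h
        · exact ⟨i, by simp, h⟩
        · exact ⟨i', by simp, h⟩
    obtain ⟨m, hm, hHm, hl⟩ := key
    obtain ⟨ts, hts, hnd, hmem⟩ := ih _ hl
    simp only [testBit_xor_two_pow hHm] at hmem
    refine ⟨m :: ts, .cons hm hts, List.nodup_cons.2 ⟨fun h => (hmem m h).2 rfl, hnd⟩, ?_⟩
    simpa [hHm] using fun t ht => (hmem t ht).1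

theorem exists_of_search {prune leaf : ℕ → Bool} {X : ℕ → Prop} [DecidablePred X] (n : ℕ)
    (l : List ℕ) (H : ℕ) (h : search prune leaf n l H = true)
    (hH : ∀ t, H.testBit t = true → X t) (hn : n ≤ l.countP X) :
    ∃ H' : ℕ, (∀ t, H'.testBit t = true → X t) ∧ (prune H' = true ∨ leaf H' = true) := by
  induction l generalizing n H with
  | nil =>
    obtain rfl : n = 0 := by simpa using hn
    exact ⟨H, hH, .inr (by simpa [search] using h)⟩
  | cons t l ih =>
    cases n with
    | zero => exact ⟨H, hH, .inr (by simpa [search] using h)⟩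
    | succ n =>
      simp only [search, Bool.and_eq_true, Bool.or_eq_true] at h
      by_cases ht : X t
      · have hH' : ∀ s, (H ||| 2 ^ t).testBit s = true → X s := by
          intro s hs
          rcases testBit_or_two_pow.1 hs with hs | rfl
          exacts [hH s hs, ht]
        rcases h.1 with h | h
        · exact ⟨_, hH', .inl h⟩
        · exact ih n _ h hH' (by simpa [List.countP_cons, ht] using hn)
      · exact ih (n + 1) H h.2 hH (by simpa [List.countP_cons, ht] using hn)

section Soundness

variable {V : Type*} [Fintype V] (e : V ≃ Fin 6)

theorem mem_ofMask_triple {i j k : Fin 6} (hij : i ≠ j) (hik : i ≠ k) (hjk : j ≠ k) (v : V) :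
    v ∈ ofMask e (2 ^ (i : ℕ) + 2 ^ (j : ℕ) + 2 ^ (k : ℕ)) ↔ e v = i ∨ e v = j ∨ e v = k := by
  have key : ∀ i j k u : Fin 6, i ≠ j → i ≠ k → j ≠ k →
      ((2 ^ (i : ℕ) + 2 ^ (j : ℕ) + 2 ^ (k : ℕ)).testBit u = true ↔ u = i ∨ u = j ∨ u = k) := by
    decide +kernel
  simpa [ofMask] using key i j k (e v) hij hik hjk

theorem ofMask_injOn : Set.InjOn (ofMask e) {m | m < 2 ^ 6} := by
  intro m hm n hn h
  refine Nat.eq_of_testBit_eq fun i => ?_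
  by_cases hi : i < 6
  · have := Finset.ext_iff.1 h (e.symm ⟨i, hi⟩)
    exact Bool.eq_iff_iff.2 (by simpa [ofMask] using this)
  · have h6 : 2 ^ 6 ≤ 2 ^ i := Nat.pow_le_pow_right (by norm_num) (not_lt.1 hi)
    rw [Nat.testBit_lt_two_pow (lt_of_lt_of_le hm h6),
      Nat.testBit_lt_two_pow (lt_of_lt_of_le hn h6)]

variable [DecidableEq V] {H : Finset (Finset V)}

theorem hasBergeK4_of_hasSDR {N : ℕ} (hN : ∀ t, N.testBit t = true → t < 2 ^ 6 ∧ ofMask e t ∈ H)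
    (a b c d x y : Fin 6) (hnd : [a, b, c, d, x, y].Nodup)
    (h : hasSDR (candidates (2 ^ (a : ℕ)) (2 ^ (b : ℕ)) (2 ^ (c : ℕ)) (2 ^ (d : ℕ))
      (2 ^ (x : ℕ)) (2 ^ (y : ℕ))) N = true) : HasBergeK4 H := by
  obtain ⟨ts, hts, htn, hmem⟩ := exists_sdr_of_hasSDR _ _ h
  have hm : ∀ t ∈ ts, t < 2 ^ 6 ∧ ofMask e t ∈ H := fun t ht => hN t (hmem t ht)
  have hinj : (ts.map (ofMask e)).Nodup :=
    htn.map_on fun s hs t ht hst => ofMask_injOn e (hm s hs).1 (hm t ht).1 hst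
  simp only [candidates, List.forall₂_cons_left_iff, List.forall₂_nil_left_iff] at hts
  obtain ⟨ecd, _, hcd, ⟨ebd, _, hbd, ⟨ebc, _, hbc, ⟨ead, _, had, ⟨eac, _, hac,
    ⟨eab, _, hab, rfl, rfl⟩, rfl⟩, rfl⟩, rfl⟩, rfl⟩, rfl⟩ := hts
  simp only [List.mem_cons, List.not_mem_nil, or_false, forall_eq_or_imp, forall_eq] at hm
  obtain ⟨⟨-, h1⟩, ⟨-, h2⟩, ⟨-, h3⟩, ⟨-, h4⟩, ⟨-, h5⟩, -, h6⟩ := hm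
  simp only [List.nodup_cons, List.mem_cons, List.not_mem_nil, or_false, not_or,
    List.nodup_nil, not_false_eq_true, and_true] at hnd
  obtain ⟨⟨nab, nac, nad, nax, nay⟩, ⟨nbc, nbd, nbx, nby⟩, ⟨ncd, ncx, ncy⟩, ⟨ndx, ndy⟩, nxy⟩ := hnd
  refine ⟨e.symm a, e.symm b, e.symm c, e.symm d, _, _, _, _, _, _, by simpa, by simpa, by simpa,
    by simpa, by simpa, by simpa, by simpa using List.nodup_reverse.2 hinj, h6, h5, h4, h3, h2, h1,
    ?_, ?_, ?_, ?_, ?_, ?_⟩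
  · rcases hab with rfl | rfl | rfl | rfl <;> simp [Finset.insert_subset_iff, mem_ofMask_triple, *]
  · rcases hac with rfl | rfl | rfl | rfl <;> simp [Finset.insert_subset_iff, mem_ofMask_triple, *]
  · rcases had with rfl | rfl | rfl | rfl <;> simp [Finset.insert_subset_iff, mem_ofMask_triple, *]
  · rcases hbc with rfl | rfl | rfl | rfl <;> simp [Finset.insert_subset_iff, mem_ofMask_triple, *]
  · rcases hbd with rfl | rfl | rfl | rfl <;> simp [Finset.insert_subset_iff, mem_ofMask_triple, *]
  · rcases hcd with rfl | rfl | rfl | rfl <;> simp [Finset.insert_subset_iff, mem_ofMask_triple, *]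

theorem hasBergeK4_of_bergeTest {N : ℕ}
    (hN : ∀ t, N.testBit t = true → t < 2 ^ 6 ∧ ofMask e t ∈ H) (h : bergeTest N = true) :
    HasBergeK4 H := by
  simp only [bergeTest, Bool.or_eq_true] at h
  rcases h with (((((((((((((h | h) | h) | h) | h) | h) | h) | h) | h) | h) | h) | h) | h) | h) | h
  · exact hasBergeK4_of_hasSDR e hN 0 1 2 3 4 5 (by decide) h
  · exact hasBergeK4_of_hasSDR e hN 0 1 2 4 3 5 (by decide) h
  · exact hasBergeK4_of_hasSDR e hN 0 1 3 4 2 5 (by decide) h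
  · exact hasBergeK4_of_hasSDR e hN 0 2 3 4 1 5 (by decide) h
  · exact hasBergeK4_of_hasSDR e hN 1 2 3 4 0 5 (by decide) h
  · exact hasBergeK4_of_hasSDR e hN 0 1 2 5 3 4 (by decide) h
  · exact hasBergeK4_of_hasSDR e hN 0 1 3 5 2 4 (by decide) h
  · exact hasBergeK4_of_hasSDR e hN 0 1 4 5 2 3 (by decide) h
  · exact hasBergeK4_of_hasSDR e hN 0 2 3 5 1 4 (by decide) h
  · exact hasBergeK4_of_hasSDR e hN 0 2 4 5 1 3 (by decide) h
  · exact hasBergeK4_of_hasSDR e hN 0 3 4 5 1 2 (by decide) h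
  · exact hasBergeK4_of_hasSDR e hN 1 2 3 5 0 4 (by decide) h
  · exact hasBergeK4_of_hasSDR e hN 1 2 4 5 0 3 (by decide) h
  · exact hasBergeK4_of_hasSDR e hN 1 3 4 5 0 2 (by decide) h
  · exact hasBergeK4_of_hasSDR e hN 2 3 4 5 0 1 (by decide) h

theorem card_le_countP (l : List ℕ) (hl : ∀ m ∈ l, m < 2 ^ 6) {K : Finset (Finset V)}
    (hK : K ⊆ H) (hKl : ∀ t ∈ K, ∃ m ∈ l, ofMask e m = t) :
    K.card ≤ l.countP fun m => m < 2 ^ 6 ∧ ofMask e m ∈ H := by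
  rw [List.countP_eq_length_filter]
  refine le_trans ?_ (List.toFinset_card_le _)
  refine le_trans (Finset.card_le_card (t := Finset.image (ofMask e) _) ?_) Finset.card_image_le
  intro t ht
  obtain ⟨m, hm, rfl⟩ := hKl t ht
  exact Finset.mem_image_of_mem _ (by simpa [hm, hK ht] using hl m hm)

theorem exists_ofMask_eq (t : Finset V) (ht : t.card = 3) :
    ∃ m ∈ if e.symm 5 ∈ t then triplesThrough else triplesAvoiding, ofMask e m = t := by
  have key : ∀ s : Finset (Fin 6), s.card = 3 →
      ∃ m ∈ if 5 ∈ s then triplesThrough else triplesAvoiding,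
        ofMask (Equiv.refl (Fin 6)) m = s := by
    decide +kernel
  obtain ⟨m, hm, hms⟩ := key (t.map e.toEmbedding) (by simpa using ht)
  refine ⟨m, by simpa [Equiv.eq_symm_apply, ← Equiv.eq_symm_apply] using hm, ?_⟩
  ext v
  have := Finset.ext_iff.1 hms (e v)
  rw [ofMask, Finset.mem_filter] at this
  simpa [ofMask] using this

theorem card_avoiding_le (hH : ∀ t ∈ H, t.card = 3) (hfree : ¬ HasBergeK4 H) :
    (H.filter (e.symm 5 ∉ ·)).card ≤ 5 := by
  by_contra! h
  obtain ⟨N, hN, h | h⟩ := exists_of_search 6 triplesAvoiding 0 search_six_avoiding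
    (X := fun m => m < 2 ^ 6 ∧ ofMask e m ∈ H) (by simp)
    (le_trans h (card_le_countP e _ (by decide) (Finset.filter_subset _ _) fun t ht => by
      obtain ⟨ht, h5⟩ := Finset.mem_filter.1 ht
      simpa [h5] using exists_ofMask_eq e t (hH t ht)))
  · simp at h
  · exact hfree (hasBergeK4_of_bergeTest e hN h)

theorem card_through_le (hH : ∀ t ∈ H, t.card = 3) (hfree : ¬ HasBergeK4 H)
    (h5 : 5 ≤ (H.filter (e.symm 5 ∉ ·)).card) : (H.filter (e.symm 5 ∈ ·)).card ≤ 3 := by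
  by_contra! h
  obtain ⟨N, hN, hs | hs⟩ := exists_of_search 5 triplesAvoiding 0 search_five_four
    (X := fun m => m < 2 ^ 6 ∧ ofMask e m ∈ H) (by simp)
    (le_trans h5 (card_le_countP e _ (by decide) (Finset.filter_subset _ _) fun t ht => by
      obtain ⟨ht, h5⟩ := Finset.mem_filter.1 ht
      simpa [h5] using exists_ofMask_eq e t (hH t ht)))
  · simp at hs
  obtain ⟨N, hN, hs | hs⟩ := exists_of_search 4 triplesThrough N hs hN
    (le_trans h (card_le_countP e _ (by decide) (Finset.filter_subset _ _) fun t ht => by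
      obtain ⟨ht, h5⟩ := Finset.mem_filter.1 ht
      simpa [h5] using exists_ofMask_eq e t (hH t ht)))
  · exact hfree (hasBergeK4_of_bergeTest e hN hs)
  · simp at hs

end Soundness

section Extremal

variable {V : Type*} [DecidableEq V] [Fintype V]

theorem card_le_eight_of_not_hasBergeK4 (hV : Fintype.card V = 6) {H : Finset (Finset V)}
    (hH : ∀ t ∈ H, t.card = 3) (hfree : ¬ HasBergeK4 H) : H.card ≤ 8 := by
  by_contra! h9
  have hsum : ∑ w : V, (H.filter (w ∉ ·)).card = 3 * H.card := by
    have := Finset.sum_card_bipartiteAbove_eq_sum_card_bipartiteBelow (s := Finset.univ) (t := H)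
      fun (w : V) t => w ∉ t
    simp only [Finset.bipartiteAbove, Finset.bipartiteBelow] at this
    rw [this, Finset.sum_const_nat (m := 3), mul_comm]
    intro t ht
    have : Finset.univ.filter (· ∉ t) = tᶜ := by ext; simp
    rw [this, Finset.card_compl, hV, hH t ht]
  obtain ⟨w, -, hw⟩ : ∃ w ∈ (Finset.univ : Finset V), 4 < (H.filter (w ∉ ·)).card := by
    refine Finset.exists_lt_of_sum_lt ?_
    rw [hsum, Finset.sum_const, Finset.card_univ, hV, smul_eq_mul]
    omega
  let f := Fintype.equivFinOfCardEq hV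
  let e : V ≃ Fin 6 := f.trans (Equiv.swap (f w) 5)
  have he : e.symm 5 = w := by simp [e]
  have h1 := card_avoiding_le e hH hfree
  have h2 := card_through_le e hH hfree (by rwa [he])
  have h3 := H.card_filter_add_card_filter_not (e.symm 5 ∈ ·)
  omega

theorem exists_card_eq_eight_not_hasBergeK4 (hV : Fintype.card V = 6) :
    ∃ H : Finset (Finset V), (∀ t ∈ H, t.card = 3) ∧ ¬ HasBergeK4 H ∧ H.card = 8 := by
  have e : V ≃ Fin 3 × Bool := Fintype.equivOfCardEq (by simp [hV])
  let T (f : Fin 3 → Bool) : Finset V := Finset.univ.filter fun v => (e v).2 = f (e v).1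
  have hT : ∀ f v, v ∈ T f ↔ (e v).2 = f (e v).1 := by simp [T]
  have hinj : Function.Injective T := fun f g h => funext fun i => by
    simpa [hT] using Finset.ext_iff.1 h (e.symm (i, f i))
  refine ⟨Finset.univ.image T, ?_, ?_, ?_⟩
  · simp only [Finset.mem_image, Finset.mem_univ, true_and, forall_exists_index,
      forall_apply_eq_imp_iff]
    intro f
    have : T f = Finset.univ.image fun i => e.symm (i, f i) := by
      ext v
      simp only [hT, Finset.mem_image, Finset.mem_univ, true_and, Equiv.symm_apply_eq]
      exact ⟨fun h => ⟨(e v).1, by rw [← h]⟩, by rintro ⟨i, h⟩; rw [← h]⟩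
    rw [this, Finset.card_image_of_injective _ fun i j h => by simpa using congrArg (Prod.fst ∘ e) h]
    simp
  · rintro ⟨v₁, v₂, v₃, v₄, e₁₂, e₁₃, e₁₄, e₂₃, e₂₄, e₃₄, n₁₂, n₁₃, n₁₄, n₂₃, n₂₄, n₃₄, -,
      m₁₂, m₁₃, m₁₄, m₂₃, m₂₄, m₃₄, s₁₂, s₁₃, s₁₄, s₂₃, s₂₄, s₃₄⟩
    have key : ∀ u v : V, ∀ t ∈ Finset.univ.image T, u ≠ v → {u, v} ⊆ t → (e u).1 ≠ (e v).1 := by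
      intro u v t ht huv hsub h
      obtain ⟨f, -, rfl⟩ := Finset.mem_image.1 ht
      simp only [Finset.insert_subset_iff, Finset.singleton_subset_iff, hT] at hsub
      exact huv (e.injective (Prod.ext h (by rw [hsub.1, hsub.2, h])))
    have pigeonhole : ∀ a b c d : Fin 3, a ≠ b → a ≠ c → a ≠ d → b ≠ c → b ≠ d → ¬ c ≠ d := by
      decide
    exact pigeonhole _ _ _ _ (key _ _ _ m₁₂ n₁₂ s₁₂) (key _ _ _ m₁₃ n₁₃ s₁₃)
      (key _ _ _ m₁₄ n₁₄ s₁₄) (key _ _ _ m₂₃ n₂₃ s₂₃) (key _ _ _ m₂₄ n₂₄ s₂₄)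
      (key _ _ _ m₃₄ n₃₄ s₃₄)
  · rw [Finset.card_image_of_injective _ hinj]
    simp

end Extremal

/-- The maximum number of triples in a Berge-`K₄`-free triple
system on a 6-element vertex set is `8`. -/
theorem turan_bergeK4_six
    (V : Type*) [DecidableEq V] [Fintype V] (hV : Fintype.card V = 6) :
    (∀ H : Finset (Finset V), (∀ t ∈ H, t.card = 3) → ¬ HasBergeK4 H →
      H.card ≤ 8) ∧
    (∃ H : Finset (Finset V), (∀ t ∈ H, t.card = 3) ∧ ¬ HasBergeK4 H ∧
      H.card = 8) :=
  ⟨fun _ => card_le_eight_of_not_hasBergeK4 hV, exists_card_eq_eight_not_hasBergeK4 hV⟩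
end
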